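/- (Existence of parabolic-bounded motions.) For any n ≥ 2, the planar (n+1)-body problem has parabolic-bounded motions: there exist solutions, defined for all forward time, such that the position of one of the bodies relative to the center of mass of the others goes to infinity with velocity tending to zero, while the relative positions of the remaining bodies around their center of mass evolve in a bounded motion. -/

import Mathlib

open Filter

noncomputable section

/-- The plane. -/
abbrev Plane := EuclideanSpace ℝ (Fin 2)

/-- The center of mass of the bodies other than the last one. -/
def centerMassOthers {n : ℕ} (m : Fin (n + 1) → ℝ)
    (q : ℝ → Fin (n + 1) → Plane) (t : ℝ) : Plane :=
  (∑ j ∈ Finset.univ.erase (Fin.last n), m j)⁻¹ •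
    ∑ j ∈ Finset.univ.erase (Fin.last n), m j • q t j

/-- The Newtonian gravitational acceleration exerted on body `i`. -/
def newtonAccel {n : ℕ} (m : Fin (n + 1) → ℝ)
    (q : ℝ → Fin (n + 1) → Plane) (t : ℝ) (i : Fin (n + 1)) : Plane :=
  ∑ j ∈ Finset.univ.erase i, (m j / ‖q t j - q t i‖ ^ 3) • (q t j - q t i)

namespace ParabolicBounded

open MeasureTheory Set

section Tails

variable {E : Type*} [NormedAddCommGroup E] [NormedSpace ℝ E]

/-- For `t ≥ t₀` this is `∫ s in Ioi t, h s`; it is differentiable on the whole line. -/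
def tailInt (t₀ : ℝ) (h : ℝ → E) (t : ℝ) : E :=
  (∫ s in Ioi t₀, h s) - ∫ s in t₀..t, h s

theorem hasDerivAt_integral_of_continuous [CompleteSpace E] {h : ℝ → E} (hh : Continuous h)
    (a t : ℝ) : HasDerivAt (fun t => ∫ s in a..t, h s) (h t) t :=
  intervalIntegral.integral_hasDerivAt_right (hh.intervalIntegrable _ _)
    hh.stronglyMeasurable.stronglyMeasurableAtFilter hh.continuousAt

theorem hasDerivAt_tailInt [CompleteSpace E] {h : ℝ → E} (hh : Continuous h) (t₀ t : ℝ) :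
    HasDerivAt (tailInt t₀ h) (-h t) t := by
  exact (hasDerivAt_integral_of_continuous hh t₀ t).const_sub (∫ s in Ioi t₀, h s)

theorem tailInt_eq {t₀ t : ℝ} {h : ℝ → E} (hi : IntegrableOn h (Ioi t₀)) (ht : t₀ ≤ t) :
    tailInt t₀ h t = ∫ s in Ioi t, h s := by
  have := intervalIntegral.integral_interval_add_Ioi hi (hi.mono_set (Ioi_subset_Ioi ht))
  rw [tailInt, ← this]; abel

omit [NormedSpace ℝ E] in
theorem integrableOn_of_rpow_bound {t₀ β D : ℝ} (h0 : 0 < t₀) (hβ : 1 < β) {h : ℝ → E}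
    (hh : Continuous h) (hb : ∀ s, t₀ ≤ s → ‖h s‖ ≤ D * s ^ (-β)) :
    IntegrableOn h (Ioi t₀) := by
  refine Integrable.mono' ((integrableOn_Ioi_rpow_of_lt (by linarith : -β < -1) h0).const_mul D)
    hh.aestronglyMeasurable ?_
  filter_upwards [ae_restrict_mem measurableSet_Ioi] with s hs using hb s (le_of_lt hs)

theorem norm_tailInt_le {t₀ t β D : ℝ} (h0 : 0 < t₀) (ht : t₀ ≤ t) (hβ : 1 < β) {h : ℝ → E}
    (hi : IntegrableOn h (Ioi t₀)) (hb : ∀ s, t ≤ s → ‖h s‖ ≤ D * s ^ (-β)) :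
    ‖tailInt t₀ h t‖ ≤ D * t ^ (1 - β) / (β - 1) := by
  have htpos : 0 < t := h0.trans_le ht
  rw [tailInt_eq hi ht]
  have h1 : IntegrableOn (fun s : ℝ => D * s ^ (-β)) (Ioi t) :=
    (integrableOn_Ioi_rpow_of_lt (by linarith : -β < -1) htpos).const_mul D
  refine (norm_integral_le_of_norm_le h1 ?_).trans (le_of_eq ?_)
  · filter_upwards [ae_restrict_mem measurableSet_Ioi] with s hs using hb s (le_of_lt hs)
  · rw [integral_const_mul, integral_Ioi_rpow_of_lt (by linarith) htpos,
      show -β + 1 = 1 - β by ring, show (1 - β) = -(β - 1) by ring]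
    rw [neg_div_neg_eq, mul_div_assoc]

theorem tailInt_sub {t₀ t : ℝ} {h g : ℝ → E} (hh : Continuous h) (hg : Continuous g)
    (hhi : IntegrableOn h (Ioi t₀)) (hgi : IntegrableOn g (Ioi t₀)) :
    tailInt t₀ h t - tailInt t₀ g t = tailInt t₀ (fun s => h s - g s) t := by
  simp only [tailInt]
  rw [integral_sub hhi hgi,
    intervalIntegral.integral_sub (hh.intervalIntegrable _ _) (hg.intervalIntegrable _ _)]
  abel

theorem norm_integral_le_sub_of_hasDerivAt [CompleteSpace E] {h : ℝ → E} (hh : Continuous h)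
    {a t : ℝ} (ht : a ≤ t) {B B' : ℝ → ℝ} (hB : ∀ s ∈ Icc a t, HasDerivAt B (B' s) s)
    (hb : ∀ s ∈ Icc a t, ‖h s‖ ≤ B' s) : ‖∫ s in a..t, h s‖ ≤ B t - B a := by
  have h1 : ∀ s, HasDerivAt (fun t => ∫ s in a..t, h s) (h s) s :=
    hasDerivAt_integral_of_continuous hh a
  refine image_norm_le_of_norm_deriv_right_le_deriv_boundary' (f' := h) (B' := B')
    (B := fun t => B t - B a) (fun s _ => (h1 s).continuousAt.continuousWithinAt)
    (fun s _ => (h1 s).hasDerivWithinAt) (by simp)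
    (fun s hs => ((hB s hs).continuousAt.sub continuousAt_const).continuousWithinAt)
    (fun s hs => ((hB s ⟨hs.1, hs.2.le⟩).sub_const _).hasDerivWithinAt)
    (fun s hs => hb s ⟨hs.1, hs.2.le⟩) ⟨ht, le_rfl⟩

end Tails

section Green

variable {E F : Type*} [NormedAddCommGroup E] [NormedSpace ℝ E]
  [NormedAddCommGroup F] [NormedSpace ℝ F]

/-- Continuous forcing terms decaying like `s⁻²` on `[t₀, ∞)`. -/
def IsForcing (t₀ : ℝ) (f : ℝ → E) : Prop :=
  Continuous f ∧ ∃ D : ℝ, ∀ s, t₀ ≤ s → ‖f s‖ ≤ D * s ^ (-2 : ℝ)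

/-- Operators on forcing terms which lose at most one power of `t`. -/
structure LosesOnePower (t₀ C : ℝ) (G : (ℝ → E) → ℝ → F) : Prop where
  zero : ∀ t, t₀ ≤ t → G (fun _ => 0) t = 0
  bound : ∀ f g, IsForcing t₀ f → IsForcing t₀ g → ∀ β D : ℝ, 9 / 5 ≤ β → β ≤ 2 →
    (∀ s, t₀ ≤ s → ‖f s - g s‖ ≤ D * s ^ (-β)) →
    ∀ t, t₀ ≤ t → ‖G f t - G g t‖ ≤ C * (D * t ^ (1 - β))

/-- `G` is a right inverse of `d/dt - A` on forcing terms, losing at most one power of `t`. -/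
structure IsGreen (A : E →L[ℝ] E) (t₀ C : ℝ) (G : (ℝ → E) → ℝ → E) : Prop
    extends LosesOnePower t₀ C G where
  hasDerivAt : ∀ f, IsForcing t₀ f → ∀ t, t₀ ≤ t → HasDerivAt (G f) (A (G f t) + f t) t

/-- The linear system `Y' = A Y + f` is solvable with decaying solutions. -/
def HasGreen (A : E →L[ℝ] E) : Prop :=
  ∃ C : ℝ, 0 ≤ C ∧ ∃ t₁ : ℝ, ∀ t₀, t₁ ≤ t₀ → 1 ≤ t₀ → ∃ G, IsGreen A t₀ C G

omit [NormedSpace ℝ E] [NormedSpace ℝ F] in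
theorem LosesOnePower.mono {t₀ C C' : ℝ} (h0 : 0 < t₀) {G : (ℝ → E) → ℝ → F}
    (hG : LosesOnePower t₀ C G) (hC : C ≤ C') : LosesOnePower t₀ C' G where
  zero := hG.zero
  bound f g hf hg β D h1 h2 hb t ht := by
    refine (hG.bound f g hf hg β D h1 h2 hb t ht).trans ?_
    have hD : 0 ≤ D := by
      have := (norm_nonneg _).trans (hb t₀ le_rfl)
      exact nonneg_of_mul_nonneg_left this (Real.rpow_pos_of_pos h0 _)
    exact mul_le_mul_of_nonneg_right hC
      (mul_nonneg hD (Real.rpow_nonneg (h0.le.trans ht) _))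

omit [NormedSpace ℝ E] [NormedSpace ℝ F] in
theorem LosesOnePower.add {t₀ C C' : ℝ} {G G' : (ℝ → E) → ℝ → F}
    (hG : LosesOnePower t₀ C G) (hG' : LosesOnePower t₀ C' G') :
    LosesOnePower t₀ (C + C') (fun f t => G f t + G' f t) where
  zero t ht := by simp [hG.zero t ht, hG'.zero t ht]
  bound f g hf hg β D h1 h2 hb t ht := by
    rw [add_sub_add_comm, add_mul]
    exact (norm_add_le _ _).trans (add_le_add (hG.bound f g hf hg β D h1 h2 hb t ht)
      (hG'.bound f g hf hg β D h1 h2 hb t ht))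

theorem LosesOnePower.clm_comp {t₀ C : ℝ} {G : (ℝ → E) → ℝ → E}
    (hG : LosesOnePower t₀ C G) (L : E →L[ℝ] F) :
    LosesOnePower t₀ (‖L‖ * C) (fun f t => L (G f t)) where
  zero t ht := by simp [hG.zero t ht]
  bound f g hf hg β D h1 h2 hb t ht := by
    rw [← map_sub, mul_assoc]
    exact (L.le_opNorm _).trans
      (mul_le_mul_of_nonneg_left (hG.bound f g hf hg β D h1 h2 hb t ht) (norm_nonneg _))

theorem IsForcing.smul {t₀ : ℝ} {f : ℝ → E} (hf : IsForcing t₀ f) {ψ : ℝ → ℝ}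
    (hψ : Continuous ψ) {B : ℝ} (hB : ∀ s, t₀ ≤ s → |ψ s| ≤ B) :
    IsForcing t₀ (fun s => ψ s • f s) := by
  obtain ⟨hc, D, hD⟩ := hf
  refine ⟨hψ.smul hc, B * D, fun s hs => ?_⟩
  rw [norm_smul, Real.norm_eq_abs, mul_assoc]
  exact mul_le_mul (hB s hs) (hD s hs) (norm_nonneg _) ((abs_nonneg _).trans (hB s hs))

omit [NormedSpace ℝ E] in
theorem IsForcing.integrableOn {t₀ : ℝ} (h0 : 0 < t₀) {f : ℝ → E} (hf : IsForcing t₀ f) :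
    IntegrableOn f (Ioi t₀) := by
  obtain ⟨hc, D, hD⟩ := hf
  exact integrableOn_of_rpow_bound h0 (by norm_num) hc hD

theorem losesOnePower_tail {t₀ B : ℝ} (h0 : 0 < t₀) {φ ψ : ℝ → ℝ} (hψ : Continuous ψ)
    (hB : ∀ s, t₀ ≤ s → |ψ s| ≤ B) (hφψ : ∀ t s, t₀ ≤ t → t ≤ s → |φ t| * |ψ s| ≤ 1) :
    LosesOnePower t₀ 2 (fun (f : ℝ → E) t => φ t • tailInt t₀ (fun s => ψ s • f s) t) where
  zero t ht := by simp [tailInt]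
  bound f g hf hg β D h1 h2 hb t ht := by
    have hf' := hf.smul hψ hB
    have hg' := hg.smul hψ hB
    have htp : 0 < t := h0.trans_le ht
    have hD : 0 ≤ D := by
      have := (norm_nonneg _).trans (hb t₀ le_rfl)
      exact nonneg_of_mul_nonneg_left this (Real.rpow_pos_of_pos h0 _)
    rw [← smul_sub, tailInt_sub hf'.1 hg'.1 (hf'.integrableOn h0) (hg'.integrableOn h0)]
    have hint : IntegrableOn (fun s => ψ s • f s - ψ s • g s) (Ioi t₀) :=
      (hf'.integrableOn h0).sub (hg'.integrableOn h0)
    have key : ‖tailInt t₀ (fun s => φ t • (ψ s • f s - ψ s • g s)) t‖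
        ≤ D * t ^ (1 - β) / (β - 1) := by
      refine norm_tailInt_le h0 ht (by linarith) (hint.smul (φ t)) fun s hs => ?_
      rw [← smul_sub, norm_smul, norm_smul, ← mul_assoc, Real.norm_eq_abs, Real.norm_eq_abs]
      calc |φ t| * |ψ s| * ‖f s - g s‖ ≤ 1 * ‖f s - g s‖ :=
            mul_le_mul_of_nonneg_right (hφψ t s ht hs) (norm_nonneg _)
        _ ≤ D * s ^ (-β) := by rw [one_mul]; exact hb s (ht.trans hs)
    have hpull : tailInt t₀ (fun s => φ t • (ψ s • f s - ψ s • g s)) t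
        = φ t • tailInt t₀ (fun s => ψ s • f s - ψ s • g s) t := by
      simp only [tailInt]
      rw [integral_smul, intervalIntegral.integral_smul, smul_sub]
    rw [← hpull]
    refine key.trans ?_
    have hX : 0 ≤ D * t ^ (1 - β) := mul_nonneg hD (Real.rpow_nonneg htp.le _)
    rw [div_le_iff₀ (by linarith)]
    nlinarith

theorem losesOnePower_forward [CompleteSpace E] {t₀ σ : ℝ} (hσ : 0 < σ) (h0 : 2 / σ ≤ t₀) :
    LosesOnePower t₀ 1 (fun (f : ℝ → E) t =>
      Real.exp (-σ * t) • ∫ s in t₀..t, Real.exp (σ * s) • f s) where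
  zero t ht := by simp
  bound f g hf hg β D h1 h2 hb t ht := by
    have h0p : 0 < t₀ := lt_of_lt_of_le (by positivity) h0
    have hce : Continuous fun s => Real.exp (σ * s) := by fun_prop
    have hcf : Continuous fun s => Real.exp (σ * s) • f s := hce.smul hf.1
    have hcg : Continuous fun s => Real.exp (σ * s) • g s := hce.smul hg.1
    have hcfg : Continuous fun s => Real.exp (σ * s) • f s - Real.exp (σ * s) • g s :=
      hcf.sub hcg
    have hD : 0 ≤ D := by
      have := (norm_nonneg _).trans (hb t₀ le_rfl)
      exact nonneg_of_mul_nonneg_left this (Real.rpow_pos_of_pos h0p _)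
    rw [← smul_sub, ← intervalIntegral.integral_sub (hcf.intervalIntegrable _ _)
      (hcg.intervalIntegrable _ _), norm_smul, Real.norm_eq_abs, Real.abs_exp]
    have hder : ∀ s ∈ Icc t₀ t, HasDerivAt (fun s => D * (Real.exp (σ * s) * s ^ (1 - β)))
        (D * (Real.exp (σ * s) * σ * s ^ (1 - β)
          + Real.exp (σ * s) * ((1 - β) * s ^ (1 - β - 1)))) s := by
      intro s hs
      have hsp : 0 < s := h0p.trans_le hs.1
      have e1 : HasDerivAt (fun s => Real.exp (σ * s)) (Real.exp (σ * s) * σ) s := by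
        simpa using ((hasDerivAt_id s).const_mul σ).exp
      exact (e1.mul (Real.hasDerivAt_rpow_const (Or.inl hsp.ne'))).const_mul D
    have hbd : ‖∫ s in t₀..t, (Real.exp (σ * s) • f s - Real.exp (σ * s) • g s)‖
        ≤ D * (Real.exp (σ * t) * t ^ (1 - β)) := by
      have hneg : 0 ≤ D * (Real.exp (σ * t₀) * t₀ ^ (1 - β)) := by positivity
      have := norm_integral_le_sub_of_hasDerivAt hcfg ht hder fun s hs => by
        have hsp : 0 < s := h0p.trans_le hs.1
        rw [← smul_sub, norm_smul, Real.norm_eq_abs, Real.abs_exp]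
        have e2 : s ^ (1 - β) = s * s ^ (-β) := by
          rw [show 1 - β = 1 + -β by ring, Real.rpow_add hsp, Real.rpow_one]
        have e3 : 1 - β - 1 = -β := by ring
        have e4 : 2 ≤ σ * s := by
          rw [← div_le_iff₀' hσ]; exact h0.trans hs.1
        have e5 : 0 < s ^ (-β) := Real.rpow_pos_of_pos hsp _
        rw [e3, e2]
        calc Real.exp (σ * s) * ‖f s - g s‖ ≤ Real.exp (σ * s) * (D * s ^ (-β)) :=
              mul_le_mul_of_nonneg_left (hb s hs.1) (Real.exp_pos _).le
          _ ≤ Real.exp (σ * s) * (D * s ^ (-β) * (σ * s + (1 - β))) := by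
              refine mul_le_mul_of_nonneg_left ?_ (Real.exp_pos _).le
              exact le_mul_of_one_le_right (mul_nonneg hD e5.le) (by linarith)
          _ = _ := by ring
      linarith
    calc Real.exp (-σ * t) * ‖∫ s in t₀..t, (Real.exp (σ * s) • f s - Real.exp (σ * s) • g s)‖
        ≤ Real.exp (-σ * t) * (D * (Real.exp (σ * t) * t ^ (1 - β))) :=
          mul_le_mul_of_nonneg_left hbd (Real.exp_pos _).le
      _ = (Real.exp (-σ * t) * Real.exp (σ * t)) * (D * t ^ (1 - β)) := by ring
      _ = 1 * (D * t ^ (1 - β)) := by rw [← Real.exp_add]; simp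

end Green
end ParabolicBounded

namespace ParabolicBounded

open MeasureTheory Set

section GreenBlocks

variable {E : Type*} [NormedAddCommGroup E] [NormedSpace ℝ E]

/-- The solution of `Y' = σ Y + f` decaying at infinity. -/
def unstableOp (t₀ σ : ℝ) (f : ℝ → E) (t : ℝ) : E :=
  (-Real.exp (σ * t)) • tailInt t₀ (fun s => Real.exp (-σ * s) • f s) t

/-- The solution of `Y' = -σ Y + f` vanishing at `t₀`. -/
def stableOp (t₀ σ : ℝ) (f : ℝ → E) (t : ℝ) : E :=
  Real.exp (-σ * t) • ∫ s in t₀..t, Real.exp (σ * s) • f s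

/-- The function `t ↦ -∫ s in Ioi t, cos (b (t - s)) f s`. -/
def cosOp (t₀ b : ℝ) (f : ℝ → E) (t : ℝ) : E :=
  (-Real.cos (b * t)) • tailInt t₀ (fun s => Real.cos (b * s) • f s) t
    + (-Real.sin (b * t)) • tailInt t₀ (fun s => Real.sin (b * s) • f s) t

/-- The function `t ↦ -∫ s in Ioi t, sin (b (t - s)) f s`. -/
def sinOp (t₀ b : ℝ) (f : ℝ → E) (t : ℝ) : E :=
  (-Real.sin (b * t)) • tailInt t₀ (fun s => Real.cos (b * s) • f s) t
    + Real.cos (b * t) • tailInt t₀ (fun s => Real.sin (b * s) • f s) t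

theorem losesOnePower_unstableOp {t₀ σ : ℝ} (h0 : 0 < t₀) (hσ : 0 < σ) :
    LosesOnePower t₀ 2 (unstableOp (E := E) t₀ σ) := by
  refine losesOnePower_tail (B := 1) h0 (by fun_prop) (fun s hs => ?_) (fun t s ht hs => ?_)
  · rw [Real.abs_exp, Real.exp_le_one_iff]; nlinarith
  · rw [abs_neg, Real.abs_exp, Real.abs_exp, ← Real.exp_add, Real.exp_le_one_iff]; nlinarith

theorem losesOnePower_cosOp {t₀ : ℝ} (b : ℝ) (h0 : 0 < t₀) :
    LosesOnePower t₀ (2 + 2) (cosOp (E := E) t₀ b) := by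
  refine LosesOnePower.add ?_ ?_
  · refine losesOnePower_tail (B := 1) h0 (by fun_prop) (fun s hs => Real.abs_cos_le_one _)
      (fun t s ht hs => ?_)
    rw [abs_neg]
    exact mul_le_one₀ (Real.abs_cos_le_one _) (abs_nonneg _) (Real.abs_cos_le_one _)
  · refine losesOnePower_tail (B := 1) h0 (by fun_prop) (fun s hs => Real.abs_sin_le_one _)
      (fun t s ht hs => ?_)
    rw [abs_neg]
    exact mul_le_one₀ (Real.abs_sin_le_one _) (abs_nonneg _) (Real.abs_sin_le_one _)

theorem losesOnePower_sinOp {t₀ : ℝ} (b : ℝ) (h0 : 0 < t₀) :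
    LosesOnePower t₀ (2 + 2) (sinOp (E := E) t₀ b) := by
  refine LosesOnePower.add ?_ ?_
  · refine losesOnePower_tail (B := 1) h0 (by fun_prop) (fun s hs => Real.abs_cos_le_one _)
      (fun t s ht hs => ?_)
    rw [abs_neg]
    exact mul_le_one₀ (Real.abs_sin_le_one _) (abs_nonneg _) (Real.abs_cos_le_one _)
  · refine losesOnePower_tail (B := 1) h0 (by fun_prop) (fun s hs => Real.abs_sin_le_one _)
      (fun t s ht hs => ?_)
    exact mul_le_one₀ (Real.abs_cos_le_one _) (abs_nonneg _) (Real.abs_sin_le_one _)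

variable [CompleteSpace E]

theorem hasDerivAt_unstableOp {t₀ : ℝ} (σ : ℝ) {f : ℝ → E} (hf : Continuous f) (t : ℝ) :
    HasDerivAt (unstableOp t₀ σ f) (σ • unstableOp t₀ σ f t + f t) t := by
  have hc : Continuous fun s => Real.exp (-σ * s) • f s := by fun_prop
  have h1 : HasDerivAt (fun s => -Real.exp (σ * s)) (-(Real.exp (σ * t) * σ)) t := by
    simpa using (((hasDerivAt_id t).const_mul σ).exp).fun_neg
  convert! h1.smul (hasDerivAt_tailInt hc t₀ t) using 1
  have h2 : f t = (Real.exp (σ * t) * Real.exp (-σ * t)) • f t := by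
    rw [← Real.exp_add]; simp
  conv_lhs => rw [h2]
  simp only [unstableOp]
  module

theorem hasDerivAt_stableOp {t₀ : ℝ} (σ : ℝ) {f : ℝ → E} (hf : Continuous f) (t : ℝ) :
    HasDerivAt (stableOp t₀ σ f) (-σ • stableOp t₀ σ f t + f t) t := by
  have hc : Continuous fun s => Real.exp (σ * s) • f s := by fun_prop
  have h1 : HasDerivAt (fun s => Real.exp (-σ * s)) (Real.exp (-σ * t) * -σ) t := by
    simpa using (((hasDerivAt_id t).const_mul (-σ)).exp)
  convert! h1.smul (hasDerivAt_integral_of_continuous hc t₀ t) using 1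
  have h2 : Real.exp (-σ * t) * Real.exp (σ * t) = 1 := by rw [← Real.exp_add]; simp
  simp only [stableOp, smul_smul, h2, one_smul]
  rw [mul_comm (-σ)]; abel

theorem hasDerivAt_cosOp {t₀ : ℝ} (b : ℝ) {f : ℝ → E} (hf : Continuous f) (t : ℝ) :
    HasDerivAt (cosOp t₀ b f) (f t - b • sinOp t₀ b f t) t := by
  have hc : Continuous fun s => Real.cos (b * s) • f s := by fun_prop
  have hs : Continuous fun s => Real.sin (b * s) • f s := by fun_prop
  have h1 : HasDerivAt (fun s => -Real.cos (b * s)) (Real.sin (b * t) * b) t := by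
    simpa using (((hasDerivAt_id t).const_mul b).cos).fun_neg
  have h2 : HasDerivAt (fun s => -Real.sin (b * s)) (-(Real.cos (b * t) * b)) t := by
    simpa using (((hasDerivAt_id t).const_mul b).sin).fun_neg
  convert! (h1.smul (hasDerivAt_tailInt hc t₀ t)).add
    (h2.smul (hasDerivAt_tailInt hs t₀ t)) using 1
  have h3 : f t = (Real.cos (b * t) ^ 2 + Real.sin (b * t) ^ 2) • f t := by
    rw [Real.cos_sq_add_sin_sq, one_smul]
  conv_lhs => rw [h3]
  simp only [sinOp]
  module

theorem hasDerivAt_sinOp {t₀ : ℝ} (b : ℝ) {f : ℝ → E} (hf : Continuous f) (t : ℝ) :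
    HasDerivAt (sinOp t₀ b f) (b • cosOp t₀ b f t) t := by
  have hc : Continuous fun s => Real.cos (b * s) • f s := by fun_prop
  have hs : Continuous fun s => Real.sin (b * s) • f s := by fun_prop
  have h1 : HasDerivAt (fun s => Real.cos (b * s)) (-(Real.sin (b * t) * b)) t := by
    simpa using (((hasDerivAt_id t).const_mul b).cos)
  have h2 : HasDerivAt (fun s => -Real.sin (b * s)) (-(Real.cos (b * t) * b)) t := by
    simpa using (((hasDerivAt_id t).const_mul b).sin).fun_neg
  convert! (h2.smul (hasDerivAt_tailInt hc t₀ t)).add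
    (h1.smul (hasDerivAt_tailInt hs t₀ t)) using 1
  simp only [cosOp]
  module

/-- Linear systems with spectrum `{0, ± i}` and semisimple matrix. -/
theorem hasGreen_of_cube {A : E →L[ℝ] E} (hA : ∀ x, A (A (A x)) = -A x) : HasGreen A := by
  set P : E →L[ℝ] E := ContinuousLinearMap.id ℝ E + A ∘L A with hP
  set R : E →L[ℝ] E := -(A ∘L A) with hR
  refine ⟨‖P‖ * (2 + 2) + ‖R‖ * (2 + 2) + ‖R ∘L A‖ * (2 + 2), by positivity, 1,
    fun t₀ _ h0 => ⟨fun f t => P (cosOp t₀ 0 f t) + R (cosOp t₀ 1 f t)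
      + (R ∘L A) (sinOp t₀ 1 f t), ?_, fun f hf t ht => ?_⟩⟩
  · have h0' : 0 < t₀ := by linarith
    exact (((losesOnePower_cosOp 0 h0').clm_comp P).add
      ((losesOnePower_cosOp 1 h0').clm_comp R)).add
      ((losesOnePower_sinOp 1 h0').clm_comp (R ∘L A))
  · convert! ((P.hasFDerivAt.comp_hasDerivAt t (hasDerivAt_cosOp 0 hf.1 t)).add
      (R.hasFDerivAt.comp_hasDerivAt t (hasDerivAt_cosOp 1 hf.1 t))).add
      ((R ∘L A).hasFDerivAt.comp_hasDerivAt t (hasDerivAt_sinOp 1 hf.1 t)) using 1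
    simp [hP, hR, hA]
    abel

/-- Linear systems with spectrum `{± σ, ± i b}`. -/
theorem hasGreen_of_saddle_center {A : E →L[ℝ] E} {σ b : ℝ} (hσ : 0 < σ) (hb : 0 < b)
    (hA : ∀ x, A (A (A (A x))) = (σ ^ 2 - b ^ 2) • A (A x) + (σ ^ 2 * b ^ 2) • x) :
    HasGreen A := by
  have hq : σ ^ 2 + b ^ 2 ≠ 0 := by positivity
  set I : E →L[ℝ] E := ContinuousLinearMap.id ℝ E with hI
  set S : E →L[ℝ] E := (σ ^ 2 + b ^ 2)⁻¹ • (A ∘L A + b ^ 2 • I) with hS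
  set P : E →L[ℝ] E := ((1 / 2 : ℝ) • (I + σ⁻¹ • A)) ∘L S with hP
  set M : E →L[ℝ] E := ((1 / 2 : ℝ) • (I - σ⁻¹ • A)) ∘L S with hM
  set R : E →L[ℝ] E := (σ ^ 2 + b ^ 2)⁻¹ • (σ ^ 2 • I - A ∘L A) with hR
  refine ⟨‖P‖ * 2 + ‖M‖ * 1 + ‖R‖ * (2 + 2) + ‖b⁻¹ • R ∘L A‖ * (2 + 2), by positivity, 2 / σ,
    fun t₀ h1 h0 => ⟨fun f t => P (unstableOp t₀ σ f t) + M (stableOp t₀ σ f t)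
      + R (cosOp t₀ b f t) + (b⁻¹ • R ∘L A) (sinOp t₀ b f t), ?_, fun f hf t ht => ?_⟩⟩
  · have h0' : 0 < t₀ := by linarith
    exact ((((losesOnePower_unstableOp h0' hσ).clm_comp P).add
      ((losesOnePower_forward hσ h1).clm_comp M)).add
      ((losesOnePower_cosOp b h0').clm_comp R)).add
      ((losesOnePower_sinOp b h0').clm_comp (b⁻¹ • R ∘L A))
  · convert! (((P.hasFDerivAt.comp_hasDerivAt t (hasDerivAt_unstableOp σ hf.1 t)).add
      (M.hasFDerivAt.comp_hasDerivAt t (hasDerivAt_stableOp σ hf.1 t))).add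
      (R.hasFDerivAt.comp_hasDerivAt t (hasDerivAt_cosOp b hf.1 t))).add
      ((b⁻¹ • R ∘L A).hasFDerivAt.comp_hasDerivAt t (hasDerivAt_sinOp b hf.1 t)) using 1
    simp only [hP, hM, hR, hS, hI, ContinuousLinearMap.comp_apply, smul_apply,
      add_apply, sub_apply, ContinuousLinearMap.id_apply,
      map_add, map_sub, map_smul, hA]
    match_scalars <;> field_simp <;> ring

omit [CompleteSpace E] in
/-- Block diagonal systems. -/
theorem hasGreen_pi {ι : Type*} [Fintype ι] {A : ι → E →L[ℝ] E} (hA : ∀ i, HasGreen (A i)) :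
    HasGreen (ContinuousLinearMap.pi fun i => A i ∘L ContinuousLinearMap.proj i) := by
  choose C hC t₁ h using hA
  refine ⟨∑ i, C i, Finset.sum_nonneg fun i _ => hC i, ∑ i, |t₁ i|, fun t₀ h1 h0 => ?_⟩
  have h2 : ∀ i, t₁ i ≤ t₀ := fun i =>
    (le_abs_self _).trans ((Finset.single_le_sum (f := fun i => |t₁ i|)
      (fun i _ => abs_nonneg _) (Finset.mem_univ i)).trans h1)
  choose G hG using fun i => h i t₀ (h2 i) h0
  have hproj : ∀ {f : ℝ → ι → E}, IsForcing t₀ f → ∀ i, IsForcing t₀ (fun s => f s i) := by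
    rintro f ⟨hc, D, hD⟩ i
    exact ⟨(continuous_apply i).comp hc, D, fun s hs => (norm_le_pi_norm _ i).trans (hD s hs)⟩
  refine ⟨fun f t i => G i (fun s => f s i) t, ⟨fun t ht => ?_, ?_⟩, fun f hf t ht => ?_⟩
  · funext i
    exact (hG i).zero t ht
  · intro f g hf hg β D hβ1 hβ2 hb t ht
    have h0' : 0 < t₀ := by linarith
    have hD : 0 ≤ D := by
      have := (norm_nonneg _).trans (hb t₀ le_rfl)
      exact nonneg_of_mul_nonneg_left this (Real.rpow_pos_of_pos h0' _)
    have hX : 0 ≤ D * t ^ (1 - β) := mul_nonneg hD (Real.rpow_nonneg (h0'.le.trans ht) _)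
    refine (pi_norm_le_iff_of_nonneg
      (mul_nonneg (Finset.sum_nonneg fun i _ => hC i) hX)).2 fun i => ?_
    refine ((hG i).bound _ _ (hproj hf i) (hproj hg i) β D hβ1 hβ2
      (fun s hs => (norm_le_pi_norm (f s - g s) i).trans (hb s hs)) t ht).trans ?_
    exact mul_le_mul_of_nonneg_right
      (Finset.single_le_sum (fun i _ => hC i) (Finset.mem_univ i)) hX
  · rw [hasDerivAt_pi]
    intro i
    exact (hG i).hasDerivAt _ (hproj hf i) t ht

end GreenBlocks
end ParabolicBounded

namespace ParabolicBounded

open MeasureTheory Set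

/-- The linearization of one block of the inner problem at a relative equilibrium. -/
def blockOp (c lam : ℝ) : ℂ × ℂ →L[ℝ] ℂ × ℂ :=
  LinearMap.toContinuousLinearMap
    { toFun := fun x => (x.2 - Complex.I * x.1 - ((c * (x.2.im - x.1.re) : ℝ) : ℂ) * Complex.I,
        (lam : ℂ) * (2 * x.1.re - Complex.I * x.1.im) - Complex.I * x.2
          + ((c * (x.2.im - x.1.re) : ℝ) : ℂ))
      map_add' := fun x y => by
        refine Prod.ext ?_ ?_ <;> apply Complex.ext <;> simp <;> ring
      map_smul' := fun r x => by
        refine Prod.ext ?_ ?_ <;> apply Complex.ext <;> simp <;> ring }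

theorem blockOp_apply (c lam : ℝ) (x : ℂ × ℂ) : blockOp c lam x =
    (x.2 - Complex.I * x.1 - ((c * (x.2.im - x.1.re) : ℝ) : ℂ) * Complex.I,
        (lam : ℂ) * (2 * x.1.re - Complex.I * x.1.im) - Complex.I * x.2
          + ((c * (x.2.im - x.1.re) : ℝ) : ℂ)) := rfl

theorem hasGreen_blockOp_one : HasGreen (blockOp 1 1) := by
  refine hasGreen_of_cube fun x => ?_
  refine Prod.ext ?_ ?_ <;> apply Complex.ext <;> simp [blockOp_apply] <;> ring

theorem hasGreen_blockOp_zero {lam : ℝ} (hlam : 1 < lam) : HasGreen (blockOp 0 lam) := by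
  have h1 : 0 ≤ 9 * lam ^ 2 - 8 * lam := by nlinarith
  set d := √(9 * lam ^ 2 - 8 * lam) with hd
  have hd2 : d ^ 2 = 9 * lam ^ 2 - 8 * lam := Real.sq_sqrt h1
  have hd0 : 0 ≤ d := Real.sqrt_nonneg _
  have hdp : |lam - 2| < d := by
    apply abs_lt_of_sq_lt_sq _ hd0
    nlinarith
  obtain ⟨hda, hdb⟩ := abs_lt.1 hdp
  have hs : 0 < (d + (lam - 2)) / 2 := by linarith
  have hb : 0 < (d - (lam - 2)) / 2 := by linarith
  refine hasGreen_of_saddle_center (Real.sqrt_pos.2 hs) (Real.sqrt_pos.2 hb) fun x => ?_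
  rw [Real.sq_sqrt hs.le, Real.sq_sqrt hb.le]
  have e1 : (d + (lam - 2)) / 2 - (d - (lam - 2)) / 2 = lam - 2 := by ring
  have e2 : (d + (lam - 2)) / 2 * ((d - (lam - 2)) / 2) = (1 + 2 * lam) * (lam - 1) := by
    nlinarith
  rw [e1, e2]
  refine Prod.ext ?_ ?_ <;> apply Complex.ext <;> simp [blockOp_apply] <;> ring

end ParabolicBounded

namespace ParabolicBounded

open MeasureTheory Set

section Outer

/-- The power `s ^ p`, frozen for `s ≤ t₀`. -/
def frozenPow (t₀ p s : ℝ) : ℝ := max s t₀ ^ p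

theorem continuous_frozenPow {t₀ : ℝ} (h0 : 0 < t₀) (p : ℝ) : Continuous (frozenPow t₀ p) :=
  (continuous_id.max continuous_const).rpow_const fun _ => Or.inl (lt_max_of_lt_right h0).ne'

theorem continuous_frozenPow_mul {t₀ : ℝ} (h0 : 0 < t₀) (p : ℝ) {f : ℝ → ℝ}
    (hf : Continuous f) : Continuous fun s => frozenPow t₀ p s * f s :=
  (continuous_frozenPow h0 p).mul hf

theorem frozenPow_eq {t₀ s : ℝ} (hs : t₀ ≤ s) (p : ℝ) : frozenPow t₀ p s = s ^ p := by
  rw [frozenPow, max_eq_left hs]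

/-- Continuous real functions of size `O(s ^ (-9/5))` on `[t₀, ∞)`. -/
def IsOuterForcing (t₀ : ℝ) (f : ℝ → ℝ) : Prop :=
  Continuous f ∧ ∃ D : ℝ, ∀ s, t₀ ≤ s → |f s| ≤ D * s ^ (-(9 / 5) : ℝ)

/-- `∫ s in Ioi t, s ^ p * f s`. -/
def powTail (t₀ p : ℝ) (f : ℝ → ℝ) : ℝ → ℝ := tailInt t₀ fun s => frozenPow t₀ p s * f s

/-- `∫ s in t₀..t, s ^ p * f s`. -/
def powInt (t₀ p : ℝ) (f : ℝ → ℝ) (t : ℝ) : ℝ := ∫ s in t₀..t, frozenPow t₀ p s * f s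

theorem frozenPow_mul_bound {t₀ D : ℝ} (h0 : 0 < t₀) {f : ℝ → ℝ}
    (hD : ∀ s, t₀ ≤ s → |f s| ≤ D * s ^ (-(9 / 5) : ℝ)) (p s : ℝ) (hs : t₀ ≤ s) :
    ‖frozenPow t₀ p s * f s‖ ≤ D * s ^ (-(9 / 5 - p)) := by
  have hs0 : 0 < s := h0.trans_le hs
  rw [norm_mul, frozenPow_eq hs, Real.norm_of_nonneg (Real.rpow_nonneg hs0.le _),
    Real.norm_eq_abs]
  calc s ^ p * |f s| ≤ s ^ p * (D * s ^ (-(9 / 5) : ℝ)) :=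
        mul_le_mul_of_nonneg_left (hD s hs) (Real.rpow_nonneg hs0.le _)
    _ = D * (s ^ p * s ^ (-(9 / 5) : ℝ)) := by ring
    _ = _ := by rw [← Real.rpow_add hs0]; ring_nf

theorem IsOuterForcing.integrableOn {t₀ : ℝ} (h0 : 0 < t₀) {f : ℝ → ℝ}
    (hf : IsOuterForcing t₀ f) {p : ℝ} (hp : p < 4 / 5) :
    IntegrableOn (fun s => frozenPow t₀ p s * f s) (Ioi t₀) := by
  obtain ⟨hc, D, hD⟩ := hf
  exact integrableOn_of_rpow_bound h0 (by linarith) (continuous_frozenPow_mul h0 p hc)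
    (frozenPow_mul_bound h0 hD p)

theorem hasDerivAt_powTail {t₀ : ℝ} (h0 : 0 < t₀) {f : ℝ → ℝ} (hf : Continuous f) (p : ℝ)
    {t : ℝ} (ht : t₀ ≤ t) : HasDerivAt (powTail t₀ p f) (-(t ^ p * f t)) t := by
  rw [← frozenPow_eq ht]
  exact hasDerivAt_tailInt (continuous_frozenPow_mul h0 p hf) t₀ t

theorem hasDerivAt_powInt {t₀ : ℝ} (h0 : 0 < t₀) {f : ℝ → ℝ} (hf : Continuous f) (p : ℝ)
    {t : ℝ} (ht : t₀ ≤ t) : HasDerivAt (powInt t₀ p f) (t ^ p * f t) t := by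
  rw [← frozenPow_eq ht]
  exact hasDerivAt_integral_of_continuous (continuous_frozenPow_mul h0 p hf) t₀ t

theorem powTail_sub {t₀ : ℝ} (h0 : 0 < t₀) {f g : ℝ → ℝ} (hf : IsOuterForcing t₀ f)
    (hg : IsOuterForcing t₀ g) {p : ℝ} (hp : p < 4 / 5) (t : ℝ) :
    powTail t₀ p (fun s => f s - g s) t = powTail t₀ p f t - powTail t₀ p g t := by
  rw [powTail, powTail, powTail, tailInt_sub (continuous_frozenPow_mul h0 p hf.1)
    (continuous_frozenPow_mul h0 p hg.1) (hf.integrableOn h0 hp) (hg.integrableOn h0 hp)]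
  simp only [mul_sub]

theorem powInt_sub {t₀ : ℝ} (h0 : 0 < t₀) {f g : ℝ → ℝ} (hf : Continuous f)
    (hg : Continuous g) (p t : ℝ) :
    powInt t₀ p (fun s => f s - g s) t = powInt t₀ p f t - powInt t₀ p g t := by
  rw [powInt, powInt, powInt, ← intervalIntegral.integral_sub
    ((continuous_frozenPow_mul h0 p hf).intervalIntegrable _ _)
    ((continuous_frozenPow_mul h0 p hg).intervalIntegrable _ _)]
  simp only [mul_sub]

theorem abs_powTail_le {t₀ D : ℝ} (h0 : 0 < t₀) {f : ℝ → ℝ} (hf : Continuous f)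
    (hD : ∀ s, t₀ ≤ s → |f s| ≤ D * s ^ (-(9 / 5) : ℝ)) {p : ℝ} (hp : p < 4 / 5)
    {t : ℝ} (ht : t₀ ≤ t) :
    |powTail t₀ p f t| ≤ D * t ^ (p - 4 / 5) / (4 / 5 - p) := by
  have := norm_tailInt_le (β := 9 / 5 - p) h0 ht (by linarith)
    (IsOuterForcing.integrableOn h0 ⟨hf, D, hD⟩ hp)
    (fun s hs => frozenPow_mul_bound h0 hD p s (ht.trans hs))
  rw [show 1 - (9 / 5 - p) = p - 4 / 5 by ring, show 9 / 5 - p - 1 = 4 / 5 - p by ring] at this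
  exact this

theorem abs_powInt_le {t₀ D : ℝ} (h0 : 0 < t₀) {f : ℝ → ℝ} (hf : Continuous f)
    (hD : ∀ s, t₀ ≤ s → |f s| ≤ D * s ^ (-(9 / 5) : ℝ)) {p : ℝ} (hp : 4 / 5 < p)
    {t : ℝ} (ht : t₀ ≤ t) :
    |powInt t₀ p f t| ≤ D * t ^ (p - 4 / 5) / (p - 4 / 5) := by
  have hD0 : 0 ≤ D := nonneg_of_mul_nonneg_left ((abs_nonneg _).trans (hD t₀ le_rfl))
    (Real.rpow_pos_of_pos h0 _)
  have hp' : 0 < p - 4 / 5 := by linarith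
  have := norm_integral_le_sub_of_hasDerivAt (continuous_frozenPow_mul h0 p hf) ht
    (B := fun s => D * s ^ (p - 4 / 5) / (p - 4 / 5)) (B' := fun s => D * s ^ (-(9 / 5 - p)))
    (fun s hs => ?_) (fun s hs => frozenPow_mul_bound h0 hD p s hs.1)
  · refine this.trans (sub_le_self _ ?_)
    have := Real.rpow_nonneg h0.le (p - 4 / 5)
    positivity
  · have hs0 : 0 < s := h0.trans_le hs.1
    convert! (((Real.hasDerivAt_rpow_const (p := p - 4 / 5) (Or.inl hs0.ne')).const_mul D).div_const
      (p - 4 / 5)) using 1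
    rw [show p - 4 / 5 - 1 = -(9 / 5 - p) by ring]
    rw [← mul_assoc, mul_right_comm, mul_div_assoc, div_self hp'.ne', mul_one]

/-- Solution operator for `x'' = (4/9) t⁻² x + f`. -/
def radialOp (t₀ : ℝ) (f : ℝ → ℝ) (t : ℝ) : ℝ :=
  -(3 / 5) * (t ^ (4 / 3 : ℝ) * powTail t₀ (-(1 / 3)) f t
    + t ^ (-(1 / 3) : ℝ) * powInt t₀ (4 / 3) f t)

/-- The derivative of `radialOp`. -/
def radialVel (t₀ : ℝ) (f : ℝ → ℝ) (t : ℝ) : ℝ :=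
  -(3 / 5) * ((4 / 3) * t ^ (1 / 3 : ℝ) * powTail t₀ (-(1 / 3)) f t
    - (1 / 3) * t ^ (-(4 / 3) : ℝ) * powInt t₀ (4 / 3) f t)

/-- Solution operator for `y'' = -(2/9) t⁻² y + f`. -/
def transOp (t₀ : ℝ) (f : ℝ → ℝ) (t : ℝ) : ℝ :=
  3 * (t ^ (1 / 3 : ℝ) * powTail t₀ (2 / 3) f t - t ^ (2 / 3 : ℝ) * powTail t₀ (1 / 3) f t)

/-- The derivative of `transOp`. -/
def transVel (t₀ : ℝ) (f : ℝ → ℝ) (t : ℝ) : ℝ :=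
  3 * ((1 / 3) * t ^ (-(2 / 3) : ℝ) * powTail t₀ (2 / 3) f t
    - (2 / 3) * t ^ (-(1 / 3) : ℝ) * powTail t₀ (1 / 3) f t)

theorem hasDerivAt_rpow' {t : ℝ} (ht : 0 < t) (p q : ℝ) (h : p - 1 = q) :
    HasDerivAt (fun s : ℝ => s ^ p) (p * t ^ q) t := by
  rw [← h]; exact Real.hasDerivAt_rpow_const (Or.inl ht.ne')

theorem hasDerivAt_radialOp {t₀ : ℝ} (h0 : 0 < t₀) {f : ℝ → ℝ} (hf : Continuous f)
    {t : ℝ} (ht : t₀ ≤ t) : HasDerivAt (radialOp t₀ f) (radialVel t₀ f t) t := by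
  have hp : 0 < t := h0.trans_le ht
  convert! (((hasDerivAt_rpow' hp (4 / 3) (1 / 3) (by norm_num)).mul
    (hasDerivAt_powTail h0 hf (-(1 / 3)) ht)).add
    ((hasDerivAt_rpow' hp (-(1 / 3)) (-(4 / 3)) (by norm_num)).mul
    (hasDerivAt_powInt h0 hf (4 / 3) ht))).const_mul (-(3 / 5)) using 1
  rw [radialVel]; ring

theorem hasDerivAt_radialVel {t₀ : ℝ} (h0 : 0 < t₀) {f : ℝ → ℝ} (hf : Continuous f)
    {t : ℝ} (ht : t₀ ≤ t) :
    HasDerivAt (radialVel t₀ f) (4 / 9 * t ^ (-2 : ℝ) * radialOp t₀ f t + f t) t := by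
  have hp : 0 < t := h0.trans_le ht
  convert! ((((hasDerivAt_rpow' hp (1 / 3) (-(2 / 3)) (by norm_num)).const_mul (4 / 3)).mul
    (hasDerivAt_powTail h0 hf (-(1 / 3)) ht)).sub
    (((hasDerivAt_rpow' hp (-(4 / 3)) (-(7 / 3)) (by norm_num)).const_mul (1 / 3)).mul
    (hasDerivAt_powInt h0 hf (4 / 3) ht))).const_mul (-(3 / 5)) using 1
  have e1 : t ^ (-2 : ℝ) * t ^ (4 / 3 : ℝ) = t ^ (-(2 / 3) : ℝ) := by
    rw [← Real.rpow_add hp]; norm_num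
  have e2 : t ^ (-2 : ℝ) * t ^ (-(1 / 3) : ℝ) = t ^ (-(7 / 3) : ℝ) := by
    rw [← Real.rpow_add hp]; norm_num
  have e3 : t ^ (1 / 3 : ℝ) * t ^ (-(1 / 3) : ℝ) = 1 := by
    rw [← Real.rpow_add hp]; norm_num
  have e4 : t ^ (-(4 / 3) : ℝ) * t ^ (4 / 3 : ℝ) = 1 := by
    rw [← Real.rpow_add hp]; norm_num
  rw [radialOp, ← e1, ← e2]
  linear_combination -(4 / 5) * f t * e3 - (1 / 5) * f t * e4

theorem hasDerivAt_transOp {t₀ : ℝ} (h0 : 0 < t₀) {f : ℝ → ℝ} (hf : Continuous f)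
    {t : ℝ} (ht : t₀ ≤ t) : HasDerivAt (transOp t₀ f) (transVel t₀ f t) t := by
  have hp : 0 < t := h0.trans_le ht
  convert! (((hasDerivAt_rpow' hp (1 / 3) (-(2 / 3)) (by norm_num)).mul
    (hasDerivAt_powTail h0 hf (2 / 3) ht)).sub
    ((hasDerivAt_rpow' hp (2 / 3) (-(1 / 3)) (by norm_num)).mul
    (hasDerivAt_powTail h0 hf (1 / 3) ht))).const_mul 3 using 1
  rw [transVel]; ring

theorem hasDerivAt_transVel {t₀ : ℝ} (h0 : 0 < t₀) {f : ℝ → ℝ} (hf : Continuous f)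
    {t : ℝ} (ht : t₀ ≤ t) :
    HasDerivAt (transVel t₀ f) (-(2 / 9) * t ^ (-2 : ℝ) * transOp t₀ f t + f t) t := by
  have hp : 0 < t := h0.trans_le ht
  convert! ((((hasDerivAt_rpow' hp (-(2 / 3)) (-(5 / 3)) (by norm_num)).const_mul (1 / 3)).mul
    (hasDerivAt_powTail h0 hf (2 / 3) ht)).sub
    (((hasDerivAt_rpow' hp (-(1 / 3)) (-(4 / 3)) (by norm_num)).const_mul (2 / 3)).mul
    (hasDerivAt_powTail h0 hf (1 / 3) ht))).const_mul 3 using 1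
  have e1 : t ^ (-2 : ℝ) * t ^ (1 / 3 : ℝ) = t ^ (-(5 / 3) : ℝ) := by
    rw [← Real.rpow_add hp]; norm_num
  have e2 : t ^ (-2 : ℝ) * t ^ (2 / 3 : ℝ) = t ^ (-(4 / 3) : ℝ) := by
    rw [← Real.rpow_add hp]; norm_num
  have e3 : t ^ (-(2 / 3) : ℝ) * t ^ (2 / 3 : ℝ) = 1 := by
    rw [← Real.rpow_add hp]; norm_num
  have e4 : t ^ (-(1 / 3) : ℝ) * t ^ (1 / 3 : ℝ) = 1 := by
    rw [← Real.rpow_add hp]; norm_num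
  rw [transOp, ← e1, ← e2]
  linear_combination f t * e3 - 2 * f t * e4

theorem abs_pow_combination_le {t D a b x y p q r : ℝ} (ht : 0 < t) {c d : ℝ}
    (hc : 0 ≤ c) (hd : 0 ≤ d) (ha : |a| ≤ c) (hb : |b| ≤ d) {r₁ r₂ e₁ e₂ : ℝ}
    (hx : |x| ≤ D * t ^ r₁ / e₁) (hy : |y| ≤ D * t ^ r₂ / e₂) (h1 : p + r₁ = r)
    (h2 : q + r₂ = r) :
    |a * t ^ p * x + b * t ^ q * y| ≤ (c / e₁ + d / e₂) * (D * t ^ r) := by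
  have hp := Real.rpow_nonneg ht.le p
  have hq := Real.rpow_nonneg ht.le q
  refine (abs_add_le _ _).trans ?_
  rw [abs_mul, abs_mul, abs_mul, abs_mul, abs_of_nonneg hp, abs_of_nonneg hq, add_mul]
  refine add_le_add ?_ ?_
  · calc |a| * t ^ p * |x| ≤ c * t ^ p * (D * t ^ r₁ / e₁) := by gcongr
      _ = _ := by rw [← h1, Real.rpow_add ht]; ring
  · calc |b| * t ^ q * |y| ≤ d * t ^ q * (D * t ^ r₂ / e₂) := by gcongr
      _ = _ := by rw [← h2, Real.rpow_add ht]; ring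

theorem abs_outer_le {t₀ D : ℝ} (h0 : 0 < t₀) {f : ℝ → ℝ} (hf : Continuous f)
    (hD : ∀ s, t₀ ≤ s → |f s| ≤ D * s ^ (-(9 / 5) : ℝ)) {t : ℝ} (ht : t₀ ≤ t) :
    |radialOp t₀ f t| ≤ 50 * (D * t ^ (1 / 5 : ℝ)) ∧
    |radialVel t₀ f t| ≤ 50 * (D * t ^ (-(4 / 5) : ℝ)) ∧
    |transOp t₀ f t| ≤ 50 * (D * t ^ (1 / 5 : ℝ)) ∧
    |transVel t₀ f t| ≤ 50 * (D * t ^ (-(4 / 5) : ℝ)) := by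
  have hp : 0 < t := h0.trans_le ht
  have hD0 : 0 ≤ D := nonneg_of_mul_nonneg_left ((abs_nonneg _).trans (hD t₀ le_rfl))
    (Real.rpow_pos_of_pos h0 _)
  have b1 := abs_powTail_le h0 hf hD (p := -(1 / 3)) (by norm_num) ht
  have b2 := abs_powInt_le h0 hf hD (p := 4 / 3) (by norm_num) ht
  have b3 := abs_powTail_le h0 hf hD (p := 2 / 3) (by norm_num) ht
  have b4 := abs_powTail_le h0 hf hD (p := 1 / 3) (by norm_num) ht
  have w1 : 0 ≤ D * t ^ (1 / 5 : ℝ) := mul_nonneg hD0 (Real.rpow_nonneg hp.le _)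
  have w2 : 0 ≤ D * t ^ (-(4 / 5) : ℝ) := mul_nonneg hD0 (Real.rpow_nonneg hp.le _)
  refine ⟨?_, ?_, ?_, ?_⟩
  · have := abs_pow_combination_le (a := -(3 / 5)) (b := -(3 / 5)) (c := 1) (d := 1)
      (p := 4 / 3) (q := -(1 / 3)) (r := 1 / 5) hp zero_le_one zero_le_one
      (by norm_num [abs_le]) (by norm_num [abs_le]) b1 b2 (by norm_num) (by norm_num)
    rw [radialOp]
    refine le_trans (le_of_eq ?_) (this.trans (mul_le_mul_of_nonneg_right (by norm_num) w1))
    congr 1; ring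
  · have := abs_pow_combination_le (a := -(4 / 5)) (b := 1 / 5) (c := 1) (d := 1)
      (p := 1 / 3) (q := -(4 / 3)) (r := -(4 / 5)) hp zero_le_one zero_le_one
      (by norm_num [abs_le]) (by norm_num [abs_le]) b1 b2 (by norm_num) (by norm_num)
    rw [radialVel]
    refine le_trans (le_of_eq ?_) (this.trans (mul_le_mul_of_nonneg_right (by norm_num) w2))
    congr 1; ring
  · have := abs_pow_combination_le (a := 3) (b := -3) (c := 3) (d := 3)
      (p := 1 / 3) (q := 2 / 3) (r := 1 / 5) hp (by norm_num) (by norm_num)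
      (by norm_num [abs_le]) (by norm_num [abs_le]) b3 b4 (by norm_num) (by norm_num)
    rw [transOp]
    refine le_trans (le_of_eq ?_) (this.trans (mul_le_mul_of_nonneg_right (by norm_num) w1))
    congr 1; ring
  · have := abs_pow_combination_le (a := 1) (b := -2) (c := 1) (d := 2)
      (p := -(2 / 3)) (q := -(1 / 3)) (r := -(4 / 5)) hp (by norm_num) (by norm_num)
      (by norm_num [abs_le]) (by norm_num [abs_le]) b3 b4 (by norm_num) (by norm_num)
    rw [transVel]
    refine le_trans (le_of_eq ?_) (this.trans (mul_le_mul_of_nonneg_right (by norm_num) w2))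
    congr 1; ring

/-- Linearization at the parabolic orbit `t ^ (2/3)` of the equation of the escaping body. -/
def outerLin (t : ℝ) (d : ℂ) : ℂ := ⟨4 / 9 * t ^ (-2 : ℝ) * d.re, -(2 / 9) * t ^ (-2 : ℝ) * d.im⟩

/-- Solution operator for `δ'' = outerLin t δ + f`. -/
def outerOp (t₀ : ℝ) (f : ℝ → ℂ) (t : ℝ) : ℂ :=
  ⟨radialOp t₀ (fun s => (f s).re) t, transOp t₀ (fun s => (f s).im) t⟩

/-- The derivative of `outerOp`. -/
def outerVel (t₀ : ℝ) (f : ℝ → ℂ) (t : ℝ) : ℂ :=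
  ⟨radialVel t₀ (fun s => (f s).re) t, transVel t₀ (fun s => (f s).im) t⟩

theorem hasDerivAt_complex_mk {x y : ℝ → ℝ} {x' y' t : ℝ} (hx : HasDerivAt x x' t)
    (hy : HasDerivAt y y' t) : HasDerivAt (fun s => (⟨x s, y s⟩ : ℂ)) ⟨x', y'⟩ t := by
  have := hx.ofReal_comp.add (hy.ofReal_comp.mul_const Complex.I)
  simpa only [Complex.mk_eq_add_mul_I] using! this

theorem hasDerivAt_outerOp {t₀ : ℝ} (h0 : 0 < t₀) {f : ℝ → ℂ} (hf : Continuous f)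
    {t : ℝ} (ht : t₀ ≤ t) : HasDerivAt (outerOp t₀ f) (outerVel t₀ f t) t :=
  hasDerivAt_complex_mk (hasDerivAt_radialOp h0 (Complex.continuous_re.comp hf) ht)
    (hasDerivAt_transOp h0 (Complex.continuous_im.comp hf) ht)

theorem hasDerivAt_outerVel {t₀ : ℝ} (h0 : 0 < t₀) {f : ℝ → ℂ} (hf : Continuous f)
    {t : ℝ} (ht : t₀ ≤ t) :
    HasDerivAt (outerVel t₀ f) (outerLin t (outerOp t₀ f t) + f t) t :=
  hasDerivAt_complex_mk (hasDerivAt_radialVel h0 (Complex.continuous_re.comp hf) ht)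
    (hasDerivAt_transVel h0 (Complex.continuous_im.comp hf) ht)

theorem norm_outer_le {t₀ D : ℝ} (h0 : 0 < t₀) {f : ℝ → ℂ} (hf : Continuous f)
    (hD : ∀ s, t₀ ≤ s → ‖f s‖ ≤ D * s ^ (-(9 / 5) : ℝ)) {t : ℝ} (ht : t₀ ≤ t) :
    ‖outerOp t₀ f t‖ ≤ 100 * (D * t ^ (1 / 5 : ℝ)) ∧
    ‖outerVel t₀ f t‖ ≤ 100 * (D * t ^ (-(4 / 5) : ℝ)) := by
  have h1 := abs_outer_le h0 (Complex.continuous_re.comp hf)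
    (fun s hs => (Complex.abs_re_le_norm (f s)).trans (hD s hs)) ht
  have h2 := abs_outer_le h0 (Complex.continuous_im.comp hf)
    (fun s hs => (Complex.abs_im_le_norm (f s)).trans (hD s hs)) ht
  constructor
  · refine (Complex.norm_le_abs_re_add_abs_im _).trans ?_
    have := add_le_add h1.1 h2.2.2.1
    refine this.trans (le_of_eq (by ring))
  · refine (Complex.norm_le_abs_re_add_abs_im _).trans ?_
    have := add_le_add h1.2.1 h2.2.2.2
    refine this.trans (le_of_eq (by ring))

theorem outerOp_sub {t₀ : ℝ} (h0 : 0 < t₀) {f g : ℝ → ℂ} (hf : Continuous f) (hg : Continuous g)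
    {D : ℝ} (hfD : ∀ s, t₀ ≤ s → ‖f s‖ ≤ D * s ^ (-(9 / 5) : ℝ))
    (hgD : ∀ s, t₀ ≤ s → ‖g s‖ ≤ D * s ^ (-(9 / 5) : ℝ)) (t : ℝ) :
    outerOp t₀ f t - outerOp t₀ g t = outerOp t₀ (fun s => f s - g s) t := by
  have key : ∀ {h : ℝ → ℂ}, Continuous h → (∀ s, t₀ ≤ s → ‖h s‖ ≤ D * s ^ (-(9 / 5) : ℝ)) →
      IsOuterForcing t₀ (fun s => (h s).re) ∧ IsOuterForcing t₀ (fun s => (h s).im) :=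
    fun {h} hh hD =>
    ⟨⟨Complex.continuous_re.comp hh, D, fun s hs => (Complex.abs_re_le_norm (h s)).trans (hD s hs)⟩,
     ⟨Complex.continuous_im.comp hh, D, fun s hs => (Complex.abs_im_le_norm (h s)).trans (hD s hs)⟩⟩
  obtain ⟨fr, fi⟩ := key hf hfD
  obtain ⟨gr, gi⟩ := key hg hgD
  apply Complex.ext
  · simp only [outerOp, Complex.sub_re, radialOp]
    rw [powTail_sub h0 fr gr (by norm_num), powInt_sub h0 fr.1 gr.1]
    ring
  · simp only [outerOp, Complex.sub_im, transOp]
    rw [powTail_sub h0 fi gi (by norm_num), powTail_sub h0 fi gi (by norm_num)]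
    ring

end Outer
end ParabolicBounded

namespace ParabolicBounded

open MeasureTheory Set

section FixedPoint

variable {E F : Type*} [NormedAddCommGroup E] [NormedAddCommGroup F]

/-- Pairs of continuous curves satisfying prescribed pointwise bounds on `[t₀, ∞)`. -/
def Admissible (t₀ : ℝ) (ρ₁ ρ₂ : ℝ → ℝ) (p : (ℝ → E) × (ℝ → F)) : Prop :=
  Continuous p.1 ∧ Continuous p.2 ∧ ∀ t, t₀ ≤ t → ‖p.1 t‖ ≤ ρ₁ t ∧ ‖p.2 t‖ ≤ ρ₂ t

variable [NormedSpace ℝ E] [NormedSpace ℝ F]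

/-- The bounded continuous function `f / w`, frozen for `t ≤ t₀`. -/
def weightedBCF {t₀ : ℝ} {w : ℝ → ℝ} (hw : ContinuousOn w (Ici t₀)) (hw0 : ∀ t, t₀ ≤ t → 0 < w t)
    (f : ℝ → E) (hf : ContinuousOn f (Ici t₀)) (hb : ∀ t, t₀ ≤ t → ‖f t‖ ≤ w t) :
    BoundedContinuousFunction ℝ E :=
  BoundedContinuousFunction.ofNormedAddCommGroup
    (fun t => (w (max t t₀))⁻¹ • f (max t t₀))
    (by
      have hm : Continuous fun t : ℝ => max t t₀ := continuous_id.max continuous_const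
      exact ((hw.comp_continuous hm fun t => mem_Ici.2 (le_max_right _ _)).inv₀
        fun t => (hw0 _ (le_max_right _ _)).ne').smul
        (hf.comp_continuous hm fun t => mem_Ici.2 (le_max_right _ _)))
    1 (fun t => by
      have := hw0 _ (le_max_right t t₀)
      rw [norm_smul, norm_inv, Real.norm_of_nonneg this.le, inv_mul_le_iff₀ this, mul_one]
      exact hb _ (le_max_right _ _))

theorem weightedBCF_apply {t₀ : ℝ} {w : ℝ → ℝ} (hw : ContinuousOn w (Ici t₀))
    (hw0 : ∀ t, t₀ ≤ t → 0 < w t)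
    (f : ℝ → E) (hf : ContinuousOn f (Ici t₀)) (hb : ∀ t, t₀ ≤ t → ‖f t‖ ≤ w t) (t : ℝ) :
    weightedBCF hw hw0 f hf hb t = (w (max t t₀))⁻¹ • f (max t t₀) := rfl

theorem exists_weighted_fixedPoint [CompleteSpace E] [CompleteSpace F] {t₀ : ℝ}
    {w₁ w₂ ρ₁ ρ₂ : ℝ → ℝ}
    (hw₁ : ContinuousOn w₁ (Ici t₀)) (hw₂ : ContinuousOn w₂ (Ici t₀))
    (hp₁ : ∀ t, t₀ ≤ t → 0 < w₁ t) (hp₂ : ∀ t, t₀ ≤ t → 0 < w₂ t)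
    (hρ₁ : ∀ t, t₀ ≤ t → 0 ≤ ρ₁ t ∧ ρ₁ t ≤ w₁ t) (hρ₂ : ∀ t, t₀ ≤ t → 0 ≤ ρ₂ t ∧ ρ₂ t ≤ w₂ t)
    {T : (ℝ → E) × (ℝ → F) → (ℝ → E) × (ℝ → F)}
    (hT : ∀ p, Admissible t₀ ρ₁ ρ₂ p →
      ContinuousOn (T p).1 (Ici t₀) ∧ ContinuousOn (T p).2 (Ici t₀) ∧
        ∀ t, t₀ ≤ t → ‖(T p).1 t‖ ≤ ρ₁ t ∧ ‖(T p).2 t‖ ≤ ρ₂ t)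
    (hc : ∀ p q, Admissible t₀ ρ₁ ρ₂ p → Admissible t₀ ρ₁ ρ₂ q → ∀ D : ℝ, 0 ≤ D →
      (∀ t, t₀ ≤ t → ‖p.1 t - q.1 t‖ ≤ D * w₁ t ∧ ‖p.2 t - q.2 t‖ ≤ D * w₂ t) →
      ∀ t, t₀ ≤ t → ‖(T p).1 t - (T q).1 t‖ ≤ 1 / 2 * D * w₁ t ∧
        ‖(T p).2 t - (T q).2 t‖ ≤ 1 / 2 * D * w₂ t) :
    ∃ p, Admissible t₀ ρ₁ ρ₂ p ∧ ∀ t, t₀ ≤ t → (T p).1 t = p.1 t ∧ (T p).2 t = p.2 t := by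
  have hm : Continuous fun t : ℝ => max t t₀ := continuous_id.max continuous_const
  have hml : ∀ t : ℝ, t₀ ≤ max t t₀ := fun t => le_max_right _ _
  let W := BoundedContinuousFunction ℝ E × BoundedContinuousFunction ℝ F
  let dec : W → (ℝ → E) × (ℝ → F) := fun z =>
    (fun t => w₁ (max t t₀) • z.1 t, fun t => w₂ (max t t₀) • z.2 t)
  let S : Set W := {z | ∀ t, ‖w₁ (max t t₀) • z.1 t‖ ≤ ρ₁ (max t t₀) ∧
    ‖w₂ (max t t₀) • z.2 t‖ ≤ ρ₂ (max t t₀)}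
  have hS : IsClosed S := by
    have : S = ⋂ t, {z : W | ‖w₁ (max t t₀) • z.1 t‖ ≤ ρ₁ (max t t₀) ∧
      ‖w₂ (max t t₀) • z.2 t‖ ≤ ρ₂ (max t t₀)} := by ext; simp [S]
    rw [this]
    refine isClosed_iInter fun t => ?_
    have c1 : Continuous fun z : W => z.1 t :=
      (continuous_eval_const t).comp continuous_fst
    have c2 : Continuous fun z : W => z.2 t :=
      (continuous_eval_const t).comp continuous_snd
    exact (isClosed_le (c1.const_smul _).norm continuous_const).inter
      (isClosed_le (c2.const_smul _).norm continuous_const)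
  have : CompleteSpace S := hS.completeSpace_coe
  have : Nonempty S := ⟨⟨0, fun t => by
    simp [(hρ₁ _ (hml t)).1, (hρ₂ _ (hml t)).1]⟩⟩
  have hdec : ∀ z ∈ S, Admissible t₀ ρ₁ ρ₂ (dec z) := fun z hz =>
    ⟨(hw₁.comp_continuous hm hml).smul z.1.continuous,
      (hw₂.comp_continuous hm hml).smul z.2.continuous, fun t ht => by
        have := hz t
        rw [max_eq_left ht] at this
        simpa only [dec, max_eq_left ht] using this⟩
  let enc : S → W := fun z =>
    (weightedBCF hw₁ hp₁ (T (dec z)).1 (hT _ (hdec z z.2)).1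
      fun t ht => (((hT _ (hdec z z.2)).2.2 t ht).1).trans (hρ₁ t ht).2,
     weightedBCF hw₂ hp₂ (T (dec z)).2 (hT _ (hdec z z.2)).2.1
      fun t ht => (((hT _ (hdec z z.2)).2.2 t ht).2).trans (hρ₂ t ht).2)
  have henc : ∀ z : S, ∀ t, w₁ (max t t₀) • (enc z).1 t = (T (dec z)).1 (max t t₀) ∧
      w₂ (max t t₀) • (enc z).2 t = (T (dec z)).2 (max t t₀) := fun z t => by
    simp only [enc, weightedBCF_apply]
    exact ⟨smul_inv_smul₀ (hp₁ _ (hml t)).ne' _, smul_inv_smul₀ (hp₂ _ (hml t)).ne' _⟩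
  have hencS : ∀ z : S, enc z ∈ S := fun z t => by
    rw [(henc z t).1, (henc z t).2]
    exact (hT _ (hdec z z.2)).2.2 _ (hml t)
  let Φ : S → S := fun z => ⟨enc z, hencS z⟩
  have hΦ : ContractingWith (1 / 2) Φ := by
    refine ⟨by norm_num, LipschitzWith.of_dist_le_mul fun z z' => ?_⟩
    have hD : (0 : ℝ) ≤ dist z z' := dist_nonneg
    have hz : ∀ t, t₀ ≤ t → ‖(dec z).1 t - (dec z').1 t‖ ≤ dist z z' * w₁ t ∧
        ‖(dec z).2 t - (dec z').2 t‖ ≤ dist z z' * w₂ t := fun t ht => by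
      simp only [dec, max_eq_left ht, ← smul_sub, norm_smul, Real.norm_of_nonneg (hp₁ t ht).le,
        Real.norm_of_nonneg (hp₂ t ht).le, ← dist_eq_norm]
      rw [mul_comm, mul_comm (w₂ t)]
      refine ⟨mul_le_mul_of_nonneg_right ?_ (hp₁ t ht).le,
        mul_le_mul_of_nonneg_right ?_ (hp₂ t ht).le⟩
      · exact (BoundedContinuousFunction.dist_coe_le_dist t).trans (le_max_left _ _)
      · exact (BoundedContinuousFunction.dist_coe_le_dist t).trans (le_max_right _ _)
    have key := hc _ _ (hdec z z.2) (hdec z' z'.2) _ hD hz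
    have e : ((1 / 2 : NNReal) : ℝ) * dist z z' = 1 / 2 * dist z z' := by norm_num
    rw [e]
    refine max_le ?_ ?_
    · refine (BoundedContinuousFunction.dist_le (by positivity)).2 fun t => ?_
      have h := (key _ (hml t)).1
      rw [← (henc z t).1, ← (henc z' t).1, ← smul_sub, norm_smul,
        Real.norm_of_nonneg (hp₁ _ (hml t)).le, mul_comm] at h
      rw [dist_eq_norm]
      exact le_of_mul_le_mul_right h (hp₁ _ (hml t))
    · refine (BoundedContinuousFunction.dist_le (by positivity)).2 fun t => ?_
      have h := (key _ (hml t)).2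
      rw [← (henc z t).2, ← (henc z' t).2, ← smul_sub, norm_smul,
        Real.norm_of_nonneg (hp₂ _ (hml t)).le, mul_comm] at h
      rw [dist_eq_norm]
      exact le_of_mul_le_mul_right h (hp₂ _ (hml t))
  set z := ContractingWith.fixedPoint Φ hΦ
  have hz : Φ z = z := hΦ.fixedPoint_isFixedPt
  have hz' : enc z = z := congrArg Subtype.val hz
  refine ⟨dec z, hdec z z.2, fun t ht => ?_⟩
  have := henc z t
  rw [hz', max_eq_left ht] at this
  simp only [dec, max_eq_left ht] at this ⊢
  exact ⟨this.1.symm, this.2.symm⟩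

end FixedPoint
end ParabolicBounded

namespace ParabolicBounded

open MeasureTheory Set

section Contraction

variable {E : Type*} [NormedAddCommGroup E] [NormedSpace ℝ E]

/-- The region of phase space containing the invariant torus: points
`(t, θ, y, d)` with `y` and `d` close to the relative equilibrium and to the parabolic orbit. -/
def torusRegion (E : Type*) [NormedAddCommGroup E] (t₁ : ℝ) : Set (ℝ × ℝ × E × ℂ) :=
  {p | t₁ ≤ p.1 ∧ ‖p.2.2.1‖ ≤ p.1 ^ (-1 : ℝ) ∧ ‖p.2.2.2‖ ≤ p.1 ^ (1 / 4 : ℝ)}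

/-- Estimates for the nonlinear terms of the equations of motion near a parabolic torus. The
parameter `μ` is the mass of the escaping body. -/
structure IsTidal (k : E →L[ℝ] ℝ) (C t₁ : ℝ) (F₁ : ℝ → ℝ × ℝ × E × ℂ → E)
    (F₂ : ℝ → ℝ × ℝ × E × ℂ → ℂ) : Prop where
  continuousOn_inner : ∀ μ, 0 < μ → μ ≤ 1 → ContinuousOn (F₁ μ) (torusRegion E t₁)
  continuousOn_outer : ∀ μ, 0 < μ → μ ≤ 1 → ContinuousOn (F₂ μ) (torusRegion E t₁)
  norm_inner : ∀ μ, 0 < μ → μ ≤ 1 → ∀ t θ y d, (t, θ, y, d) ∈ torusRegion E t₁ →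
    ‖F₁ μ (t, θ, y, d)‖ ≤ C * (‖y‖ ^ 2 + μ * t ^ (-2 : ℝ))
  norm_outer : ∀ μ, 0 < μ → μ ≤ 1 → ∀ t θ y d, (t, θ, y, d) ∈ torusRegion E t₁ →
    ‖F₂ μ (t, θ, y, d)‖ ≤ C * t ^ (-2 : ℝ)
  inner_sub : ∀ μ, 0 < μ → μ ≤ 1 → ∀ t θ y d θ' y' d', (t, θ, y, d) ∈ torusRegion E t₁ →
    (t, θ', y', d') ∈ torusRegion E t₁ →
    ‖F₁ μ (t, θ, y, d) - F₁ μ (t, θ', y', d')‖ ≤ C * ((‖y‖ + ‖y'‖) * ‖y - y'‖ +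
      μ * (t ^ (-2 : ℝ) * ‖y - y'‖ + t ^ (-2 : ℝ) * |θ - θ'| + t ^ (-(9 / 4) : ℝ) * ‖d - d'‖))
  outer_sub : ∀ μ, 0 < μ → μ ≤ 1 → ∀ t θ y d θ' y' d', (t, θ, y, d) ∈ torusRegion E t₁ →
    (t, θ', y', d') ∈ torusRegion E t₁ →
    ‖F₂ μ (t, θ, y, d) - F₂ μ (t, θ', y', d')‖ ≤ C * (t ^ (-2 : ℝ) * ‖y - y'‖
      + t ^ (-2 : ℝ) * |θ - θ'| + t ^ (-(9 / 4) : ℝ) * ‖d - d'‖)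

/-- The phase of the inner motion. -/
def phase (k : E →L[ℝ] ℝ) (t₀ : ℝ) (Y : ℝ → E) (t : ℝ) : ℝ := t + ∫ s in t₀..t, k (Y s)

theorem hasDerivAt_phase (k : E →L[ℝ] ℝ) (t₀ : ℝ) {Y : ℝ → E} (hY : Continuous Y) (t : ℝ) :
    HasDerivAt (phase k t₀ Y) (1 + k (Y t)) t :=
  (hasDerivAt_id t).add (hasDerivAt_integral_of_continuous (k.continuous.comp hY) t₀ t)

theorem abs_phase_sub_le (k : E →L[ℝ] ℝ) {t₀ D : ℝ} (h0 : 0 < t₀) {Y Y' : ℝ → E}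
    (hY : Continuous Y) (hY' : Continuous Y')
    (hD : ∀ s, t₀ ≤ s → ‖Y s - Y' s‖ ≤ D * s ^ (-(4 / 5) : ℝ)) {t : ℝ} (ht : t₀ ≤ t) :
    |phase k t₀ Y t - phase k t₀ Y' t| ≤ 5 * ‖k‖ * D * t ^ (1 / 5 : ℝ) := by
  have hD0 : 0 ≤ D := nonneg_of_mul_nonneg_left ((norm_nonneg _).trans (hD t₀ le_rfl))
    (Real.rpow_pos_of_pos h0 _)
  have e : phase k t₀ Y t - phase k t₀ Y' t = ∫ s in t₀..t, k (Y s - Y' s) := by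
    simp only [phase, map_sub]
    rw [intervalIntegral.integral_sub]
    · ring
    · exact (k.continuous.comp hY).intervalIntegrable _ _
    · exact (k.continuous.comp hY').intervalIntegrable _ _
  rw [e]
  have := norm_integral_le_sub_of_hasDerivAt (k.continuous.comp (hY.sub hY')) ht
    (B := fun s => 5 * ‖k‖ * D * s ^ (1 / 5 : ℝ)) (B' := fun s => ‖k‖ * (D * s ^ (-(4 / 5) : ℝ)))
    (fun s hs => ?_) (fun s hs => (k.le_opNorm _).trans
      (mul_le_mul_of_nonneg_left (hD s hs.1) (norm_nonneg _)))
  · refine this.trans (sub_le_self _ ?_)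
    have := Real.rpow_nonneg h0.le (1 / 5)
    positivity
  · convert! (hasDerivAt_rpow' (h0.trans_le hs.1) (1 / 5) (-(4 / 5))
      (by norm_num)).const_mul (5 * ‖k‖ * D) using 1
    ring

/-- The space-time curve determined by `p`, frozen for `t ≤ t₀`. -/
def frozenCurve (k : E →L[ℝ] ℝ) (t₀ : ℝ) (p : (ℝ → E) × (ℝ → ℂ)) (s : ℝ) : ℝ × ℝ × E × ℂ :=
  (max s t₀, phase k t₀ p.1 (max s t₀), p.1 (max s t₀), p.2 (max s t₀))

theorem frozenCurve_eq (k : E →L[ℝ] ℝ) {t₀ s : ℝ} (hs : t₀ ≤ s) (p : (ℝ → E) × (ℝ → ℂ)) :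
    frozenCurve k t₀ p s = (s, phase k t₀ p.1 s, p.1 s, p.2 s) := by
  simp only [frozenCurve, max_eq_left hs]

theorem continuous_frozenCurve (k : E →L[ℝ] ℝ) (t₀ : ℝ) {p : (ℝ → E) × (ℝ → ℂ)}
    (h1 : Continuous p.1) (h2 : Continuous p.2) : Continuous (frozenCurve k t₀ p) := by
  have hm : Continuous fun t : ℝ => max t t₀ := continuous_id.max continuous_const
  have hph : Continuous (phase k t₀ p.1) :=
    continuous_iff_continuousAt.2 fun t => (hasDerivAt_phase k t₀ h1 t).continuousAt
  exact hm.prodMk ((hph.comp hm).prodMk ((h1.comp hm).prodMk (h2.comp hm)))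

theorem exists_parabolic_torus_motion [CompleteSpace E] {A : E →L[ℝ] E} (hA : HasGreen A)
    {k : E →L[ℝ] ℝ} {C t₁ : ℝ} (hC : 0 ≤ C) {F₁ : ℝ → ℝ × ℝ × E × ℂ → E}
    {F₂ : ℝ → ℝ × ℝ × E × ℂ → ℂ} (hF : IsTidal k C t₁ F₁ F₂) :
    ∃ μ, 0 < μ ∧ μ ≤ 1 ∧ ∃ t₀, t₁ ≤ t₀ ∧ 1 ≤ t₀ ∧
    ∃ (θ : ℝ → ℝ) (Y : ℝ → E) (δ ε : ℝ → ℂ),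
      (∀ t, t₀ < t → (t, θ t, Y t, δ t) ∈ torusRegion E t₁ ∧
        HasDerivAt θ (1 + k (Y t)) t ∧
        HasDerivAt Y (A (Y t) + F₁ μ (t, θ t, Y t, δ t)) t ∧
        HasDerivAt δ (ε t) t ∧
        HasDerivAt ε (outerLin t (δ t) + F₂ μ (t, θ t, Y t, δ t)) t) ∧
      Tendsto ε atTop (nhds 0) := by
  obtain ⟨CG, hCG, tG, hG⟩ := hA
  set c := ‖k‖ with hc
  have hc0 : 0 ≤ c := norm_nonneg k
  set K : ℝ := (1 + 2 * (CG * C * (4 + 5 * c)))⁻¹ with hK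
  have hZ : 0 ≤ CG * C * (4 + 5 * c) := by positivity
  have hK0 : 0 < K := by positivity
  have hK1 : K ≤ 1 := inv_le_one_of_one_le₀ (by linarith)
  have hKeq : K + 2 * (CG * C * (4 + 5 * c)) * K = 1 := by
    rw [hK]; field_simp
  set μ : ℝ := K ^ 2 with hμ
  have hμ0 : 0 < μ := by positivity
  have hμK : μ ≤ K := by rw [hμ]; nlinarith
  have hμ1 : μ ≤ 1 := hμK.trans hK1
  have hb1 : CG * (C * (K ^ 2 + μ)) ≤ K := by
    have h1 : CG * C * (2 * K) ≤ 1 := by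
      have : CG * C * (2 * K) ≤ CG * C * (2 * (4 + 5 * c) * K) := by
        apply mul_le_mul_of_nonneg_left _ (by positivity)
        nlinarith
      nlinarith
    rw [hμ]; nlinarith
  have hb2 : CG * (C * (2 * K + μ * (2 + 5 * c))) ≤ 1 / 2 := by
    have : 2 * K + μ * (2 + 5 * c) ≤ (4 + 5 * c) * K := by nlinarith
    have := mul_le_mul_of_nonneg_left this (by positivity : 0 ≤ CG * C)
    nlinarith
  obtain ⟨t₀, ht⟩ := (((tendsto_rpow_atTop (by norm_num : (0 : ℝ) < 1 / 20)).eventually_ge_atTop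
    (200 * C * (2 + 5 * c))).and ((eventually_ge_atTop tG).and ((eventually_ge_atTop t₁).and
    (eventually_ge_atTop (1 : ℝ))))).exists
  obtain ⟨ht20, htG, ht1, h1⟩ := ht
  have h0 : 0 < t₀ := by linarith
  obtain ⟨G, hGr⟩ := hG t₀ htG h1
  set ρ₁ : ℝ → ℝ := fun t => K * t ^ (-1 : ℝ) with hρ₁
  set w₁ : ℝ → ℝ := fun t => t ^ (-(4 / 5) : ℝ) with hw₁
  set w₂ : ℝ → ℝ := fun t => t ^ (1 / 4 : ℝ) with hw₂
  have hpos : ∀ {t : ℝ}, t₀ ≤ t → 0 < t := fun h => h0.trans_le h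
  have hone : ∀ {t : ℝ}, t₀ ≤ t → 1 ≤ t := fun h => h1.trans h
  -- forcing terms
  have hreg : ∀ p, Admissible t₀ ρ₁ w₂ p → ∀ s, frozenCurve k t₀ p s ∈ torusRegion E t₁ := by
    intro p hp s
    have hs : t₀ ≤ max s t₀ := le_max_right _ _
    obtain ⟨ha, hb⟩ := hp.2.2 _ hs
    refine ⟨ht1.trans hs, ha.trans ?_, hb⟩
    exact mul_le_of_le_one_left (Real.rpow_nonneg (hpos hs).le _) hK1
  have hreg' : ∀ p, Admissible t₀ ρ₁ w₂ p → ∀ s, t₀ ≤ s →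
      (s, phase k t₀ p.1 s, p.1 s, p.2 s) ∈ torusRegion E t₁ := by
    intro p hp s hs
    rw [← frozenCurve_eq k hs]; exact hreg p hp s
  set f₁ : (ℝ → E) × (ℝ → ℂ) → ℝ → E := fun p s => F₁ μ (frozenCurve k t₀ p s) with hf₁
  set f₂ : (ℝ → E) × (ℝ → ℂ) → ℝ → ℂ := fun p s => F₂ μ (frozenCurve k t₀ p s) with hf₂
  have hf₁c : ∀ p, Admissible t₀ ρ₁ w₂ p → Continuous (f₁ p) := fun p hp =>
    (hF.continuousOn_inner μ hμ0 hμ1).comp_continuous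
      (continuous_frozenCurve k t₀ hp.1 hp.2.1) (hreg p hp)
  have hf₂c : ∀ p, Admissible t₀ ρ₁ w₂ p → Continuous (f₂ p) := fun p hp =>
    (hF.continuousOn_outer μ hμ0 hμ1).comp_continuous
      (continuous_frozenCurve k t₀ hp.1 hp.2.1) (hreg p hp)
  have hf₁b : ∀ p, Admissible t₀ ρ₁ w₂ p → ∀ s, t₀ ≤ s →
      ‖f₁ p s‖ ≤ C * (K ^ 2 + μ) * s ^ (-2 : ℝ) := by
    intro p hp s hs
    have h := hF.norm_inner μ hμ0 hμ1 _ _ _ _ (hreg' p hp s hs)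
    simp only [hf₁, frozenCurve_eq k hs]
    refine h.trans ?_
    have hy := (hp.2.2 s hs).1
    have hy2 : ‖p.1 s‖ ^ 2 ≤ K ^ 2 * s ^ (-2 : ℝ) := by
      refine (pow_le_pow_left₀ (norm_nonneg _) hy 2).trans (le_of_eq ?_)
      rw [hρ₁, mul_pow, ← Real.rpow_natCast (s ^ (-1 : ℝ)), ← Real.rpow_mul (hpos hs).le]
      norm_num
    calc C * (‖p.1 s‖ ^ 2 + μ * s ^ (-2 : ℝ)) ≤ C * (K ^ 2 * s ^ (-2 : ℝ) + μ * s ^ (-2 : ℝ)) := by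
          gcongr
      _ = _ := by ring
  have hforce : ∀ p, Admissible t₀ ρ₁ w₂ p → IsForcing t₀ (f₁ p) := fun p hp =>
    ⟨hf₁c p hp, _, hf₁b p hp⟩
  have hzero : IsForcing t₀ (fun _ : ℝ => (0 : E)) :=
    ⟨continuous_const, 0, fun s _ => by simp⟩
  have hf₂b : ∀ p, Admissible t₀ ρ₁ w₂ p → ∀ s, t₀ ≤ s →
      ‖f₂ p s‖ ≤ C * s ^ (-(9 / 5) : ℝ) := by
    intro p hp s hs
    have h := hF.norm_outer μ hμ0 hμ1 _ _ _ _ (hreg' p hp s hs)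
    simp only [hf₂, frozenCurve_eq k hs]
    exact h.trans (mul_le_mul_of_nonneg_left
      (Real.rpow_le_rpow_of_exponent_le (hone hs) (by norm_num)) hC)
  have h15 : ∀ {t : ℝ}, t₀ ≤ t → 200 * C * (2 + 5 * c) * t ^ (1 / 5 : ℝ) ≤ t ^ (1 / 4 : ℝ) := by
    intro t ht
    have h2 : t ^ (1 / 4 : ℝ) = t ^ (1 / 20 : ℝ) * t ^ (1 / 5 : ℝ) := by
      rw [← Real.rpow_add (hpos ht)]; norm_num
    rw [h2]
    refine mul_le_mul_of_nonneg_right (ht20.trans ?_) (Real.rpow_nonneg (hpos ht).le _)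
    exact Real.rpow_le_rpow h0.le ht (by norm_num)
  -- difference of forcing terms
  have hdiff : ∀ p q, Admissible t₀ ρ₁ w₂ p → Admissible t₀ ρ₁ w₂ q → ∀ D : ℝ, 0 ≤ D →
      (∀ t, t₀ ≤ t → ‖p.1 t - q.1 t‖ ≤ D * w₁ t ∧ ‖p.2 t - q.2 t‖ ≤ D * w₂ t) →
      ∀ t, t₀ ≤ t →
        ‖f₁ p t - f₁ q t‖ ≤ C * (2 * K + μ * (2 + 5 * c)) * D * t ^ (-(9 / 5) : ℝ) ∧
        ‖f₂ p t - f₂ q t‖ ≤ C * (2 + 5 * c) * D * t ^ (-(9 / 5) : ℝ) := by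
    intro p q hp hq D hD hpq t ht
    have htp := hpos ht
    obtain ⟨hy, hd⟩ := hpq t ht
    have hθ := abs_phase_sub_le k h0 hp.1 hq.1 (fun s hs => (hpq s hs).1) ht
    have hX : (0 : ℝ) ≤ t ^ (-(9 / 5) : ℝ) := Real.rpow_nonneg htp.le _
    have a1 : t ^ (-2 : ℝ) * ‖p.1 t - q.1 t‖ ≤ D * t ^ (-(9 / 5) : ℝ) := by
      calc t ^ (-2 : ℝ) * ‖p.1 t - q.1 t‖ ≤ t ^ (-2 : ℝ) * (D * t ^ (-(4 / 5) : ℝ)) := by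
            gcongr
        _ = D * t ^ (-(14 / 5) : ℝ) := by
            rw [mul_left_comm, ← Real.rpow_add htp]; norm_num
        _ ≤ _ := mul_le_mul_of_nonneg_left
            (Real.rpow_le_rpow_of_exponent_le (hone ht) (by norm_num)) hD
    have a2 : t ^ (-2 : ℝ) * |phase k t₀ p.1 t - phase k t₀ q.1 t| ≤
        5 * c * D * t ^ (-(9 / 5) : ℝ) := by
      calc _ ≤ t ^ (-2 : ℝ) * (5 * c * D * t ^ (1 / 5 : ℝ)) := by
            gcongr
        _ = _ := by rw [mul_left_comm, ← Real.rpow_add htp]; norm_num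
    have a3 : t ^ (-(9 / 4) : ℝ) * ‖p.2 t - q.2 t‖ ≤ D * t ^ (-(9 / 5) : ℝ) := by
      calc _ ≤ t ^ (-(9 / 4) : ℝ) * (D * t ^ (1 / 4 : ℝ)) := by
            gcongr
        _ = D * t ^ (-2 : ℝ) := by
            rw [mul_left_comm, ← Real.rpow_add htp]; norm_num
        _ ≤ _ := mul_le_mul_of_nonneg_left
            (Real.rpow_le_rpow_of_exponent_le (hone ht) (by norm_num)) hD
    have a4 : (‖p.1 t‖ + ‖q.1 t‖) * ‖p.1 t - q.1 t‖ ≤ 2 * K * D * t ^ (-(9 / 5) : ℝ) := by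
      have hy1 := (hp.2.2 t ht).1
      have hy2 := (hq.2.2 t ht).1
      calc _ ≤ (K * t ^ (-1 : ℝ) + K * t ^ (-1 : ℝ)) * (D * t ^ (-(4 / 5) : ℝ)) := by
            gcongr
        _ = 2 * K * D * (t ^ (-1 : ℝ) * t ^ (-(4 / 5) : ℝ)) := by ring
        _ = _ := by rw [← Real.rpow_add htp]; norm_num
    simp only [hf₁, hf₂, frozenCurve_eq k ht]
    constructor
    · refine (hF.inner_sub μ hμ0 hμ1 _ _ _ _ _ _ _ (hreg' p hp t ht) (hreg' q hq t ht)).trans ?_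
      rw [mul_assoc, mul_assoc]
      refine mul_le_mul_of_nonneg_left ?_ hC
      have := mul_le_mul_of_nonneg_left (add_le_add (add_le_add a1 a2) a3) hμ0.le
      linarith
    · refine (hF.outer_sub μ hμ0 hμ1 _ _ _ _ _ _ _ (hreg' p hp t ht) (hreg' q hq t ht)).trans ?_
      rw [mul_assoc, mul_assoc]
      refine mul_le_mul_of_nonneg_left ?_ hC
      linarith [add_le_add (add_le_add a1 a2) a3]
  have hmaps : ∀ p, Admissible t₀ ρ₁ w₂ p → ∀ t, t₀ ≤ t →
      ‖G (f₁ p) t‖ ≤ ρ₁ t ∧ ‖outerOp t₀ (f₂ p) t‖ ≤ w₂ t := by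
    refine fun p hp t ht => ⟨?_, ?_⟩
    · have := hGr.bound _ _ (hforce p hp) hzero 2 (C * (K ^ 2 + μ)) (by norm_num) le_rfl
        (fun s hs => by simpa using hf₁b p hp s hs) t ht
      rw [hGr.zero t ht, sub_zero, ← mul_assoc] at this
      refine this.trans ?_
      rw [show (1 : ℝ) - 2 = -1 by norm_num]
      exact mul_le_mul_of_nonneg_right hb1 (Real.rpow_nonneg (hpos ht).le _)
    · refine (norm_outer_le h0 (hf₂c p hp) (hf₂b p hp) ht).1.trans (le_trans ?_ (h15 ht))
      rw [← mul_assoc]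
      refine mul_le_mul_of_nonneg_right ?_ (Real.rpow_nonneg (hpos ht).le _)
      nlinarith [mul_nonneg hC hc0]
  have hcontr : ∀ p q, Admissible t₀ ρ₁ w₂ p → Admissible t₀ ρ₁ w₂ q → ∀ D : ℝ, 0 ≤ D →
      (∀ t, t₀ ≤ t → ‖p.1 t - q.1 t‖ ≤ D * w₁ t ∧ ‖p.2 t - q.2 t‖ ≤ D * w₂ t) →
      ∀ t, t₀ ≤ t → ‖G (f₁ p) t - G (f₁ q) t‖ ≤ 1 / 2 * D * w₁ t ∧
        ‖outerOp t₀ (f₂ p) t - outerOp t₀ (f₂ q) t‖ ≤ 1 / 2 * D * w₂ t := by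
    refine fun p q hp hq D hD hpq t ht => ⟨?_, ?_⟩
    · have := hGr.bound _ _ (hforce p hp) (hforce q hq) (9 / 5)
        (C * (2 * K + μ * (2 + 5 * c)) * D) le_rfl (by norm_num)
        (fun s hs => (hdiff p q hp hq D hD hpq s hs).1) t ht
      refine this.trans ?_
      rw [show (1 : ℝ) - 9 / 5 = -(4 / 5) by norm_num]
      have hX : 0 ≤ D * t ^ (-(4 / 5) : ℝ) := mul_nonneg hD (Real.rpow_nonneg (hpos ht).le _)
      have := mul_le_mul_of_nonneg_right hb2 hX
      simp only [hw₁]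
      linarith
    · rw [outerOp_sub h0 (hf₂c p hp) (hf₂c q hq) (hf₂b p hp) (hf₂b q hq)]
      refine (norm_outer_le h0 ((hf₂c p hp).sub (hf₂c q hq))
        (fun s hs => (hdiff p q hp hq D hD hpq s hs).2) ht).1.trans ?_
      have := mul_le_mul_of_nonneg_left (h15 ht) hD
      simp only [hw₂]
      linarith
  obtain ⟨p, hp, hfix⟩ := exists_weighted_fixedPoint (t₀ := t₀) (w₁ := w₁) (w₂ := w₂) (ρ₁ := ρ₁)
    (ρ₂ := w₂) (T := fun p => (G (f₁ p), outerOp t₀ (f₂ p)))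
    (fun t ht => (Real.continuousAt_rpow_const _ _
      (Or.inl (hpos ht).ne')).continuousWithinAt)
    (fun t ht => (Real.continuousAt_rpow_const _ _
      (Or.inl (hpos ht).ne')).continuousWithinAt)
    (fun t ht => Real.rpow_pos_of_pos (hpos ht) _)
    (fun t ht => Real.rpow_pos_of_pos (hpos ht) _)
    (fun t ht => ⟨mul_nonneg hK0.le (Real.rpow_nonneg (hpos ht).le _),
      (mul_le_of_le_one_left (Real.rpow_nonneg (hpos ht).le _) hK1).trans
        (Real.rpow_le_rpow_of_exponent_le (hone ht) (by norm_num))⟩)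
    (fun t ht => ⟨Real.rpow_nonneg (hpos ht).le _, le_rfl⟩)
    (fun p hp => ⟨fun t ht => (hGr.hasDerivAt _ (hforce p hp) t ht).continuousAt.continuousWithinAt,
      fun t ht => (hasDerivAt_outerOp h0 (hf₂c p hp) ht).continuousAt.continuousWithinAt,
      hmaps p hp⟩)
    hcontr
  replace hfix : ∀ t, t₀ ≤ t → G (f₁ p) t = p.1 t ∧ outerOp t₀ (f₂ p) t = p.2 t := hfix
  refine ⟨μ, hμ0, hμ1, t₀, ht1, h1, phase k t₀ p.1, p.1, p.2, outerVel t₀ (f₂ p),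
    fun t ht => ⟨hreg' p hp t ht.le, hasDerivAt_phase k t₀ hp.1 t, ?_, ?_, ?_⟩, ?_⟩
  · have h := hGr.hasDerivAt _ (hforce p hp) t ht.le
    rw [(hfix t ht.le).1] at h
    simp only [hf₁, frozenCurve_eq k ht.le] at h
    refine h.congr_of_eventuallyEq ?_
    filter_upwards [lt_mem_nhds ht] with s hs using ((hfix s hs.le).1).symm
  · refine (hasDerivAt_outerOp h0 (hf₂c p hp) ht.le).congr_of_eventuallyEq ?_
    filter_upwards [lt_mem_nhds ht] with s hs using ((hfix s hs.le).2).symm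
  · have h := hasDerivAt_outerVel h0 (hf₂c p hp) ht.le
    rw [(hfix t ht.le).2] at h
    simpa only [hf₂, frozenCurve_eq k ht.le] using h
  · have h : Tendsto (fun t : ℝ => 100 * (C * t ^ (-(4 / 5) : ℝ))) atTop (nhds 0) := by
      simpa using ((tendsto_rpow_neg_atTop (by norm_num : (0 : ℝ) < 4 / 5)).const_mul C).const_mul
        100
    refine squeeze_zero_norm' ?_ h
    filter_upwards [eventually_ge_atTop t₀] with t ht
    exact (norm_outer_le h0 (hf₂c p hp) (hf₂b p hp) ht).2

end Contraction
end ParabolicBounded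

namespace ParabolicBounded

section Collinear

variable {n : ℕ}

/-- The weights `1 / |aᵢ - aⱼ|³` of a collinear configuration, with zero diagonal. -/
def cubeWeight (a : Fin n → ℝ) (i j : Fin n) : ℝ := (|a i - a j| ^ 3)⁻¹

theorem cubeWeight_symm (a : Fin n → ℝ) (i j : Fin n) :
    cubeWeight a i j = cubeWeight a j i := by
  rw [cubeWeight, cubeWeight, abs_sub_comm]

/-- Collinear relative equilibria of `n` unit masses. -/
structure IsCollinearEquilibrium (a : Fin n → ℝ) : Prop where
  strictMono : StrictMono a
  balance : ∀ j, ∑ i, cubeWeight a i j * (a j - a i) = a j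

theorem hasDerivAt_inv_abs {x : ℝ} (hx : x ≠ 0) (v : ℝ) :
    HasDerivAt (fun s => |x + s * v|⁻¹) (-((|x| ^ 3)⁻¹ * (x * v))) 0 := by
  have h1 : HasDerivAt (fun s : ℝ => x + s * v) v 0 := by
    simpa using ((hasDerivAt_id (0 : ℝ)).mul_const v).const_add x
  rcases hx.lt_or_gt with h | h
  · have h2 : HasDerivAt (fun s => (-(x + s * v))⁻¹) (-((|x| ^ 3)⁻¹ * (x * v))) 0 := by
      have h3 := h1.neg.inv (by simpa using hx)
      convert! h3 using 1
      simp only [Pi.neg_apply, zero_mul, add_zero, abs_of_neg h]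
      field_simp
    refine h2.congr_of_eventuallyEq ?_
    have : ∀ᶠ s in nhds (0 : ℝ), x + s * v < 0 :=
      h1.continuousAt.eventually (gt_mem_nhds (by simpa using h))
    filter_upwards [this] with s hs
    rw [abs_of_neg hs]
  · have h2 : HasDerivAt (fun s => (x + s * v)⁻¹) (-((|x| ^ 3)⁻¹ * (x * v))) 0 := by
      have h3 := h1.inv (by simpa using hx)
      convert! h3 using 1
      simp only [zero_mul, add_zero, abs_of_pos h]
      field_simp
    refine h2.congr_of_eventuallyEq ?_
    have : ∀ᶠ s in nhds (0 : ℝ), 0 < x + s * v :=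
      h1.continuousAt.eventually (lt_mem_nhds (by simpa using h))
    filter_upwards [this] with s hs
    rw [abs_of_pos hs]

/-- The amended potential on the line. -/
def amendedPotential (x : Fin n → ℝ) : ℝ :=
  1 / 2 * ∑ j, ∑ i, |x j - x i|⁻¹ + 1 / 2 * ∑ j, x j ^ 2

theorem inv_abs_le_amendedPotential (x : Fin n → ℝ) {i j : Fin n} (hij : i ≠ j) :
    |x j - x i|⁻¹ ≤ amendedPotential x := by
  have h0 : ∀ j i, 0 ≤ |x j - x i|⁻¹ := fun j i => inv_nonneg.2 (abs_nonneg _)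
  have h1 : |x j - x i|⁻¹ ≤ ∑ i, |x j - x i|⁻¹ :=
    Finset.single_le_sum (f := fun i => |x j - x i|⁻¹) (fun i _ => h0 j i) (Finset.mem_univ i)
  have h2 : |x i - x j|⁻¹ ≤ ∑ j, |x i - x j|⁻¹ :=
    Finset.single_le_sum (f := fun j => |x i - x j|⁻¹) (fun j _ => h0 i j) (Finset.mem_univ j)
  have h3 := Finset.add_le_sum (f := fun j => ∑ i, |x j - x i|⁻¹)
    (fun j _ => Finset.sum_nonneg fun i _ => h0 j i) (Finset.mem_univ i) (Finset.mem_univ j) hij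
  have h4 : 0 ≤ ∑ j, x j ^ 2 := Finset.sum_nonneg fun j _ => sq_nonneg _
  rw [abs_sub_comm] at h2
  rw [amendedPotential]
  linarith

theorem sq_le_amendedPotential (x : Fin n → ℝ) (i : Fin n) : x i ^ 2 ≤ 2 * amendedPotential x := by
  have h1 : x i ^ 2 ≤ ∑ j, x j ^ 2 :=
    Finset.single_le_sum (f := fun j => x j ^ 2) (fun j _ => sq_nonneg _) (Finset.mem_univ i)
  have h2 : 0 ≤ ∑ j, ∑ i, |x j - x i|⁻¹ :=
    Finset.sum_nonneg fun j _ => Finset.sum_nonneg fun i _ => inv_nonneg.2 (abs_nonneg _)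
  rw [amendedPotential]
  linarith

theorem hasDerivAt_amendedPotential {a : Fin n → ℝ} (ha : Function.Injective a) (v : Fin n → ℝ) :
    HasDerivAt (fun s : ℝ => amendedPotential (fun j => a j + s * v j))
      (∑ j, v j * (a j - ∑ i, cubeWeight a i j * (a j - a i))) 0 := by
  have h1 : ∀ j i, HasDerivAt (fun s : ℝ => |(a j + s * v j) - (a i + s * v i)|⁻¹)
      (-(cubeWeight a i j * ((a j - a i) * (v j - v i)))) 0 := by
    intro j i
    by_cases hij : i = j
    · subst hij
      simpa using hasDerivAt_const (0 : ℝ) (0 : ℝ)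
    · have := hasDerivAt_inv_abs (sub_ne_zero.2 fun h => hij (ha h).symm : a j - a i ≠ 0)
        (v j - v i)
      rw [cubeWeight, abs_sub_comm]
      convert! this using 3
      ring_nf
  have h2 : ∀ j, HasDerivAt (fun s : ℝ => (a j + s * v j) ^ 2) (2 * a j * v j) 0 := by
    intro j
    have := (((hasDerivAt_id (0 : ℝ)).mul_const (v j)).const_add (a j)).pow 2
    simpa using! this
  have h3 := ((HasDerivAt.fun_sum fun j (_ : j ∈ Finset.univ) =>
    HasDerivAt.fun_sum fun i (_ : i ∈ Finset.univ) => h1 j i).const_mul (1 / 2)).add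
    ((HasDerivAt.fun_sum fun j (_ : j ∈ Finset.univ) => h2 j).const_mul (1 / 2))
  convert! h3 using 1
  have e1 : ∑ j, ∑ i, cubeWeight a i j * ((a j - a i) * (v j - v i)) =
      2 * ∑ j, ∑ i, v j * (cubeWeight a i j * (a j - a i)) := by
    have : ∑ j, ∑ i, cubeWeight a i j * ((a j - a i) * (v j - v i)) =
      ∑ j, ∑ i, v j * (cubeWeight a i j * (a j - a i)) +
      ∑ j, ∑ i, v i * (cubeWeight a j i * (a i - a j)) := by
      rw [← Finset.sum_add_distrib]
      refine Finset.sum_congr rfl fun j _ => ?_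
      rw [← Finset.sum_add_distrib]
      refine Finset.sum_congr rfl fun i _ => ?_
      rw [cubeWeight_symm a j i]; ring
    rw [this, Finset.sum_comm (f := fun j i => v i * (cubeWeight a j i * (a i - a j))), two_mul]
  simp only [Finset.sum_neg_distrib]
  rw [e1]
  have e2 : ∑ j, 2 * a j * v j = 2 * ∑ j, v j * a j := by
    rw [Finset.mul_sum]
    exact Finset.sum_congr rfl fun j _ => by ring
  rw [e2]
  have e3 : ∑ j, v j * (a j - ∑ i, cubeWeight a i j * (a j - a i)) =
      ∑ j, v j * a j - ∑ j, ∑ i, v j * (cubeWeight a i j * (a j - a i)) := by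
    rw [← Finset.sum_sub_distrib]
    exact Finset.sum_congr rfl fun j _ => by rw [← Finset.mul_sum, mul_sub]
  rw [e3]
  ring

theorem exists_isCollinearEquilibrium (n : ℕ) :
    ∃ a : Fin n → ℝ, IsCollinearEquilibrium a := by
  set x₀ : Fin n → ℝ := fun i => (i : ℝ) with hx₀
  set f₀ := amendedPotential x₀ with hf₀
  have hf₀0 : 0 ≤ f₀ := by
    rw [hf₀, amendedPotential]; positivity
  set δ : ℝ := (f₀ + 2)⁻¹ with hδ
  have hδ0 : 0 < δ := by positivity
  have hδ1 : δ ≤ 1 := inv_le_one_of_one_le₀ (by linarith)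
  set M : ℝ := 2 * f₀ + n + 2 with hM
  set S : Set (Fin n → ℝ) := {x | (∀ i j, i < j → δ ≤ x j - x i) ∧ ∀ i, |x i| ≤ M} with hS
  have hScl : IsClosed S := by
    have : S = (⋂ i, ⋂ j, ⋂ (_ : i < j), {x : Fin n → ℝ | δ ≤ x j - x i}) ∩
        ⋂ i, {x : Fin n → ℝ | |x i| ≤ M} := by
      ext; simp [hS]
    rw [this]
    refine IsClosed.inter (isClosed_iInter fun i => isClosed_iInter fun j =>
      isClosed_iInter fun _ => isClosed_le continuous_const (by fun_prop))
      (isClosed_iInter fun i => isClosed_le (by fun_prop) continuous_const)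
  have hSc : IsCompact S := by
    refine Metric.isCompact_of_isClosed_isBounded hScl ?_
    refine (Metric.isBounded_closedBall (x := (0 : Fin n → ℝ)) (r := M)).subset fun x hx => ?_
    rw [mem_closedBall_zero_iff]
    exact (pi_norm_le_iff_of_nonneg (by positivity)).2 hx.2
  have hx₀S : x₀ ∈ S := by
    refine ⟨fun i j hij => ?_, fun i => ?_⟩
    · have : ((i : ℕ) : ℝ) + 1 ≤ (j : ℕ) := by exact_mod_cast hij
      simp only [hx₀]; linarith
    · have : ((i : ℕ) : ℝ) ≤ n := by exact_mod_cast i.2.le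
      simp only [hx₀]
      rw [abs_of_nonneg (by positivity)]; linarith
  have hcont : ContinuousOn (amendedPotential (n := n)) S := by
    unfold amendedPotential
    refine ContinuousOn.add (continuousOn_const.mul (continuousOn_finsetSum _ fun j _ =>
      continuousOn_finsetSum _ fun i _ => ?_)) (by fun_prop)
    by_cases hij : i = j
    · subst hij; simpa using continuousOn_const
    · refine ContinuousOn.inv₀ (by fun_prop) fun x hx => ?_
      rw [abs_ne_zero]
      rcases lt_or_gt_of_ne hij with h | h
      · have := hx.1 i j h; linarith
      · have := hx.1 j i h; intro h'; linarith
  obtain ⟨a, haS, hmin⟩ := hSc.exists_isMinOn ⟨x₀, hx₀S⟩ hcont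
  have hle : amendedPotential a ≤ f₀ := hmin hx₀S
  have hmono : StrictMono a := fun i j hij => by
    have := haS.1 i j hij; linarith
  refine ⟨a, hmono, fun j => ?_⟩
  have hstrict : (∀ i j, i < j → δ < a j - a i) ∧ ∀ i, |a i| < M := by
    refine ⟨fun i j hij => ?_, fun i => ?_⟩
    · have h1 := (inv_abs_le_amendedPotential a hij.ne).trans hle
      have h2 : 0 < a j - a i := sub_pos.2 (hmono hij)
      rw [abs_of_pos h2] at h1
      rw [hδ]
      refine inv_lt_of_inv_lt₀ h2 ?_
      linarith
    · have h1 := (sq_le_amendedPotential a i).trans (mul_le_mul_of_nonneg_left hle zero_le_two)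
      have hn : (0 : ℝ) ≤ n := by positivity
      refine abs_lt_of_sq_lt_sq (h1.trans_lt ?_) (by positivity)
      nlinarith
  set v : Fin n → ℝ := Pi.single j 1 with hv
  have hloc : IsLocalMin (fun s : ℝ => amendedPotential (fun j => a j + s * v j)) 0 := by
    have h1 : ∀ᶠ s in nhds (0 : ℝ), (fun j => a j + s * v j) ∈ S := by
      have c1 : ∀ i, Continuous fun s : ℝ => a i + s * v i := fun i => by fun_prop
      refine Filter.Eventually.and ?_ ?_
      · rw [eventually_all]; intro i
        rw [eventually_all]; intro k
        rw [eventually_imp_distrib_left]; intro hik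
        have : ∀ᶠ s in nhds (0 : ℝ), δ < (a k + s * v k) - (a i + s * v i) :=
          ((c1 k).sub (c1 i)).continuousAt.eventually
            (lt_mem_nhds (by simpa using hstrict.1 i k hik))
        filter_upwards [this] with s hs using hs.le
      · rw [eventually_all]; intro i
        have : ∀ᶠ s in nhds (0 : ℝ), |a i + s * v i| < M :=
          (c1 i).abs.continuousAt.eventually (gt_mem_nhds (by simpa using hstrict.2 i))
        filter_upwards [this] with s hs using hs.le
    filter_upwards [h1] with s hs
    have := hmin hs
    simpa using this
  have := hloc.hasDerivAt_eq_zero (hasDerivAt_amendedPotential hmono.injective v)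
  rw [Finset.sum_eq_single j (fun i _ hi => by simp [hv, hi]) (by simp)] at this
  simp only [hv, Pi.single_eq_same, one_mul] at this
  linarith

theorem IsCollinearEquilibrium.sum_eq_zero {a : Fin n → ℝ} (ha : IsCollinearEquilibrium a) :
    ∑ j, a j = 0 := by
  have h : ∑ j, a j = ∑ j, ∑ i, cubeWeight a i j * (a j - a i) :=
    Finset.sum_congr rfl fun j _ => (ha.balance j).symm
  have h2 : ∑ j, ∑ i, cubeWeight a i j * (a j - a i) =
      -∑ j, ∑ i, cubeWeight a i j * (a j - a i) := by
    conv_lhs => rw [Finset.sum_comm]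
    rw [← Finset.sum_neg_distrib]
    refine Finset.sum_congr rfl fun i _ => ?_
    rw [← Finset.sum_neg_distrib]
    refine Finset.sum_congr rfl fun j _ => ?_
    rw [cubeWeight_symm]; ring
  rw [h]; linarith

theorem IsCollinearEquilibrium.eq_smul_of_lt {a : Fin n → ℝ} (ha : IsCollinearEquilibrium a)
    {v : Fin n → ℝ} {lam : ℝ} (hlam : lam ≤ 1) (hv0 : ∑ j, v j = 0)
    (hv : ∀ j, ∑ i, cubeWeight a i j * (v j - v i) = lam * v j) {p₀ q₀ : Fin n}
    (hpq₀ : p₀ < q₀) (hlt : v p₀ < v q₀) : ∃ M, ∀ j, v j = M * a j := by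
  obtain ⟨⟨p, q⟩, hpq, hmax⟩ := Finset.exists_max_image
    (Finset.univ.filter fun x : Fin n × Fin n => x.1 < x.2)
    (fun x => (v x.2 - v x.1) / (a x.2 - a x.1)) ⟨(p₀, q₀), by simpa using hpq₀⟩
  simp only [Finset.mem_filter, Finset.mem_univ, true_and, Prod.forall] at hpq hmax
  set M := (v q - v p) / (a q - a p) with hM
  have hpos : ∀ {i j}, i < j → 0 < a j - a i := fun h => sub_pos.2 (ha.strictMono h)
  have hM0 : 0 < M := lt_of_lt_of_le (div_pos (sub_pos.2 hlt) (hpos hpq₀)) (hmax _ _ hpq₀)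
  set w : Fin n → ℝ := fun j => M * a j - v j with hw
  have hwm : ∀ {i j}, i ≤ j → w i ≤ w j := by
    intro i j hij
    rcases hij.eq_or_lt with rfl | hij
    · exact le_rfl
    · have := (div_le_iff₀ (hpos hij)).1 (hmax i j hij)
      simp only [hw]; linarith
  have hwpq : w p = w q := by
    have : M * (a q - a p) = v q - v p := div_mul_cancel₀ _ (hpos hpq).ne'
    simp only [hw]; linarith
  have hsum : ∑ i, (w q - w i) * (cubeWeight a i q - cubeWeight a i p) =
      (1 - lam) * (M * (a q - a p)) := by
    have e : ∀ j, ∑ i, cubeWeight a i j * (w j - w i) = M * a j - lam * v j := by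
      intro j
      rw [← ha.balance j, ← hv j, Finset.mul_sum, ← Finset.sum_sub_distrib]
      exact Finset.sum_congr rfl fun i _ => by simp only [hw]; ring
    have e2 : ∑ i, (w q - w i) * (cubeWeight a i q - cubeWeight a i p) =
        (M * a q - lam * v q) - (M * a p - lam * v p) := by
      rw [← e q, ← e p, ← Finset.sum_sub_distrib]
      exact Finset.sum_congr rfl fun i _ => by rw [hwpq]; ring
    have : M * (a q - a p) = v q - v p := div_mul_cancel₀ _ (hpos hpq).ne'
    rw [e2]; linear_combination lam * this
  have hW1 : ∀ {i}, i < p → cubeWeight a i q - cubeWeight a i p < 0 := by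
    intro i hi
    have h1 := hpos hi
    have h2 := hpos hpq
    rw [sub_neg, cubeWeight, cubeWeight, abs_sub_comm, abs_sub_comm (a i), abs_of_pos h1,
      abs_of_pos (hpos (hi.trans hpq))]
    exact inv_strictAnti₀ (by positivity) (pow_lt_pow_left₀ (by linarith) h1.le (by norm_num))
  have hW2 : ∀ {i}, q < i → 0 < cubeWeight a i q - cubeWeight a i p := by
    intro i hi
    have h1 := hpos hi
    have h2 := hpos hpq
    rw [sub_pos, cubeWeight, cubeWeight, abs_of_pos h1, abs_of_pos (hpos (hpq.trans hi))]
    exact inv_strictAnti₀ (by positivity) (pow_lt_pow_left₀ (by linarith) h1.le (by norm_num))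
  have hterm : ∀ i ∈ Finset.univ, (w q - w i) * (cubeWeight a i q - cubeWeight a i p) ≤ 0 := by
    intro i _
    rcases lt_or_ge i p with h | h
    · exact mul_nonpos_of_nonneg_of_nonpos (sub_nonneg.2 (hwm (h.trans hpq).le)) (hW1 h).le
    · rcases lt_or_ge q i with h' | h'
      · exact mul_nonpos_of_nonpos_of_nonneg (sub_nonpos.2 (hwm h'.le)) (hW2 h').le
      · have : w q = w i := le_antisymm (hwpq ▸ hwm h) (hwm h')
        simp [this]
  have hzero : ∑ i, (w q - w i) * (cubeWeight a i q - cubeWeight a i p) = 0 := by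
    refine le_antisymm (Finset.sum_nonpos hterm) ?_
    rw [hsum]
    exact mul_nonneg (by linarith) (mul_nonneg hM0.le (hpos hpq).le)
  have hconst : ∀ i, w i = w q := by
    intro i
    have hi := (Finset.sum_eq_zero_iff_of_nonpos hterm).1 hzero i (Finset.mem_univ i)
    rcases lt_or_ge i p with h | h
    · rcases mul_eq_zero.1 hi with h1 | h1
      · linarith
      · exact absurd h1 (hW1 h).ne
    · rcases lt_or_ge q i with h' | h'
      · rcases mul_eq_zero.1 hi with h1 | h1
        · linarith
        · exact absurd h1 (hW2 h').ne'
      · exact (le_antisymm (hwpq ▸ hwm h) (hwm h')).symm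
  have hw0 : ∑ j, w j = 0 := by
    simp only [hw, Finset.sum_sub_distrib, ← Finset.mul_sum, ha.sum_eq_zero, hv0]; simp
  have hq0 : w q = 0 := by
    rw [Finset.sum_congr rfl fun i _ => hconst i, Finset.sum_const, Finset.card_univ,
      Fintype.card_fin, nsmul_eq_mul] at hw0
    rcases mul_eq_zero.1 hw0 with h | h
    · have : n = 0 := by exact_mod_cast h
      subst this; exact p.elim0
    · exact h
  refine ⟨M, fun j => ?_⟩
  have := hconst j
  rw [hq0] at this
  simp only [hw] at this
  linarith

/-- Conley's theorem for collinear relative equilibria. -/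
theorem IsCollinearEquilibrium.eq_smul {a : Fin n → ℝ} (ha : IsCollinearEquilibrium a)
    {v : Fin n → ℝ} {lam : ℝ} (hlam : lam ≤ 1) (hv0 : ∑ j, v j = 0)
    (hv : ∀ j, ∑ i, cubeWeight a i j * (v j - v i) = lam * v j) : ∃ M, ∀ j, v j = M * a j := by
  by_cases h1 : ∃ p q, p < q ∧ v p < v q
  · obtain ⟨p, q, hpq, h⟩ := h1
    exact ha.eq_smul_of_lt hlam hv0 hv hpq h
  by_cases h2 : ∃ p q, p < q ∧ v q < v p
  · obtain ⟨p, q, hpq, h⟩ := h2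
    obtain ⟨M, hM⟩ := ha.eq_smul_of_lt (v := fun j => -v j) hlam (by simp [hv0]) (fun j => by
      rw [mul_neg, ← hv j, ← Finset.sum_neg_distrib]
      exact Finset.sum_congr rfl fun i _ => by ring) hpq (by simpa using h)
    exact ⟨-M, fun j => by have := hM j; linarith⟩
  · push Not at h1 h2
    have hc : ∀ i j, v i = v j := fun i j => by
      rcases lt_trichotomy i j with h | h | h
      · exact le_antisymm (h2 _ _ h) (h1 _ _ h)
      · rw [h]
      · exact le_antisymm (h1 _ _ h) (h2 _ _ h)
    refine ⟨0, fun j => ?_⟩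
    rw [Finset.sum_congr rfl fun i _ => hc i j, Finset.sum_const, Finset.card_univ,
      Fintype.card_fin, nsmul_eq_mul] at hv0
    rcases mul_eq_zero.1 hv0 with h | h
    · have : n = 0 := by exact_mod_cast h
      subst this; exact j.elim0
    · rw [h, zero_mul]

end Collinear
end ParabolicBounded

namespace ParabolicBounded

section Modal

variable {n : ℕ}

/-- An orthonormal basis of the configurations with center of mass zero which diagonalizes the
linearization at the collinear relative equilibrium `a`. -/
structure IsModalBasis {ι : Type*} [Fintype ι] [DecidableEq ι] (a : Fin n → ℝ)
    (b : ι → Fin n → ℝ) (lam : ι → ℝ) (k₀ : ι) (α : ℝ) : Prop where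
  complete : ∀ i j, ∑ k, b k i * b k j = (if i = j then 1 else 0) - (n : ℝ)⁻¹
  sum_eq_zero : ∀ k, ∑ i, b k i = 0
  eigen : ∀ k j, ∑ i, cubeWeight a i j * (b k j - b k i) = lam k * b k j
  orthonormal : ∀ k l, ∑ i, b k i * b l i = if k = l then 1 else 0
  coord : ∀ k, ∑ j, b k j * a j = if k = k₀ then α else 0
  eigenvalue_eq_one : lam k₀ = 1
  one_lt : ∀ k, k ≠ k₀ → 1 < lam k
  ne_zero : α ≠ 0

theorem IsModalBasis.mul_eq {ι : Type*} [Fintype ι] [DecidableEq ι] {a : Fin n → ℝ}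
    {b : ι → Fin n → ℝ} {lam : ι → ℝ} {k₀ : ι} {α : ℝ} (hb : IsModalBasis a b lam k₀ α)
    (ha : IsCollinearEquilibrium a) (j : Fin n) : α * b k₀ j = a j := by
  have h1 : ∑ k, b k j * ∑ i, b k i * a i = α * b k₀ j := by
    simp_rw [hb.coord]
    simp [mul_comm]
  have h2 : ∑ k, b k j * ∑ i, b k i * a i = ∑ i, (∑ k, b k j * b k i) * a i := by
    simp_rw [Finset.mul_sum, Finset.sum_mul]
    rw [Finset.sum_comm]
    exact Finset.sum_congr rfl fun i _ => Finset.sum_congr rfl fun k _ => by ring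
  rw [← h1, h2]
  simp_rw [hb.complete, sub_mul, Finset.sum_sub_distrib, ← Finset.mul_sum, ha.sum_eq_zero]
  simp

/-- The linearization of the attraction along the line of a collinear configuration. -/
def collinearHessian (a : Fin n → ℝ) : EuclideanSpace ℝ (Fin n) →ₗ[ℝ] EuclideanSpace ℝ (Fin n) where
  toFun u := WithLp.toLp 2 fun j => ∑ i, cubeWeight a i j * (u j - u i)
  map_add' u v := by
    ext j
    simp only [PiLp.add_apply, ← Finset.sum_add_distrib]
    exact Finset.sum_congr rfl fun i _ => by ring
  map_smul' c u := by
    ext j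
    simp only [PiLp.smul_apply, smul_eq_mul, RingHom.id_apply, Finset.mul_sum]
    exact Finset.sum_congr rfl fun i _ => by ring

theorem collinearHessian_apply (a : Fin n → ℝ) (u : EuclideanSpace ℝ (Fin n)) (j : Fin n) :
    collinearHessian a u j = ∑ i, cubeWeight a i j * (u j - u i) := rfl

theorem inner_collinearHessian (a : Fin n → ℝ) (u v : EuclideanSpace ℝ (Fin n)) :
    inner ℝ (collinearHessian a u) v =
      1 / 2 * ∑ j, ∑ i, cubeWeight a i j * ((u j - u i) * (v j - v i)) := by
  have h1 : inner ℝ (collinearHessian a u) v =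
      ∑ j, ∑ i, cubeWeight a i j * ((u j - u i) * v j) := by
    simp only [PiLp.inner_apply, collinearHessian_apply, RCLike.inner_apply, conj_trivial,
      Finset.mul_sum]
    exact Finset.sum_congr rfl fun j _ => Finset.sum_congr rfl fun i _ => by ring
  have h2 : inner ℝ (collinearHessian a u) v =
      -∑ j, ∑ i, cubeWeight a i j * ((u j - u i) * v i) := by
    rw [h1, Finset.sum_comm, ← Finset.sum_neg_distrib]
    refine Finset.sum_congr rfl fun i _ => ?_
    rw [← Finset.sum_neg_distrib]
    exact Finset.sum_congr rfl fun j _ => by rw [cubeWeight_symm]; ring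
  have h3 : ∑ j, ∑ i, cubeWeight a i j * ((u j - u i) * (v j - v i)) =
      ∑ j, ∑ i, cubeWeight a i j * ((u j - u i) * v j) -
      ∑ j, ∑ i, cubeWeight a i j * ((u j - u i) * v i) := by
    simp_rw [← Finset.sum_sub_distrib]
    exact Finset.sum_congr rfl fun j _ => Finset.sum_congr rfl fun i _ => by ring
  linarith

theorem collinearHessian_isSymmetric (a : Fin n → ℝ) : (collinearHessian a).IsSymmetric := by
  intro u v
  rw [inner_collinearHessian, real_inner_comm, inner_collinearHessian]
  congr 1
  exact Finset.sum_congr rfl fun j _ => Finset.sum_congr rfl fun i _ => by ring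

/-- The configurations on the line with center of mass zero. -/
def centered (n : ℕ) : Submodule ℝ (EuclideanSpace ℝ (Fin n)) where
  carrier := {u | ∑ i, u i = 0}
  add_mem' {u v} hu hv := by
    simp only [Set.mem_ofPred_eq, PiLp.add_apply, Finset.sum_add_distrib] at *
    rw [hu, hv, add_zero]
  zero_mem' := by simp
  smul_mem' c u hu := by
    simp only [Set.mem_ofPred_eq, PiLp.smul_apply, smul_eq_mul, ← Finset.mul_sum] at *
    rw [hu, mul_zero]

theorem mem_centered {u : EuclideanSpace ℝ (Fin n)} : u ∈ centered n ↔ ∑ i, u i = 0 := Iff.rfl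

theorem collinearHessian_mem (a : Fin n → ℝ) (u : EuclideanSpace ℝ (Fin n)) :
    collinearHessian a u ∈ centered n := by
  have h : ∑ j, collinearHessian a u j = -∑ j, collinearHessian a u j := by
    simp only [collinearHessian_apply]
    conv_lhs => rw [Finset.sum_comm]
    rw [← Finset.sum_neg_distrib]
    refine Finset.sum_congr rfl fun i _ => ?_
    rw [← Finset.sum_neg_distrib]
    exact Finset.sum_congr rfl fun j _ => by rw [cubeWeight_symm]; ring
  rw [mem_centered]; linarith

theorem exists_isModalBasis {a : Fin n → ℝ} (ha : IsCollinearEquilibrium a) (hn : 2 ≤ n) :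
    ∃ (d : ℕ) (b : Fin d → Fin n → ℝ) (lam : Fin d → ℝ) (k₀ : Fin d) (α : ℝ),
      IsModalBasis a b lam k₀ α := by
  have hT := (collinearHessian_isSymmetric a).restrict_invariant
    (V := centered n) fun u _ => collinearHessian_mem a u
  set d := Module.finrank ℝ (centered n) with hd
  set e := hT.eigenvectorBasis hd.symm with he
  set lam := hT.eigenvalues hd.symm with hlam
  set b : Fin d → Fin n → ℝ := fun k i => (e k : EuclideanSpace ℝ (Fin n)) i with hb
  have hsum : ∀ k, ∑ i, b k i = 0 := fun k => mem_centered.1 (e k).2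
  have heig : ∀ k j, ∑ i, cubeWeight a i j * (b k j - b k i) = lam k * b k j := by
    intro k j
    have h := congrArg (fun u : centered n => (u : EuclideanSpace ℝ (Fin n)) j)
      (hT.apply_eigenvectorBasis hd.symm k)
    exact h
  have hinner : ∀ u v : centered n, inner ℝ u v =
      ∑ i, (u : EuclideanSpace ℝ (Fin n)) i * (v : EuclideanSpace ℝ (Fin n)) i := by
    intro u v
    rw [Submodule.coe_inner, PiLp.inner_apply]
    exact Finset.sum_congr rfl fun i _ => by simp [mul_comm]
  have horth : ∀ k l, ∑ i, b k i * b l i = if k = l then 1 else 0 := by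
    intro k l
    rw [← orthonormal_iff_ite.1 e.orthonormal k l, hinner]
  have hcomplete : ∀ u v : centered n, inner ℝ u v =
      ∑ k, (∑ i, (u : EuclideanSpace ℝ (Fin n)) i * b k i) *
        ∑ i, b k i * (v : EuclideanSpace ℝ (Fin n)) i := by
    intro u v
    rw [← e.sum_inner_mul_inner u v]
    simp only [hinner, hb]
  have hn0 : (n : ℝ) ≠ 0 := by
    have : n ≠ 0 := by omega
    exact_mod_cast this
  set p : Fin n → centered n := fun i =>
    ⟨WithLp.toLp 2 fun j => (if i = j then 1 else 0) - (n : ℝ)⁻¹, by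
      rw [mem_centered]
      simp [hn0]⟩ with hp
  set a' : centered n := ⟨WithLp.toLp 2 a, mem_centered.2 ha.sum_eq_zero⟩ with ha'
  have ha0 : a' ≠ 0 := by
    intro h
    have h1 : ∀ i, a i = 0 := fun i =>
      congrArg (fun u : centered n => (u : EuclideanSpace ℝ (Fin n)) i) h
    have h2 := ha.strictMono (show (⟨0, by omega⟩ : Fin n) < ⟨1, by omega⟩ by
      rw [Fin.mk_lt_mk]; norm_num)
    rw [h1, h1] at h2
    exact lt_irrefl _ h2
  obtain ⟨k₀, hk₀⟩ : ∃ k, ∑ j, b k j * a j ≠ 0 := by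
    by_contra! h
    refine ha0 (inner_self_eq_zero (𝕜 := ℝ).1 ?_)
    rw [hcomplete]
    refine Finset.sum_eq_zero fun k _ => ?_
    rw [show ∑ i, b k i * (a' : EuclideanSpace ℝ (Fin n)) i = 0 from h k, mul_zero]
  have hlam_mul : ∀ k, lam k * ∑ j, b k j * a j = ∑ j, b k j * a j := by
    intro k
    have h1 := hT (e k) a'
    rw [hT.apply_eigenvectorBasis hd.symm k] at h1
    have h2 : (collinearHessian a).restrict (fun u _ => collinearHessian_mem a u) a' = a' := by
      ext j
      exact ha.balance j
    rw [h2, inner_smul_left] at h1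
    rw [hinner] at h1
    simpa using! h1
  have hmul : ∀ k, lam k ≤ 1 → ∃ M, ∀ j, b k j = M * a j := fun k hk =>
    ha.eq_smul hk (hsum k) (heig k)
  have hlam₀ : lam k₀ = 1 := mul_right_cancel₀ hk₀ (by rw [hlam_mul, one_mul])
  have hone : ∀ k, k ≠ k₀ → 1 < lam k := by
    intro k hk
    by_contra! hle
    obtain ⟨M, hM⟩ := hmul k hle
    obtain ⟨M₀, hM₀⟩ := hmul k₀ hlam₀.le
    have h1 := horth k k₀
    have h2 := horth k k
    have h3 := horth k₀ k₀
    simp only [hM, hM₀, hk, if_false, if_true] at h1 h2 h3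
    have e1 : ∑ i, M * a i * (M₀ * a i) = M * M₀ * ∑ i, a i * a i := by
      rw [Finset.mul_sum]; exact Finset.sum_congr rfl fun i _ => by ring
    have e2 : ∑ i, M * a i * (M * a i) = M * M * ∑ i, a i * a i := by
      rw [Finset.mul_sum]; exact Finset.sum_congr rfl fun i _ => by ring
    have e3 : ∑ i, M₀ * a i * (M₀ * a i) = M₀ * M₀ * ∑ i, a i * a i := by
      rw [Finset.mul_sum]; exact Finset.sum_congr rfl fun i _ => by ring
    rw [e1] at h1
    rw [e2] at h2
    rw [e3] at h3
    have : (M * M * ∑ i, a i * a i) * (M₀ * M₀ * ∑ i, a i * a i) =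
        (M * M₀ * ∑ i, a i * a i) * (M * M₀ * ∑ i, a i * a i) := by ring
    rw [h1, h2, h3] at this
    norm_num at this
  refine ⟨d, b, lam, k₀, ∑ j, b k₀ j * a j, ?_, hsum, heig, horth, ?_, hlam₀, hone, hk₀⟩
  · intro i j
    have hpb : ∀ i k, ∑ l, b k l * (p i : EuclideanSpace ℝ (Fin n)) l = b k i := by
      intro i k
      simp only [hp, mul_sub, Finset.sum_sub_distrib, ← Finset.sum_mul, hsum]
      simp
    have h1 := hcomplete (p i) (p j)
    simp_rw [mul_comm _ (b _ _), hpb] at h1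
    rw [Finset.sum_congr rfl fun k _ => mul_comm (b k i) (b k j), ← Finset.sum_congr rfl fun k _ =>
      mul_comm (b k i) (b k j), ← h1, hinner]
    simp only [hp, mul_sub, sub_mul, Finset.sum_sub_distrib]
    simp [hn0]
  · intro k
    split_ifs with h
    · rw [h]
    · by_contra h0
      have := hlam_mul k
      have h1 : lam k = 1 := mul_right_cancel₀ h0 (by rw [hlam_mul, one_mul])
      exact (hone k h).ne' h1

end Modal
end ParabolicBounded

namespace ParabolicBounded

section SecondOrder

variable {E F : Type*} [NormedAddCommGroup E] [NormedSpace ℝ E] [NormedAddCommGroup F]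
  [NormedSpace ℝ F]

theorem exists_lipschitz_fderiv {f : E → F} {x : E} (hf : ContDiffAt ℝ 2 f x) :
    ∃ L r : ℝ, 0 ≤ L ∧ 0 < r ∧ (∀ z ∈ Metric.ball x r, DifferentiableAt ℝ f z) ∧
      (∀ z ∈ Metric.ball x r, ‖fderiv ℝ f z‖ ≤ L) ∧
      ∀ z ∈ Metric.ball x r, ∀ z' ∈ Metric.ball x r,
        ‖fderiv ℝ f z - fderiv ℝ f z'‖ ≤ L * ‖z - z'‖ := by
  have h1 : ContDiffAt ℝ 1 (fderiv ℝ f) x := hf.fderiv_right (by norm_num)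
  obtain ⟨K, s, hs, hK⟩ := h1.exists_lipschitzOnWith
  have h2 : ∀ᶠ z in nhds x, DifferentiableAt ℝ f z := by
    have := (hf.of_le (m := 1) (by norm_num)).eventually (by simp)
    filter_upwards [this] with z hz using hz.differentiableAt (by norm_num)
  have h3 : ∀ᶠ z in nhds x, ‖fderiv ℝ f z‖ < ‖fderiv ℝ f x‖ + 1 :=
    h1.continuousAt.norm.eventually (gt_mem_nhds (by linarith))
  obtain ⟨r, hr, hball⟩ := Metric.eventually_nhds_iff_ball.1 (h2.and (h3.and hs))
  refine ⟨max K (‖fderiv ℝ f x‖ + 1), r, le_max_of_le_left K.2, hr, fun z hz => (hball z hz).1,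
    fun z hz => (hball z hz).2.1.le.trans (le_max_right _ _), fun z hz z' hz' => ?_⟩
  have := hK.dist_le_mul z (hball z hz).2.2 z' (hball z' hz').2.2
  rw [dist_eq_norm, dist_eq_norm] at this
  exact this.trans (mul_le_mul_of_nonneg_right (le_max_left _ _) (norm_nonneg _))

theorem exists_norm_remainder_sub_le {f : E → F} {x : E} (hf : ContDiffAt ℝ 2 f x) :
    ∃ L r : ℝ, 0 ≤ L ∧ 0 < r ∧ ∀ h h' : E, ‖h‖ < r → ‖h'‖ < r →
      ‖(f (x + h) - f x - fderiv ℝ f x h) - (f (x + h') - f x - fderiv ℝ f x h')‖ ≤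
        L * (‖h‖ + ‖h'‖) * ‖h - h'‖ := by
  obtain ⟨L, r, hL, hr, hd, -, hlip⟩ := exists_lipschitz_fderiv hf
  refine ⟨L, r, hL, hr, fun h h' hh hh' => ?_⟩
  set ρ := max ‖h‖ ‖h'‖ with hρ
  have hsub : Metric.closedBall x ρ ⊆ Metric.ball x r :=
    Metric.closedBall_subset_ball (max_lt hh hh')
  have key := (convex_closedBall x ρ).norm_image_sub_le_of_norm_hasFDerivWithin_le'
    (f := f) (f' := fderiv ℝ f) (φ := fderiv ℝ f x) (C := L * ρ) (x := x + h') (y := x + h)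
    (fun z hz => (hd z (hsub hz)).hasFDerivAt.hasFDerivWithinAt)
    (fun z hz => (hlip z (hsub hz) x (Metric.mem_ball_self hr)).trans
      (mul_le_mul_of_nonneg_left (by simpa [dist_eq_norm] using hz) hL))
    (by simp [hρ]) (by simp [hρ])
  have e : (f (x + h) - f x - fderiv ℝ f x h) - (f (x + h') - f x - fderiv ℝ f x h') =
      f (x + h) - f (x + h') - fderiv ℝ f x (x + h - (x + h')) := by
    rw [add_sub_add_left_eq_sub, map_sub]; abel
  rw [e]
  refine key.trans ?_
  rw [add_sub_add_left_eq_sub]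
  refine mul_le_mul_of_nonneg_right (mul_le_mul_of_nonneg_left ?_ hL) (norm_nonneg _)
  exact max_le (by linarith [norm_nonneg h']) (by linarith [norm_nonneg h])

theorem exists_norm_increment_sub_le {f : E → F} {x : E} (hf : ContDiffAt ℝ 2 f x) :
    ∃ L r : ℝ, 0 ≤ L ∧ 0 < r ∧ (∀ s y : E, ‖s - x‖ < r → ‖y‖ < r →
      ‖f (s - y) - f s‖ ≤ L * ‖y‖) ∧
      ∀ s s' y y' : E, ‖s - x‖ < r → ‖s' - x‖ < r → ‖y‖ < r → ‖y'‖ < r →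
      ‖(f (s - y) - f s) - (f (s' - y') - f s')‖ ≤ L * ‖y - y'‖ + L * ‖y‖ * ‖s - s'‖ := by
  obtain ⟨L, r, hL, hr, hd, hbound, hlip⟩ := exists_lipschitz_fderiv hf
  have hmv : ∀ z ∈ Metric.ball x r, ∀ z' ∈ Metric.ball x r, ‖f z' - f z‖ ≤ L * ‖z' - z‖ :=
    fun z hz z' hz' => (convex_ball x r).norm_image_sub_le_of_norm_fderiv_le hd hbound hz hz'
  have hmem : ∀ s y : E, ‖s - x‖ < r / 2 → ‖y‖ < r / 2 → s - y ∈ Metric.ball x r := by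
    intro s y hs hy
    rw [mem_ball_iff_norm]
    calc ‖s - y - x‖ = ‖(s - x) - y‖ := by congr 1; abel
      _ ≤ ‖s - x‖ + ‖y‖ := norm_sub_le _ _
      _ < r := by linarith
  have hmem' : ∀ s : E, ‖s - x‖ < r / 2 → s ∈ Metric.ball x r := fun s hs => by
    rw [mem_ball_iff_norm]; linarith
  refine ⟨L, r / 2, hL, by positivity, fun s y hs hy => ?_, fun s s' y y' hs hs' hy hy' => ?_⟩
  · simpa using hmv s (hmem' s hs) (s - y) (hmem s y hs hy)
  · have h1 : ‖(f (s - y) - f s) - (f (s' - y) - f s')‖ ≤ L * ‖y‖ * ‖s - s'‖ := by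
      refine (convex_ball x (r / 2)).norm_image_sub_le_of_norm_hasFDerivWithin_le
        (f := fun s => f (s - y) - f s) (f' := fun s => fderiv ℝ f (s - y) - fderiv ℝ f s)
        (fun z hz => ?_) (fun z hz => ?_) (mem_ball_iff_norm.2 hs') (mem_ball_iff_norm.2 hs)
      · rw [mem_ball_iff_norm] at hz
        refine HasFDerivAt.hasFDerivWithinAt (HasFDerivAt.sub ?_ (hd z (hmem' z hz)).hasFDerivAt)
        exact (hasFDerivAt_comp_sub y).2 (hd _ (hmem z y hz hy)).hasFDerivAt
      · rw [mem_ball_iff_norm] at hz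
        simpa using hlip (z - y) (hmem z y hz hy) z (hmem' z hz)
    have h2 : ‖f (s' - y) - f (s' - y')‖ ≤ L * ‖y - y'‖ := by
      have := hmv (s' - y') (hmem s' y' hs' hy') (s' - y) (hmem s' y hs' hy)
      rwa [sub_sub_sub_cancel_left, norm_sub_rev y'] at this
    calc _ = ‖(f (s' - y) - f (s' - y')) + ((f (s - y) - f s) - (f (s' - y) - f s'))‖ := by
          congr 1; abel
      _ ≤ _ := (norm_add_le _ _).trans (add_le_add h2 h1)

end SecondOrder

section Gravity

/-- The Newtonian force field of a unit mass (up to sign). -/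
def grav (z : ℂ) : ℂ := (‖z‖ ^ 3)⁻¹ • z

theorem grav_zero : grav 0 = 0 := by simp [grav]

theorem grav_neg (z : ℂ) : grav (-z) = -grav z := by simp [grav]

theorem grav_mul {u : ℂ} (hu : ‖u‖ = 1) (z : ℂ) : grav (u * z) = u * grav z := by
  rw [grav, grav, norm_mul, hu, one_mul, mul_smul_comm]

theorem grav_smul {c : ℝ} (hc : 0 < c) (z : ℂ) : grav (c * z) = ((c ^ 2)⁻¹ : ℝ) * grav z := by
  rw [grav, grav, norm_mul, Complex.norm_real, Real.norm_of_nonneg hc.le, Complex.real_smul,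
    Complex.real_smul]
  have : (c : ℂ) ≠ 0 := by exact_mod_cast hc.ne'
  push_cast
  field_simp

theorem grav_one : grav 1 = 1 := by simp [grav]

theorem contDiffAt_grav {z : ℂ} (hz : z ≠ 0) : ContDiffAt ℝ 2 grav z :=
  ContDiffAt.smul (ContDiffAt.inv ((contDiffAt_norm ℝ hz).pow 3) (by simpa using hz)) contDiffAt_id

theorem continuousAt_grav {z : ℂ} (hz : z ≠ 0) : ContinuousAt grav z :=
  (contDiffAt_grav hz).continuousAt

/-- The derivative of `grav` at `1`. -/
def gravDeriv (h : ℂ) : ℂ := ⟨-2 * h.re, h.im⟩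

theorem fderiv_grav {a : ℝ} (ha : a ≠ 0) (h : ℂ) :
    fderiv ℝ grav a h = ((|a| ^ 3)⁻¹ : ℝ) * gravDeriv h := by
  have e : grav = fun z => ((‖z‖ ^ 2) ^ (-(3 / 2) : ℝ)) • z := by
    funext z
    rw [grav, ← Real.rpow_natCast ‖z‖ 2, ← Real.rpow_mul (norm_nonneg _), ← Real.rpow_natCast,
      ← Real.rpow_neg (norm_nonneg _)]
    norm_num
  have hn : ‖(a : ℂ)‖ ^ 2 ≠ 0 := by simpa using ha
  have h1 : HasFDerivAt (fun z : ℂ => ‖z‖ ^ 2) (2 • innerSL ℝ (a : ℂ)) (a : ℂ) :=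
    (hasStrictFDerivAt_norm_sq (a : ℂ)).hasFDerivAt
  have h2 := (h1.rpow_const (p := -(3 / 2)) (Or.inl hn)).smul (hasFDerivAt_id (a : ℂ))
  rw [e]
  have h3 := h2.fderiv
  have e4 : (‖(a : ℂ)‖ ^ 2) ^ (-(3 / 2) : ℝ) = (|a| ^ 3)⁻¹ := by
    rw [Complex.norm_real, Real.norm_eq_abs, ← Real.rpow_natCast, ← Real.rpow_mul (abs_nonneg _),
      ← Real.rpow_natCast, ← Real.rpow_neg (abs_nonneg _)]
    norm_num
  have e5 : (‖(a : ℂ)‖ ^ 2) ^ (-(3 / 2) - 1 : ℝ) = (|a| ^ 3)⁻¹ * (a ^ 2)⁻¹ := by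
    rw [Real.rpow_sub (by positivity), e4, Complex.norm_real, Real.norm_eq_abs, sq_abs,
      Real.rpow_one, div_eq_mul_inv]
  have h4 : fderiv ℝ (fun z : ℂ => ((‖z‖ ^ 2) ^ (-(3 / 2) : ℝ)) • z) a = _ := h3
  rw [h4]
  simp only [add_apply, smul_apply, ContinuousLinearMap.smulRight_apply, innerSL_apply_apply, e4,
    e5, id]
  generalize (|a| ^ 3)⁻¹ = c
  have e6 : (2 : ℕ) • inner ℝ (a : ℂ) h = 2 * (a * h.re) := by
    simp [Complex.inner, mul_comm]
  have e7 : -(3 / 2) * (c * (a ^ 2)⁻¹) * (2 * (a * h.re)) * a = -3 * c * h.re := by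
    field_simp
  rw [e6, smul_eq_mul, Complex.real_smul, Complex.real_smul, ← Complex.ofReal_mul, e7]
  apply Complex.ext
  · simp [gravDeriv]
    ring
  · simp [gravDeriv]

end Gravity
end ParabolicBounded

namespace ParabolicBounded

section InnerField

variable {n : ℕ} {ι : Type*}

/-- The deviation of the angular velocity of the rotating frame. -/
def rotation (k₀ : ι) (α : ℝ) : (ι → ℂ × ℂ) →L[ℝ] ℝ :=
  α⁻¹ • ((Complex.imCLM ∘L ContinuousLinearMap.snd ℝ ℂ ℂ -
    Complex.reCLM ∘L ContinuousLinearMap.fst ℝ ℂ ℂ) ∘L ContinuousLinearMap.proj k₀)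

theorem rotation_apply (k₀ : ι) (α : ℝ) (Y : ι → ℂ × ℂ) :
    rotation k₀ α Y = α⁻¹ * ((Y k₀).2.im - (Y k₀).1.re) := rfl

variable [Fintype ι]

/-- The configuration with modal coordinates `Y`, in the rotating frame. -/
def shape (a : Fin n → ℝ) (b : ι → Fin n → ℝ) (Y : ι → ℂ × ℂ) (j : Fin n) : ℂ :=
  a j + ∑ k, (b k j : ℂ) * (Y k).1

/-- The velocities with modal coordinates `Y`, in the rotating frame. -/
def momentum (a : Fin n → ℝ) (b : ι → Fin n → ℝ) (Y : ι → ℂ × ℂ) (j : Fin n) : ℂ :=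
  a j * Complex.I + ∑ k, (b k j : ℂ) * (Y k).2

/-- The mutual attraction of the unit masses. -/
def mutualForce (a : Fin n → ℝ) (b : ι → Fin n → ℝ) (Y : ι → ℂ × ℂ) (j : Fin n) : ℂ :=
  ∑ i, grav (shape a b Y i - shape a b Y j)

theorem shape_zero (a : Fin n → ℝ) (b : ι → Fin n → ℝ) (j : Fin n) : shape a b 0 j = a j := by
  simp [shape]

theorem contDiff_shape (a : Fin n → ℝ) (b : ι → Fin n → ℝ) (j : Fin n) :
    ContDiff ℝ 2 fun Y => shape a b Y j := by
  unfold shape; fun_prop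

/-- The linear part of `shape`. -/
def shapeLin (b : ι → Fin n → ℝ) (j : Fin n) : (ι → ℂ × ℂ) →L[ℝ] ℂ :=
  ∑ k, b k j • (ContinuousLinearMap.fst ℝ ℂ ℂ ∘L ContinuousLinearMap.proj k)

theorem shapeLin_apply (b : ι → Fin n → ℝ) (j : Fin n) (Y : ι → ℂ × ℂ) :
    shapeLin b j Y = ∑ k, (b k j : ℂ) * (Y k).1 := by
  simp [shapeLin]

theorem shape_eq (a : Fin n → ℝ) (b : ι → Fin n → ℝ) (Y : ι → ℂ × ℂ) (j : Fin n) :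
    shape a b Y j = a j + shapeLin b j Y := by
  rw [shapeLin_apply, shape]

theorem contDiffAt_grav_shape {a : Fin n → ℝ} (ha : Function.Injective a) (b : ι → Fin n → ℝ)
    (i j : Fin n) : ContDiffAt ℝ 2 (fun Y => grav (shape a b Y i - shape a b Y j)) 0 := by
  by_cases h : i = j
  · subst h
    simpa using contDiffAt_const
  · refine ContDiffAt.comp (g := grav) (0 : ι → ℂ × ℂ) (contDiffAt_grav ?_)
      ((contDiff_shape a b i).sub (contDiff_shape a b j)).contDiffAt
    simp only [shape_zero, ne_eq, sub_eq_zero, Complex.ofReal_inj]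
    exact fun h' => h (ha h')

theorem hasFDerivAt_grav_shape {a : Fin n → ℝ} (ha : Function.Injective a) (b : ι → Fin n → ℝ)
    (i j : Fin n) : HasFDerivAt (fun Y => grav (shape a b Y i - shape a b Y j))
      (fderiv ℝ grav ((a i - a j : ℝ) : ℂ) ∘L (shapeLin b i - shapeLin b j)) 0 := by
  by_cases h : i = j
  · subst h
    simpa using hasFDerivAt_const _ _
  · have h1 : ∀ l, HasFDerivAt (fun Y => shape a b Y l) (shapeLin b l) 0 := fun l => by
      simp only [shape_eq]
      exact (shapeLin b l).hasFDerivAt.const_add _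
    have hne : ((a i - a j : ℝ) : ℂ) ≠ 0 := by
      simp only [ne_eq, Complex.ofReal_eq_zero, sub_eq_zero]
      exact fun h' => h (ha h')
    have h2 : HasFDerivAt grav (fderiv ℝ grav ((a i - a j : ℝ) : ℂ))
        (shape a b 0 i - shape a b 0 j) := by
      rw [shape_zero, shape_zero, ← Complex.ofReal_sub]
      exact ((contDiffAt_grav hne).differentiableAt (by norm_num)).hasFDerivAt
    exact h2.comp (0 : ι → ℂ × ℂ) ((h1 i).sub (h1 j))

theorem gravDeriv_add (z w : ℂ) : gravDeriv (z + w) = gravDeriv z + gravDeriv w := by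
  apply Complex.ext <;> simp [gravDeriv]; ring

theorem gravDeriv_real_mul (r : ℝ) (z : ℂ) : gravDeriv (r * z) = r * gravDeriv z := by
  apply Complex.ext <;> simp [gravDeriv]; ring

/-- `gravDeriv` as a linear map. -/
def gravDerivLin : ℂ →ₗ[ℝ] ℂ where
  toFun := gravDeriv
  map_add' := gravDeriv_add
  map_smul' r z := by simpa using gravDeriv_real_mul r z

variable [DecidableEq ι]

/-- The modal coordinates of the relative equilibrium. -/
def modalCenter (k₀ : ι) (α : ℝ) (k : ι) : ℂ := ((if k = k₀ then α else 0 : ℝ) : ℂ)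

/-- The vector field of the unit masses in modal coordinates. -/
def innerField (a : Fin n → ℝ) (b : ι → Fin n → ℝ) (k₀ : ι) (α : ℝ) (Y : ι → ℂ × ℂ) (k : ι) :
    ℂ × ℂ :=
  (modalCenter k₀ α k * Complex.I + (Y k).2 -
      ((1 + rotation k₀ α Y : ℝ) : ℂ) * (Complex.I * (modalCenter k₀ α k + (Y k).1)),
    ∑ j, (b k j : ℂ) * mutualForce a b Y j -
      ((1 + rotation k₀ α Y : ℝ) : ℂ) *
        (Complex.I * (modalCenter k₀ α k * Complex.I + (Y k).2)))

/-- The linearization of `innerField`. -/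
def innerLin (lam : ι → ℝ) (k₀ : ι) : (ι → ℂ × ℂ) →L[ℝ] (ι → ℂ × ℂ) :=
  ContinuousLinearMap.pi fun k =>
    blockOp (if k = k₀ then 1 else 0) (lam k) ∘L ContinuousLinearMap.proj k

theorem contDiffAt_innerField {a : Fin n → ℝ} (ha : Function.Injective a) (b : ι → Fin n → ℝ)
    (k₀ : ι) (α : ℝ) : ContDiffAt ℝ 2 (innerField a b k₀ α) 0 := by
  have hrot : ContDiff ℝ 2 fun Y => ((1 + rotation k₀ α Y : ℝ) : ℂ) :=
    Complex.ofRealCLM.contDiff.comp (contDiff_const.add (rotation k₀ α).contDiff)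
  refine contDiffAt_pi.2 fun k => ContDiffAt.prodMk ?_ ?_
  · refine ContDiffAt.sub (by fun_prop) (hrot.contDiffAt.mul (by fun_prop))
  · refine ContDiffAt.sub (ContDiffAt.sum fun j _ => contDiffAt_const.mul
      (ContDiffAt.sum fun i _ => contDiffAt_grav_shape ha b i j))
      (hrot.contDiffAt.mul (by fun_prop))

theorem sum_fderiv_grav_shape {a : Fin n → ℝ} (ha : Function.Injective a) {b : ι → Fin n → ℝ}
    {lam : ι → ℝ} {k₀ : ι} {α : ℝ} (hb : IsModalBasis a b lam k₀ α) (Y : ι → ℂ × ℂ) (k : ι) :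
    ∑ j, (b k j : ℂ) * ∑ i, fderiv ℝ grav ((a i - a j : ℝ) : ℂ) (shapeLin b i Y - shapeLin b j Y) =
      -(lam k * gravDeriv (Y k).1) := by
  have h1 : ∀ j i, fderiv ℝ grav ((a i - a j : ℝ) : ℂ) (shapeLin b i Y - shapeLin b j Y) =
      ∑ l, ((cubeWeight a i j * (b l i - b l j) : ℝ) : ℂ) * gravDeriv (Y l).1 := by
    intro j i
    by_cases h : i = j
    · subst h; simp
    · rw [fderiv_grav (sub_ne_zero.2 fun h' => h (ha h'))]
      have : gravDeriv (shapeLin b i Y - shapeLin b j Y) =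
          ∑ l, ((b l i - b l j : ℝ) : ℂ) * gravDeriv (Y l).1 := by
        rw [shapeLin_apply, shapeLin_apply, ← Finset.sum_sub_distrib]
        change gravDerivLin _ = _
        rw [map_sum]
        refine Finset.sum_congr rfl fun l _ => ?_
        rw [← sub_mul, ← Complex.ofReal_sub]
        exact gravDeriv_real_mul _ _
      rw [this, Finset.mul_sum]
      exact Finset.sum_congr rfl fun l _ => by rw [cubeWeight]; push_cast; ring
  have h2 : ∀ j, ∑ i, fderiv ℝ grav ((a i - a j : ℝ) : ℂ) (shapeLin b i Y - shapeLin b j Y) =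
      ∑ l, ((-(lam l * b l j) : ℝ) : ℂ) * gravDeriv (Y l).1 := by
    intro j
    simp_rw [h1]
    rw [Finset.sum_comm]
    refine Finset.sum_congr rfl fun l _ => ?_
    rw [← Finset.sum_mul, ← Complex.ofReal_sum, ← hb.eigen l j, ← Finset.sum_neg_distrib]
    congr 2
    exact Finset.sum_congr rfl fun i _ => by ring
  simp_rw [h2, Finset.mul_sum]
  rw [Finset.sum_comm]
  have h3 : ∀ l, ∑ j, (b k j : ℂ) * (((-(lam l * b l j) : ℝ) : ℂ) * gravDeriv (Y l).1) =
      ((-(lam l * if k = l then 1 else 0) : ℝ) : ℂ) * gravDeriv (Y l).1 := by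
    intro l
    rw [← hb.orthonormal k l, Finset.mul_sum, ← Finset.sum_neg_distrib, Complex.ofReal_sum,
      Finset.sum_mul]
    exact Finset.sum_congr rfl fun j _ => by push_cast; ring
  simp_rw [h3]
  rw [Finset.sum_eq_single k (fun l _ hl => by simp [hl.symm]) (by simp)]
  simp

theorem sum_grav_collinear {a : Fin n → ℝ} (ha : IsCollinearEquilibrium a) (j : Fin n) :
    ∑ i, grav ((a i : ℂ) - a j) = -a j := by
  have : ∀ i, grav ((a i : ℂ) - a j) = ((-(cubeWeight a i j * (a j - a i)) : ℝ) : ℂ) := by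
    intro i
    rw [grav, ← Complex.ofReal_sub, Complex.norm_real, Real.norm_eq_abs, cubeWeight,
      Complex.real_smul]
    push_cast; ring
  simp_rw [this]
  rw [← Complex.ofReal_sum, Finset.sum_neg_distrib, ha.balance, Complex.ofReal_neg]

theorem innerField_zero {a : Fin n → ℝ} (ha : IsCollinearEquilibrium a) {b : ι → Fin n → ℝ}
    {lam : ι → ℝ} {k₀ : ι} {α : ℝ} (hb : IsModalBasis a b lam k₀ α) :
    innerField a b k₀ α 0 = 0 := by
  funext k
  have h : ∑ j, (b k j : ℂ) * mutualForce a b 0 j = -modalCenter k₀ α k := by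
    simp only [mutualForce, shape_zero, sum_grav_collinear ha, modalCenter]
    rw [← hb.coord k]
    simp
  simp only [innerField, h, map_zero, Pi.zero_apply, Prod.fst_zero, Prod.snd_zero]
  ext1
  · push_cast; simp; ring
  · push_cast; simp
    linear_combination (-modalCenter k₀ α k) * Complex.I_mul_I

theorem hasFDerivAt_innerField {a : Fin n → ℝ} (ha : IsCollinearEquilibrium a)
    {b : ι → Fin n → ℝ} {lam : ι → ℝ} {k₀ : ι} {α : ℝ} (hb : IsModalBasis a b lam k₀ α) :
    HasFDerivAt (innerField a b k₀ α) (innerLin lam k₀) 0 := by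
  have hinj := ha.strictMono.injective
  have hrot : HasFDerivAt (fun Y => ((1 + rotation k₀ α Y : ℝ) : ℂ))
      (Complex.ofRealCLM ∘L rotation k₀ α) 0 :=
    Complex.ofRealCLM.hasFDerivAt.comp (0 : ι → ℂ × ℂ)
      ((rotation k₀ α).hasFDerivAt.const_add 1)
  refine hasFDerivAt_pi.2 fun k => ?_
  have hfst : HasFDerivAt (fun Y : ι → ℂ × ℂ => (Y k).1)
      (ContinuousLinearMap.fst ℝ ℂ ℂ ∘L ContinuousLinearMap.proj k) 0 :=
    (ContinuousLinearMap.fst ℝ ℂ ℂ ∘L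
      ContinuousLinearMap.proj (φ := fun _ : ι => ℂ × ℂ) k).hasFDerivAt
  have hsnd : HasFDerivAt (fun Y : ι → ℂ × ℂ => (Y k).2)
      (ContinuousLinearMap.snd ℝ ℂ ℂ ∘L ContinuousLinearMap.proj k) 0 :=
    (ContinuousLinearMap.snd ℝ ℂ ℂ ∘L
      ContinuousLinearMap.proj (φ := fun _ : ι => ℂ × ℂ) k).hasFDerivAt
  have h1 := (hsnd.const_add (modalCenter k₀ α k * Complex.I)).sub
    (hrot.mul ((hfst.const_add (modalCenter k₀ α k)).const_mul Complex.I))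
  have h2 := (HasFDerivAt.fun_sum fun j (_ : j ∈ Finset.univ) => (HasFDerivAt.fun_sum
    fun i (_ : i ∈ Finset.univ) => hasFDerivAt_grav_shape hinj b i j).const_mul (b k j : ℂ)).sub
    (hrot.mul ((hsnd.const_add (modalCenter k₀ α k * Complex.I)).const_mul Complex.I))
  refine (h1.prodMk h2).congr_fderiv ?_
  ext1 Y
  have h3 := sum_fderiv_grav_shape hinj hb Y k
  simp only [ContinuousLinearMap.prod_apply, sub_apply, add_apply, smul_apply,
    ContinuousLinearMap.comp_apply, ContinuousLinearMap.proj_apply, blockOp_apply, sum_apply]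
  have h4 : modalCenter k₀ α k * (rotation k₀ α Y : ℂ) =
      (((if k = k₀ then 1 else 0) * ((Y k).2.im - (Y k).1.re) : ℝ) : ℂ) := by
    rw [modalCenter, ← Complex.ofReal_mul]
    congr 1
    split_ifs with h
    · rw [h, rotation_apply, mul_inv_cancel_left₀ hb.ne_zero, one_mul]
    · rw [zero_mul, zero_mul]
  have h5 : -gravDeriv (Y k).1 = 2 * ((Y k).1.re : ℂ) - Complex.I * ((Y k).1.im : ℂ) := by
    apply Complex.ext <;> simp [gravDeriv]
  rw [← h4, ← h5]
  simp only [smul_eq_mul, h3, map_zero, add_zero, Complex.ofReal_one, one_mul, Pi.zero_apply,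
    Prod.fst_zero, Prod.snd_zero, Complex.ofRealCLM_apply, ContinuousLinearMap.coe_fst',
    ContinuousLinearMap.coe_snd']
  ext1
  · simp only
    ring
  · simp only
    linear_combination (-modalCenter k₀ α k * (rotation k₀ α Y : ℂ)) * Complex.I_mul_I

/-- The nonlinear part of `innerField` is quadratic. -/
theorem exists_norm_innerField_sub_le {a : Fin n → ℝ} (ha : IsCollinearEquilibrium a)
    {b : ι → Fin n → ℝ} {lam : ι → ℝ} {k₀ : ι} {α : ℝ} (hb : IsModalBasis a b lam k₀ α) :
    ∃ L r : ℝ, 0 ≤ L ∧ 0 < r ∧ ∀ Y Y' : ι → ℂ × ℂ, ‖Y‖ < r → ‖Y'‖ < r →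
      ‖(innerField a b k₀ α Y - innerLin lam k₀ Y) -
        (innerField a b k₀ α Y' - innerLin lam k₀ Y')‖ ≤ L * (‖Y‖ + ‖Y'‖) * ‖Y - Y'‖ := by
  obtain ⟨L, r, hL, hr, h⟩ := exists_norm_remainder_sub_le
    (contDiffAt_innerField ha.strictMono.injective b k₀ α)
  refine ⟨L, r, hL, hr, fun Y Y' hY hY' => ?_⟩
  simpa [(hasFDerivAt_innerField ha hb).fderiv, innerField_zero ha hb] using h Y Y' hY hY'

theorem hasGreen_innerLin {a : Fin n → ℝ} {b : ι → Fin n → ℝ} {lam : ι → ℝ} {k₀ : ι} {α : ℝ}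
    (hb : IsModalBasis a b lam k₀ α) : HasGreen (innerLin lam k₀) := by
  refine hasGreen_pi fun k => ?_
  split_ifs with h
  · rw [h, hb.eigenvalue_eq_one]
    exact hasGreen_blockOp_one
  · exact hasGreen_blockOp_zero (hb.one_lt k h)

end InnerField
end ParabolicBounded

namespace ParabolicBounded

section Tide

variable {n : ℕ} {ι : Type*}

/-- The position of the escaping body close to the parabolic solution, in scaled units. -/
def outerPos (t : ℝ) (δ : ℂ) : ℂ := ((t ^ (2 / 3 : ℝ) : ℝ) : ℂ) + δ

theorem rpow_eq_pow_of_div_twelve {t : ℝ} (ht : 0 < t) {p : ℝ} {k : ℕ} (hp : p = -(k / 12)) :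
    t ^ p = (t ^ (-(1 / 12) : ℝ)) ^ k := by
  rw [← Real.rpow_natCast, ← Real.rpow_mul ht.le]
  congr 1
  rw [hp]; ring

theorem grav_outerPos_sub {t : ℝ} (ht : 0 < t) (δ w : ℂ) :
    grav (outerPos t δ - w) = (((t ^ (-(1 / 12) : ℝ)) ^ 16 : ℝ) : ℂ) *
      grav (1 + (((t ^ (-(1 / 12) : ℝ)) ^ 8 : ℝ) : ℂ) * δ -
        (((t ^ (-(1 / 12) : ℝ)) ^ 8 : ℝ) : ℂ) * w) := by
  set x := t ^ (-(1 / 12) : ℝ) with hx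
  have hx0 : 0 < x := Real.rpow_pos_of_pos ht _
  have h1 : t ^ (2 / 3 : ℝ) = (x ^ 8)⁻¹ := by
    rw [← rpow_eq_pow_of_div_twelve ht (p := -(2 / 3)) (by norm_num), ← Real.rpow_neg ht.le,
      neg_neg]
  have hxc : (x : ℂ) ≠ 0 := by exact_mod_cast hx0.ne'
  have h2 : outerPos t δ - w = (((x ^ 8)⁻¹ : ℝ) : ℂ) *
      (1 + ((x ^ 8 : ℝ) : ℂ) * δ - ((x ^ 8 : ℝ) : ℂ) * w) := by
    rw [outerPos, h1]
    push_cast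
    field_simp
  rw [h2, grav_smul (by positivity)]
  congr 2
  field_simp

theorem grav_outerPos {t : ℝ} (ht : 0 < t) (δ : ℂ) :
    grav (outerPos t δ) = (((t ^ (-(1 / 12) : ℝ)) ^ 16 : ℝ) : ℂ) *
      grav (1 + (((t ^ (-(1 / 12) : ℝ)) ^ 8 : ℝ) : ℂ) * δ) := by
  simpa using grav_outerPos_sub ht δ 0

theorem exists_forall_rpow_lt {r : ℝ} (hr : 0 < r) :
    ∃ t₁ : ℝ, 1 ≤ t₁ ∧ ∀ t, t₁ ≤ t → t ^ (-(1 / 12) : ℝ) < r := by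
  have h := (tendsto_rpow_neg_atTop (show (0 : ℝ) < 1 / 12 by norm_num)).eventually
    (gt_mem_nhds hr)
  obtain ⟨T, hT⟩ := eventually_atTop.1 h
  exact ⟨max 1 T, le_max_left _ _, fun t ht => hT t ((le_max_right _ _).trans ht)⟩

theorem norm_pow_mul_le_of_mem_torusRegion {E : Type*} [NormedAddCommGroup E] {t₁ t θ : ℝ} {Y : E}
    {δ : ℂ} (ht₁ : 1 ≤ t₁) (h : (t, θ, Y, δ) ∈ torusRegion E t₁) :
    ‖(((t ^ (-(1 / 12) : ℝ)) ^ 8 : ℝ) : ℂ) * δ‖ ≤ (t ^ (-(1 / 12) : ℝ)) ^ 5 := by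
  have ht : 0 < t := zero_lt_one.trans_le (ht₁.trans h.1)
  have hd : ‖δ‖ ≤ t ^ (1 / 4 : ℝ) := h.2.2
  rw [← rpow_eq_pow_of_div_twelve ht (p := -(2 / 3)) (by norm_num),
    ← rpow_eq_pow_of_div_twelve ht (p := -(5 / 12)) (by norm_num), norm_mul, Complex.norm_real,
    Real.norm_of_nonneg (by positivity)]
  calc _ ≤ t ^ (-(2 / 3) : ℝ) * t ^ (1 / 4 : ℝ) := by gcongr
    _ = _ := by rw [← Real.rpow_add ht]; norm_num

/-- The nonlinear part of the attraction of the escaping body to the center of mass. -/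
def keplerRemainder (t : ℝ) (δ : ℂ) : ℂ :=
  grav (outerPos t δ) - ((t ^ (-(4 / 3) : ℝ) : ℝ) : ℂ) - ((t ^ (-2 : ℝ) : ℝ) : ℂ) * gravDeriv δ

theorem exists_norm_keplerRemainder_le (E : Type*) [NormedAddCommGroup E] :
    ∃ K t₁ : ℝ, 0 ≤ K ∧ 1 ≤ t₁ ∧ ∀ (t θ θ' : ℝ) (Y Y' : E) (δ δ' : ℂ),
      (t, θ, Y, δ) ∈ torusRegion E t₁ → (t, θ', Y', δ') ∈ torusRegion E t₁ →
      outerPos t δ ≠ 0 ∧ ‖keplerRemainder t δ‖ ≤ K * t ^ (-2 : ℝ) ∧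
      ‖keplerRemainder t δ - keplerRemainder t δ'‖ ≤ K * (t ^ (-(9 / 4) : ℝ) * ‖δ - δ'‖) := by
  obtain ⟨L, r, hL, hr, hrem⟩ := exists_norm_remainder_sub_le
    (contDiffAt_grav (z := ((1 : ℝ) : ℂ)) (by simp))
  obtain ⟨t₁, ht₁, hx⟩ := exists_forall_rpow_lt (lt_min hr one_pos)
  refine ⟨2 * L, t₁, by positivity, ht₁, fun t θ θ' Y Y' δ δ' h h' => ?_⟩
  have ht : 0 < t := zero_lt_one.trans_le (ht₁.trans h.1)
  have hδ := norm_pow_mul_le_of_mem_torusRegion ht₁ h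
  have hδ' := norm_pow_mul_le_of_mem_torusRegion ht₁ h'
  have hxr := (hx t h.1).trans_le (min_le_left _ _)
  have hx1 := (hx t h.1).trans_le (min_le_right _ _)
  have e : ∀ δ, keplerRemainder t δ = (((t ^ (-(1 / 12) : ℝ)) ^ 16 : ℝ) : ℂ) *
      (grav (((1 : ℝ) : ℂ) + (((t ^ (-(1 / 12) : ℝ)) ^ 8 : ℝ) : ℂ) * δ) - grav ((1 : ℝ) : ℂ) -
        fderiv ℝ grav ((1 : ℝ) : ℂ) ((((t ^ (-(1 / 12) : ℝ)) ^ 8 : ℝ) : ℂ) * δ)) := by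
    intro δ
    rw [keplerRemainder, grav_outerPos ht, fderiv_grav one_ne_zero, gravDeriv_real_mul,
      rpow_eq_pow_of_div_twelve ht (p := -(4 / 3)) (k := 16) (by norm_num),
      rpow_eq_pow_of_div_twelve ht (p := -2) (k := 24) (by norm_num), Complex.ofReal_one, grav_one]
    push_cast
    simp only [abs_one, Complex.ofReal_one, one_pow, inv_one]
    ring
  rw [e, e, ← mul_sub, norm_mul, norm_mul, Complex.norm_real,
    rpow_eq_pow_of_div_twelve ht (p := -2) (k := 24) (by norm_num),
    rpow_eq_pow_of_div_twelve ht (p := -(9 / 4)) (k := 27) (by norm_num)]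
  have hx0 : 0 < t ^ (-(1 / 12) : ℝ) := Real.rpow_pos_of_pos ht _
  have hne : t ^ (2 / 3 : ℝ) * (t ^ (-(1 / 12) : ℝ)) ^ 8 = 1 := by
    rw [← rpow_eq_pow_of_div_twelve ht (p := -(2 / 3)) (by norm_num), ← Real.rpow_add ht]
    norm_num
  generalize t ^ (-(1 / 12) : ℝ) = x at *
  rw [Real.norm_of_nonneg (by positivity)]
  have hx5 : x ^ 5 ≤ x := pow_le_of_le_one hx0.le hx1.le (by norm_num)
  have hd : ((x ^ 8 : ℝ) : ℂ) * δ - ((x ^ 8 : ℝ) : ℂ) * δ' = ((x ^ 8 : ℝ) : ℂ) * (δ - δ') := by ring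
  refine ⟨fun h0 => ?_, ?_, ?_⟩
  · have h1 : ((x ^ 8 : ℝ) : ℂ) * outerPos t δ = 1 + ((x ^ 8 : ℝ) : ℂ) * δ := by
      rw [outerPos, mul_add, ← Complex.ofReal_mul, mul_comm (x ^ 8), hne, Complex.ofReal_one]
    rw [h0, mul_zero] at h1
    have h2 : ((x ^ 8 : ℝ) : ℂ) * δ = -1 := by linear_combination -h1
    rw [h2, norm_neg, norm_one] at hδ
    linarith
  · have h1 := hrem _ 0 (hδ.trans_lt (hx5.trans_lt hxr)) (by simpa using hr)
    simp only [add_zero, sub_self, map_zero, sub_zero, norm_zero] at h1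
    calc _ ≤ x ^ 16 * (L * x ^ 5 * x ^ 5) := by
          refine mul_le_mul_of_nonneg_left (h1.trans ?_) (by positivity)
          gcongr
      _ = L * x ^ 24 * x ^ 2 := by ring
      _ ≤ L * x ^ 24 * 2 := by
          refine mul_le_mul_of_nonneg_left ?_ (by positivity)
          nlinarith
      _ = _ := by ring
  · have h1 := hrem _ _ (hδ.trans_lt (hx5.trans_lt hxr)) (hδ'.trans_lt (hx5.trans_lt hxr))
    rw [hd, norm_mul (_ : ℂ) (δ - δ'), Complex.norm_real, Real.norm_of_nonneg (by positivity)] at h1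
    calc _ ≤ x ^ 16 * (L * (x ^ 5 + x ^ 5) * (x ^ 8 * ‖δ - δ'‖)) := by
          refine mul_le_mul_of_nonneg_left (h1.trans ?_) (by positivity)
          gcongr
      _ = 2 * L * (x ^ 27 * ‖δ - δ'‖) * x ^ 2 := by ring
      _ ≤ 2 * L * (x ^ 27 * ‖δ - δ'‖) * 1 := by
          refine mul_le_mul_of_nonneg_left ?_ (by positivity)
          nlinarith
      _ = _ := by ring

theorem norm_exp_sub_exp_le (θ θ' : ℝ) :
    ‖Complex.exp (θ * Complex.I) - Complex.exp (θ' * Complex.I)‖ ≤ |θ - θ'| := by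
  have h : Complex.exp (θ * Complex.I) - Complex.exp (θ' * Complex.I) =
      Complex.exp (θ' * Complex.I) * (Complex.exp (Complex.I * ((θ - θ' : ℝ) : ℂ)) - 1) := by
    rw [mul_sub, ← Complex.exp_add]
    congr 2
    · push_cast; ring
    · ring
  rw [h, norm_mul, Complex.norm_exp_ofReal_mul_I, one_mul]
  exact Real.norm_exp_I_mul_ofReal_sub_one_le

variable [Fintype ι]

/-- The positions of the unit masses in the inertial frame. -/
def bodyPos (a : Fin n → ℝ) (b : ι → Fin n → ℝ) (θ : ℝ) (Y : ι → ℂ × ℂ) (j : Fin n) : ℂ :=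
  Complex.exp (θ * Complex.I) * shape a b Y j

theorem exists_norm_bodyPos_le (a : Fin n → ℝ) (b : ι → Fin n → ℝ) :
    ∃ M : ℝ, 1 ≤ M ∧ ∀ (j : Fin n) (θ θ' : ℝ) (Y Y' : ι → ℂ × ℂ), ‖Y‖ ≤ 1 →
      ‖bodyPos a b θ Y j‖ ≤ M ∧
      ‖bodyPos a b θ Y j - bodyPos a b θ' Y' j‖ ≤ M * (‖Y - Y'‖ + |θ - θ'|) := by
  refine ⟨1 + ∑ j, (|a j| + ‖shapeLin b j‖), le_add_of_nonneg_right (by positivity),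
    fun j θ θ' Y Y' hY => ?_⟩
  have hj : |a j| + ‖shapeLin b j‖ ≤ 1 + ∑ j, (|a j| + ‖shapeLin b j‖) :=
    (Finset.single_le_sum (f := fun j => |a j| + ‖shapeLin b j‖) (fun _ _ => by positivity)
      (Finset.mem_univ j)).trans (le_add_of_nonneg_left zero_le_one)
  have h1 : ‖shape a b Y j‖ ≤ |a j| + ‖shapeLin b j‖ := by
    rw [shape_eq]
    refine (norm_add_le _ _).trans (add_le_add (by simp) ?_)
    exact ((shapeLin b j).le_opNorm Y).trans (mul_le_of_le_one_right (norm_nonneg _) hY)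
  have h2 : ‖shape a b Y j - shape a b Y' j‖ ≤ ‖shapeLin b j‖ * ‖Y - Y'‖ := by
    rw [shape_eq, shape_eq, add_sub_add_left_eq_sub, ← map_sub]
    exact (shapeLin b j).le_opNorm _
  have h3 : bodyPos a b θ Y j - bodyPos a b θ' Y' j =
      Complex.exp (θ' * Complex.I) * (shape a b Y j - shape a b Y' j) +
      (Complex.exp (θ * Complex.I) - Complex.exp (θ' * Complex.I)) * shape a b Y j := by
    rw [bodyPos, bodyPos]; ring
  constructor
  · rw [bodyPos, norm_mul, Complex.norm_exp_ofReal_mul_I, one_mul]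
    exact h1.trans hj
  · rw [h3, mul_add]
    refine (norm_add_le _ _).trans (add_le_add ?_ ?_)
    · rw [norm_mul, Complex.norm_exp_ofReal_mul_I, one_mul]
      refine h2.trans (mul_le_mul_of_nonneg_right (le_trans ?_ hj) (norm_nonneg _))
      exact le_add_of_nonneg_left (abs_nonneg _)
    · rw [norm_mul, mul_comm]
      exact mul_le_mul (h1.trans hj) (norm_exp_sub_exp_le θ θ') (norm_nonneg _)
        ((norm_nonneg _).trans (h1.trans hj))

/-- The tidal part of the attraction between the escaping body and a unit mass. -/
def tidalForce (a : Fin n → ℝ) (b : ι → Fin n → ℝ) (κ t θ : ℝ) (Y : ι → ℂ × ℂ) (δ : ℂ)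
    (j : Fin n) : ℂ :=
  grav (outerPos t δ - κ * bodyPos a b θ Y j) - grav (outerPos t δ)

theorem exists_norm_tidalForce_le (a : Fin n → ℝ) (b : ι → Fin n → ℝ) :
    ∃ K t₁ : ℝ, 0 ≤ K ∧ 1 ≤ t₁ ∧ ∀ κ : ℝ, 0 ≤ κ → κ ≤ 1 → ∀ (j : Fin n) (t θ θ' : ℝ)
      (Y Y' : ι → ℂ × ℂ) (δ δ' : ℂ), (t, θ, Y, δ) ∈ torusRegion (ι → ℂ × ℂ) t₁ →
      (t, θ', Y', δ') ∈ torusRegion (ι → ℂ × ℂ) t₁ →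
      outerPos t δ - κ * bodyPos a b θ Y j ≠ 0 ∧
      ‖tidalForce a b κ t θ Y δ j‖ ≤ K * t ^ (-2 : ℝ) ∧
      ‖tidalForce a b κ t θ Y δ j - tidalForce a b κ t θ' Y' δ' j‖ ≤
        K * (t ^ (-2 : ℝ) * ‖Y - Y'‖ + t ^ (-2 : ℝ) * |θ - θ'| +
          t ^ (-(9 / 4) : ℝ) * ‖δ - δ'‖) := by
  obtain ⟨L, r, hL, hr, hinc, hlip⟩ := exists_norm_increment_sub_le
    (contDiffAt_grav (z := 1) one_ne_zero)
  obtain ⟨M, hM, hbody⟩ := exists_norm_bodyPos_le a b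
  have hM0 : 0 < M := zero_lt_one.trans_le hM
  obtain ⟨t₁, ht₁, hx⟩ := exists_forall_rpow_lt (r := min r (1 / 2) / M) (by positivity)
  refine ⟨L * M, t₁, by positivity, ht₁, fun κ hκ0 hκ1 j t θ θ' Y Y' δ δ' h h' => ?_⟩
  have ht1 : 1 ≤ t := ht₁.trans h.1
  have ht : 0 < t := zero_lt_one.trans_le ht1
  have hY : ∀ {θ Y δ}, (t, θ, Y, δ) ∈ torusRegion (ι → ℂ × ℂ) t₁ → ‖Y‖ ≤ 1 := fun h =>
    h.2.1.trans (Real.rpow_le_one_of_one_le_of_nonpos ht1 (by norm_num))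
  have hδ := norm_pow_mul_le_of_mem_torusRegion ht₁ h
  have hδ' := norm_pow_mul_le_of_mem_torusRegion ht₁ h'
  have hxM : M * t ^ (-(1 / 12) : ℝ) < min r (1 / 2) := by
    have := (lt_div_iff₀ hM0).1 (hx t h.1)
    linarith
  have e : ∀ θ Y δ, tidalForce a b κ t θ Y δ j = (((t ^ (-(1 / 12) : ℝ)) ^ 16 : ℝ) : ℂ) *
      (grav (1 + (((t ^ (-(1 / 12) : ℝ)) ^ 8 : ℝ) : ℂ) * δ -
        (((t ^ (-(1 / 12) : ℝ)) ^ 8 : ℝ) : ℂ) * (κ * bodyPos a b θ Y j)) -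
        grav (1 + (((t ^ (-(1 / 12) : ℝ)) ^ 8 : ℝ) : ℂ) * δ)) := fun θ Y δ => by
    rw [tidalForce, grav_outerPos_sub ht, grav_outerPos ht, mul_sub]
  rw [e, e, ← mul_sub, norm_mul, norm_mul, Complex.norm_real,
    rpow_eq_pow_of_div_twelve ht (p := -2) (k := 24) (by norm_num),
    rpow_eq_pow_of_div_twelve ht (p := -(9 / 4)) (k := 27) (by norm_num)]
  have hx0 : 0 < t ^ (-(1 / 12) : ℝ) := Real.rpow_pos_of_pos ht _
  have hne : t ^ (2 / 3 : ℝ) * (t ^ (-(1 / 12) : ℝ)) ^ 8 = 1 := by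
    rw [← rpow_eq_pow_of_div_twelve ht (p := -(2 / 3)) (by norm_num), ← Real.rpow_add ht]
    norm_num
  generalize t ^ (-(1 / 12) : ℝ) = x at *
  rw [Real.norm_of_nonneg (by positivity)]
  have hxr : M * x < r := hxM.trans_le (min_le_left _ _)
  have hx2 : M * x < 1 / 2 := hxM.trans_le (min_le_right _ _)
  have hxM' : x ≤ M * x := le_mul_of_one_le_left hx0.le hM
  have hx1 : x ≤ 1 := by linarith
  have hx5 : x ^ 5 ≤ x := pow_le_of_le_one hx0.le hx1 (by norm_num)
  have hx8 : M * x ^ 8 ≤ M * x :=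
    mul_le_mul_of_nonneg_left (pow_le_of_le_one hx0.le hx1 (by norm_num)) hM0.le
  have hy : ∀ {θ Y}, ‖Y‖ ≤ 1 →
      ‖((x ^ 8 : ℝ) : ℂ) * (κ * bodyPos a b θ Y j)‖ ≤ M * x ^ 8 := by
    intro θ Y hY
    rw [norm_mul, norm_mul, Complex.norm_real, Complex.norm_real, Real.norm_of_nonneg hκ0,
      Real.norm_of_nonneg (by positivity), mul_comm M]
    refine mul_le_mul_of_nonneg_left ?_ (by positivity)
    exact (mul_le_of_le_one_left (norm_nonneg _) hκ1).trans (hbody j θ θ Y Y hY).1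
  have hyy : ‖((x ^ 8 : ℝ) : ℂ) * (κ * bodyPos a b θ Y j) -
      ((x ^ 8 : ℝ) : ℂ) * (κ * bodyPos a b θ' Y' j)‖ ≤
      x ^ 8 * (M * (‖Y - Y'‖ + |θ - θ'|)) := by
    rw [← mul_sub, ← mul_sub, norm_mul, norm_mul, Complex.norm_real, Complex.norm_real,
      Real.norm_of_nonneg hκ0, Real.norm_of_nonneg (by positivity)]
    refine mul_le_mul_of_nonneg_left ?_ (by positivity)
    exact (mul_le_of_le_one_left (norm_nonneg _) hκ1).trans (hbody j θ θ' Y Y' (hY h)).2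
  have hs : ∀ {δ : ℂ}, ‖((x ^ 8 : ℝ) : ℂ) * δ‖ ≤ x ^ 5 →
      ‖1 + ((x ^ 8 : ℝ) : ℂ) * δ - 1‖ < r := fun hδ => by
    rw [add_sub_cancel_left]; linarith
  have hss : ‖1 + ((x ^ 8 : ℝ) : ℂ) * δ - (1 + ((x ^ 8 : ℝ) : ℂ) * δ')‖ = x ^ 8 * ‖δ - δ'‖ := by
    rw [add_sub_add_left_eq_sub, ← mul_sub, norm_mul, Complex.norm_real,
      Real.norm_of_nonneg (by positivity)]
  refine ⟨fun h0 => ?_, ?_, ?_⟩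
  · have h1 : ((x ^ 8 : ℝ) : ℂ) * (outerPos t δ - κ * bodyPos a b θ Y j) =
        1 + ((x ^ 8 : ℝ) : ℂ) * δ - ((x ^ 8 : ℝ) : ℂ) * (κ * bodyPos a b θ Y j) := by
      rw [outerPos, mul_sub, mul_add, ← Complex.ofReal_mul, mul_comm (x ^ 8), hne,
        Complex.ofReal_one]
    rw [h0, mul_zero] at h1
    have h2 : (1 : ℂ) =
        ((x ^ 8 : ℝ) : ℂ) * (κ * bodyPos a b θ Y j) - ((x ^ 8 : ℝ) : ℂ) * δ := by
      linear_combination -h1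
    have h3 := congrArg norm h2
    rw [norm_one] at h3
    have h4 := h3.le.trans (norm_sub_le _ _)
    linarith [hy (θ := θ) (hY h)]
  · have h1 := hinc _ _ (hs hδ) ((hy (θ := θ) (hY h)).trans_lt (hx8.trans_lt hxr))
    calc _ ≤ x ^ 16 * (L * (M * x ^ 8)) := by
          refine mul_le_mul_of_nonneg_left (h1.trans ?_) (by positivity)
          exact mul_le_mul_of_nonneg_left (hy (hY h)) hL
      _ = _ := by ring
  · have h1 := hlip _ _ _ _ (hs hδ) (hs hδ') ((hy (θ := θ) (hY h)).trans_lt (hx8.trans_lt hxr))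
      ((hy (θ := θ') (hY h')).trans_lt (hx8.trans_lt hxr))
    rw [hss] at h1
    calc _ ≤ x ^ 16 * (L * (x ^ 8 * (M * (‖Y - Y'‖ + |θ - θ'|))) +
            L * (M * x ^ 8) * (x ^ 8 * ‖δ - δ'‖)) := by
          refine mul_le_mul_of_nonneg_left (h1.trans ?_) (by positivity)
          gcongr
          exact hy (hY h)
      _ = L * M * (x ^ 24 * ‖Y - Y'‖ + x ^ 24 * |θ - θ'| + x ^ 27 * ‖δ - δ'‖ * x ^ 5) := by ring
      _ ≤ L * M * (x ^ 24 * ‖Y - Y'‖ + x ^ 24 * |θ - θ'| + x ^ 27 * ‖δ - δ'‖ * 1) := by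
          gcongr
          linarith
      _ = _ := by ring

end Tide
end ParabolicBounded

namespace ParabolicBounded

section IsTidal

variable {n : ℕ} {ι : Type*} [Fintype ι]

theorem torusRegion_subset {E : Type*} [NormedAddCommGroup E] {s t : ℝ} (h : s ≤ t) :
    torusRegion E t ⊆ torusRegion E s := fun _ hp => ⟨h.trans hp.1, hp.2⟩

theorem continuousOn_outerPos {E : Type*} [NormedAddCommGroup E] {t₁ : ℝ} (ht₁ : 1 ≤ t₁) :
    ContinuousOn (fun p : ℝ × ℝ × E × ℂ => outerPos p.1 p.2.2.2) (torusRegion E t₁) := by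
  unfold outerPos
  refine ContinuousOn.add (Complex.continuous_ofReal.comp_continuousOn
    (continuousOn_fst.rpow_const fun p hp => Or.inl ?_)) (by fun_prop)
  exact (zero_lt_one.trans_le (ht₁.trans hp.1)).ne'

theorem continuousOn_rpow_fst {E : Type*} [NormedAddCommGroup E] {t₁ : ℝ} (ht₁ : 1 ≤ t₁) (r : ℝ) :
    ContinuousOn (fun p : ℝ × ℝ × E × ℂ => ((p.1 ^ r : ℝ) : ℂ)) (torusRegion E t₁) :=
  Complex.continuous_ofReal.comp_continuousOn (continuousOn_fst.rpow_const fun _ hp =>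
    Or.inl (zero_lt_one.trans_le (ht₁.trans hp.1)).ne')

theorem ContinuousOn.grav {X : Type*} [TopologicalSpace X] {f : X → ℂ} {s : Set X}
    (hf : ContinuousOn f s) (h : ∀ x ∈ s, f x ≠ 0) : ContinuousOn (fun x => grav (f x)) s :=
  fun x hx => (continuousAt_grav (h x hx)).comp_continuousWithinAt (hf x hx)

theorem continuous_bodyPos (a : Fin n → ℝ) (b : ι → Fin n → ℝ) (j : Fin n) :
    Continuous fun p : ℝ × (ι → ℂ × ℂ) => bodyPos a b p.1 p.2 j := by
  unfold bodyPos shape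
  fun_prop

theorem continuous_gravDeriv : Continuous gravDeriv :=
  gravDerivLin.continuous_of_finiteDimensional

/-- The tidal forces on the unit masses, in modal coordinates. -/
def tidalMode (a : Fin n → ℝ) (b : ι → Fin n → ℝ) (κ t θ : ℝ) (Y : ι → ℂ × ℂ) (δ : ℂ) (k : ι) : ℂ :=
  Complex.exp (-θ * Complex.I) * ∑ i, (b k i : ℂ) * tidalForce a b κ t θ Y δ i

/-- The part of the attraction of the escaping body which perturbs the parabolic motion. -/
def outerPert (a : Fin n → ℝ) (b : ι → Fin n → ℝ) (κ : ℝ → ℝ) (μ : ℝ)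
    (p : ℝ × ℝ × (ι → ℂ × ℂ) × ℂ) : ℂ :=
  -(2 / 9) * ((n : ℂ)⁻¹ * ∑ j, tidalForce a b (κ μ) p.1 p.2.1 p.2.2.1 p.2.2.2 j +
    keplerRemainder p.1 p.2.2.2)

theorem norm_exp_mul_sub_le (θ θ' : ℝ) (z z' : ℂ) :
    ‖Complex.exp (-θ * Complex.I) * z - Complex.exp (-θ' * Complex.I) * z'‖ ≤
      ‖z - z'‖ + ‖z‖ * |θ - θ'| := by
  have e : Complex.exp (-θ * Complex.I) * z - Complex.exp (-θ' * Complex.I) * z' =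
      Complex.exp (((-θ' : ℝ) : ℂ) * Complex.I) * (z - z') +
      (Complex.exp (((-θ : ℝ) : ℂ) * Complex.I) -
        Complex.exp (((-θ' : ℝ) : ℂ) * Complex.I)) * z := by
    push_cast; ring
  rw [e]
  refine (norm_add_le _ _).trans (add_le_add ?_ ?_)
  · rw [norm_mul, Complex.norm_exp_ofReal_mul_I, one_mul]
  · rw [norm_mul, mul_comm]
    refine mul_le_mul_of_nonneg_left ((norm_exp_sub_exp_le _ _).trans_eq ?_) (norm_nonneg _)
    rw [← abs_neg]; congr 1; ring

variable [DecidableEq ι]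

/-- The part of the vector field of the unit masses which perturbs the linearization at the
relative equilibrium. -/
def innerPert (a : Fin n → ℝ) (b : ι → Fin n → ℝ) (lam : ι → ℝ) (k₀ : ι) (α : ℝ) (κ : ℝ → ℝ)
    (μ : ℝ) (p : ℝ × ℝ × (ι → ℂ × ℂ) × ℂ) : ι → ℂ × ℂ :=
  (innerField a b k₀ α p.2.2.1 - innerLin lam k₀ p.2.2.1) + fun k =>
    (0, ((μ * κ μ ^ 2 : ℝ) : ℂ) * tidalMode a b (κ μ) p.1 p.2.1 p.2.2.1 p.2.2.2 k)

theorem exists_isTidal {a : Fin n → ℝ} (ha : IsCollinearEquilibrium a) {b : ι → Fin n → ℝ}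
    {lam : ι → ℝ} {k₀ : ι} {α : ℝ} (hb : IsModalBasis a b lam k₀ α) {κ : ℝ → ℝ}
    (hκ0 : ∀ μ, 0 < μ → 0 ≤ κ μ) (hκ1 : ∀ μ, 0 < μ → κ μ ≤ 1) :
    ∃ C t₁, 0 ≤ C ∧ 1 ≤ t₁ ∧ IsTidal (rotation k₀ α) C t₁ (innerPert a b lam k₀ α κ)
      (outerPert a b κ) ∧
      ∀ μ, 0 < μ → ∀ j t θ Y δ, (t, θ, Y, δ) ∈ torusRegion (ι → ℂ × ℂ) t₁ →
        outerPos t δ - κ μ * bodyPos a b θ Y j ≠ 0 := by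
  obtain ⟨L, r, hL, hr, hN⟩ := exists_norm_innerField_sub_le ha hb
  obtain ⟨K₁, s₁, hK₁, hs₁, hkep⟩ := exists_norm_keplerRemainder_le (ι → ℂ × ℂ)
  obtain ⟨K₂, s₂, hK₂, hs₂, htide⟩ := exists_norm_tidalForce_le a b
  set t₁ := max (max s₁ s₂) (2 * r⁻¹) with ht₁
  have hts₁ : s₁ ≤ t₁ := (le_max_left _ _).trans (le_max_left _ _)
  have hts₂ : s₂ ≤ t₁ := (le_max_right _ _).trans (le_max_left _ _)
  have ht1 : 1 ≤ t₁ := hs₁.trans hts₁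
  set B : ℝ := ∑ k, ∑ i, |b k i| with hB
  have hB0 : 0 ≤ B := by positivity
  have hYr : ∀ {t θ Y δ}, (t, θ, Y, δ) ∈ torusRegion (ι → ℂ × ℂ) t₁ → ‖Y‖ < r := by
    intro t θ Y δ h
    have h1 : t₁ ≤ t := h.1
    have h2 : ‖Y‖ ≤ t ^ (-1 : ℝ) := h.2.1
    rw [Real.rpow_neg_one] at h2
    have h3 : r⁻¹ < t := by
      have : 2 * r⁻¹ ≤ t := (le_max_right _ _).trans h1
      linarith [inv_pos.2 hr]
    exact h2.trans_lt (inv_lt_of_inv_lt₀ hr h3)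
  have hsum : ∀ (k : ι) (f : Fin n → ℂ) (D : ℝ), 0 ≤ D → (∀ i, ‖f i‖ ≤ D) →
      ‖∑ i, (b k i : ℂ) * f i‖ ≤ B * D := by
    intro k f D hD hf
    calc _ ≤ ∑ i, ‖(b k i : ℂ) * f i‖ := norm_sum_le _ _
      _ ≤ ∑ i, |b k i| * D := Finset.sum_le_sum fun i _ => by
          rw [norm_mul, Complex.norm_real, Real.norm_eq_abs]
          exact mul_le_mul_of_nonneg_left (hf i) (abs_nonneg _)
      _ = (∑ i, |b k i|) * D := by rw [Finset.sum_mul]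
      _ ≤ B * D := mul_le_mul_of_nonneg_right
          (Finset.single_le_sum (f := fun k => ∑ i, |b k i|) (fun _ _ => by positivity)
            (Finset.mem_univ k)) hD
  have hmean : ∀ (f : Fin n → ℂ) (D : ℝ), 0 ≤ D → (∀ i, ‖f i‖ ≤ D) →
      ‖(n : ℂ)⁻¹ * ∑ i, f i‖ ≤ D := by
    intro f D hD hf
    rw [norm_mul, norm_inv, Complex.norm_natCast]
    have h1 : ‖∑ i, f i‖ ≤ n * D := (norm_sum_le _ _).trans
      ((Finset.sum_le_sum fun i _ => hf i).trans (by simp))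
    rcases Nat.eq_zero_or_pos n with h | h
    · simp [h, hD]
    · have : (0 : ℝ) < n := by exact_mod_cast h
      rw [inv_mul_le_iff₀ this]
      exact h1
  have hmode : ∀ (μ : ℝ), 0 < μ → ∀ t θ Y δ, (t, θ, Y, δ) ∈ torusRegion (ι → ℂ × ℂ) t₁ → ∀ k,
      ‖∑ i, (b k i : ℂ) * tidalForce a b (κ μ) t θ Y δ i‖ ≤ B * (K₂ * t ^ (-2 : ℝ)) := by
    intro μ hμ t θ Y δ h k
    have ht : 0 < t := zero_lt_one.trans_le (ht1.trans h.1)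
    have h' := torusRegion_subset hts₂ h
    exact hsum k _ _ (by positivity) fun i =>
      (htide (κ μ) (hκ0 μ hμ) (hκ1 μ hμ) i t θ θ Y Y δ δ h' h').2.1
  have hcoef : ∀ μ, 0 < μ → 0 ≤ μ * κ μ ^ 2 ∧ μ * κ μ ^ 2 ≤ μ := fun μ hμ =>
    ⟨mul_nonneg hμ.le (sq_nonneg _),
      mul_le_of_le_one_right hμ.le (pow_le_one₀ (hκ0 μ hμ) (hκ1 μ hμ))⟩
  have htc : ∀ μ, 0 < μ → ∀ j, ContinuousOn (fun p : ℝ × ℝ × (ι → ℂ × ℂ) × ℂ =>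
      tidalForce a b (κ μ) p.1 p.2.1 p.2.2.1 p.2.2.2 j) (torusRegion (ι → ℂ × ℂ) t₁) := by
    intro μ hμ j
    refine ContinuousOn.sub (ContinuousOn.grav ((continuousOn_outerPos ht1).sub ?_) ?_)
      (ContinuousOn.grav (continuousOn_outerPos ht1) ?_)
    · have : Continuous fun p : ℝ × ℝ × (ι → ℂ × ℂ) × ℂ => bodyPos a b p.2.1 p.2.2.1 j :=
        (continuous_bodyPos a b j).comp (by fun_prop :
          Continuous fun p : ℝ × ℝ × (ι → ℂ × ℂ) × ℂ => (p.2.1, p.2.2.1))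
      exact (continuous_const.mul this).continuousOn
    · rintro ⟨t, θ, Y, δ⟩ hp
      have h' := torusRegion_subset hts₂ hp
      exact (htide (κ μ) (hκ0 μ hμ) (hκ1 μ hμ) j t θ θ Y Y δ δ h' h').1
    · rintro ⟨t, θ, Y, δ⟩ hp
      have h' := torusRegion_subset hts₁ hp
      exact (hkep t θ θ Y Y δ δ h' h').1
  refine ⟨L + B * K₂ * 2 + (K₁ + K₂), t₁, by positivity, ht1, ⟨?_, ?_, ?_, ?_, ?_, ?_⟩,
    fun μ hμ j t θ Y δ h => ?_⟩
  · intro μ hμ _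
    refine ContinuousOn.add ?_ (continuousOn_pi.2 fun k => continuousOn_const.prodMk
      (continuousOn_const.mul (ContinuousOn.mul (by fun_prop)
        (continuousOn_finsetSum _ fun i _ => continuousOn_const.mul (htc μ hμ i)))))
    have hlip : LipschitzOnWith (Real.toNNReal (L * (r + r)))
        (fun Y => innerField a b k₀ α Y - innerLin lam k₀ Y) (Metric.ball 0 r) := by
      refine LipschitzOnWith.of_dist_le_mul fun Y hY Y' hY' => ?_
      rw [mem_ball_zero_iff] at hY hY'
      rw [dist_eq_norm, dist_eq_norm, Real.coe_toNNReal _ (by positivity)]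
      refine (hN Y Y' hY hY').trans ?_
      gcongr
    exact hlip.continuousOn.comp (by fun_prop :
      ContinuousOn (fun p : ℝ × ℝ × (ι → ℂ × ℂ) × ℂ => p.2.2.1) _) fun p hp =>
        mem_ball_zero_iff.2 (hYr hp)
  · intro μ hμ _
    refine continuousOn_const.mul ((continuousOn_const.mul
      (continuousOn_finsetSum _ fun i _ => htc μ hμ i)).add ?_)
    unfold keplerRemainder
    refine ContinuousOn.sub (ContinuousOn.sub (ContinuousOn.grav (continuousOn_outerPos ht1) ?_)
      (continuousOn_rpow_fst ht1 _)) ((continuousOn_rpow_fst ht1 _).mul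
        (continuous_gravDeriv.comp_continuousOn (by fun_prop)))
    rintro ⟨t, θ, Y, δ⟩ hp
    have h' := torusRegion_subset hts₁ hp
    exact (hkep t θ θ Y Y δ δ h' h').1
  · intro μ hμ _ t θ Y δ h
    have ht : 0 < t := zero_lt_one.trans_le (ht1.trans h.1)
    have h1 := hN Y 0 (hYr h) (by simpa using hr)
    rw [innerField_zero ha hb, map_zero, sub_zero, sub_zero, sub_zero, norm_zero, add_zero] at h1
    have h2 : ‖fun k => ((0 : ℂ), ((μ * κ μ ^ 2 : ℝ) : ℂ) * tidalMode a b (κ μ) t θ Y δ k)‖ ≤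
        μ * (B * (K₂ * t ^ (-2 : ℝ))) := by
      refine (pi_norm_le_iff_of_nonneg (by positivity)).2 fun k => ?_
      rw [Prod.norm_def, norm_zero, max_eq_right (norm_nonneg _), norm_mul, Complex.norm_real,
        Real.norm_of_nonneg (hcoef μ hμ).1]
      refine mul_le_mul (hcoef μ hμ).2 ?_ (norm_nonneg _) hμ.le
      rw [tidalMode, norm_mul, ← Complex.ofReal_neg, Complex.norm_exp_ofReal_mul_I, one_mul]
      exact hmode μ hμ t θ Y δ h k
    refine (norm_add_le _ _).trans ((add_le_add h1 h2).trans ?_)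
    have h3 : 0 ≤ t ^ (-2 : ℝ) := by positivity
    have : 0 ≤ (B * K₂ * 2 + (K₁ + K₂)) * ‖Y‖ ^ 2 +
      (L + B * K₂ + (K₁ + K₂)) * (μ * t ^ (-2 : ℝ)) := by positivity
    linarith
  · intro μ hμ _ t θ Y δ h
    have ht : 0 < t := zero_lt_one.trans_le (ht1.trans h.1)
    have h' := torusRegion_subset hts₂ h
    have h'' := torusRegion_subset hts₁ h
    have h1 := hmean (tidalForce a b (κ μ) t θ Y δ) (K₂ * t ^ (-2 : ℝ)) (by positivity) fun i =>
      (htide (κ μ) (hκ0 μ hμ) (hκ1 μ hμ) i t θ θ Y Y δ δ h' h').2.1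
    have h2 := (hkep t θ θ Y Y δ δ h'' h'').2.1
    rw [outerPert, norm_mul, norm_neg]
    have h3 := (norm_add_le _ _).trans (add_le_add h1 h2)
    have h4 : ‖(2 / 9 : ℂ)‖ ≤ 1 := by norm_num
    refine (mul_le_of_le_one_left (norm_nonneg _) h4).trans (h3.trans ?_)
    have : 0 ≤ (L + B * K₂ * 2) * t ^ (-2 : ℝ) := by positivity
    linarith
  · intro μ hμ _ t θ Y δ θ' Y' δ' h h'
    have ht : 0 < t := zero_lt_one.trans_le (ht1.trans h.1)
    have h1 := hN Y Y' (hYr h) (hYr h')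
    set D := t ^ (-2 : ℝ) * ‖Y - Y'‖ + t ^ (-2 : ℝ) * |θ - θ'| + t ^ (-(9 / 4) : ℝ) * ‖δ - δ'‖
      with hD
    have hD0 : 0 ≤ D := by positivity
    have hθD : t ^ (-2 : ℝ) * |θ - θ'| ≤ D := by
      have : 0 ≤ t ^ (-2 : ℝ) * ‖Y - Y'‖ := by positivity
      have : 0 ≤ t ^ (-(9 / 4) : ℝ) * ‖δ - δ'‖ := by positivity
      linarith
    have h2 : ‖(fun k => ((0 : ℂ), ((μ * κ μ ^ 2 : ℝ) : ℂ) * tidalMode a b (κ μ) t θ Y δ k)) -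
        fun k => ((0 : ℂ), ((μ * κ μ ^ 2 : ℝ) : ℂ) * tidalMode a b (κ μ) t θ' Y' δ' k)‖ ≤
        μ * (B * K₂ * 2 * D) := by
      refine (pi_norm_le_iff_of_nonneg (by positivity)).2 fun k => ?_
      rw [Pi.sub_apply, Prod.mk_sub_mk, sub_zero, ← mul_sub, Prod.norm_def, norm_zero,
        max_eq_right (norm_nonneg _), norm_mul, Complex.norm_real,
        Real.norm_of_nonneg (hcoef μ hμ).1]
      refine mul_le_mul (hcoef μ hμ).2 ?_ (norm_nonneg _) hμ.le
      refine (norm_exp_mul_sub_le _ _ _ _).trans ?_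
      have h3 := hsum k (fun i => tidalForce a b (κ μ) t θ Y δ i -
        tidalForce a b (κ μ) t θ' Y' δ' i) (K₂ * D) (by positivity) fun i =>
        (htide (κ μ) (hκ0 μ hμ) (hκ1 μ hμ) i t θ θ' Y Y' δ δ' (torusRegion_subset hts₂ h)
          (torusRegion_subset hts₂ h')).2.2
      simp only [mul_sub, Finset.sum_sub_distrib] at h3
      have h4 := mul_le_mul_of_nonneg_right (hmode μ hμ t θ Y δ h k) (abs_nonneg (θ - θ'))
      have h5 := mul_le_mul_of_nonneg_left hθD (mul_nonneg hB0 hK₂)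
      linarith
    rw [innerPert, innerPert, add_sub_add_comm]
    refine (norm_add_le _ _).trans ((add_le_add h1 h2).trans ?_)
    have : 0 ≤ (B * K₂ * 2 + (K₁ + K₂)) * ((‖Y‖ + ‖Y'‖) * ‖Y - Y'‖) +
      (L + (K₁ + K₂)) * (μ * D) := by positivity
    linarith
  · intro μ hμ _ t θ Y δ θ' Y' δ' h h'
    have ht : 0 < t := zero_lt_one.trans_le (ht1.trans h.1)
    set D := t ^ (-2 : ℝ) * ‖Y - Y'‖ + t ^ (-2 : ℝ) * |θ - θ'| + t ^ (-(9 / 4) : ℝ) * ‖δ - δ'‖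
      with hD
    have hD0 : 0 ≤ D := by positivity
    have hδD : t ^ (-(9 / 4) : ℝ) * ‖δ - δ'‖ ≤ D := le_add_of_nonneg_left (by positivity)
    have h1 := hmean (fun i => tidalForce a b (κ μ) t θ Y δ i -
        tidalForce a b (κ μ) t θ' Y' δ' i) (K₂ * D) (by positivity) fun i =>
        (htide (κ μ) (hκ0 μ hμ) (hκ1 μ hμ) i t θ θ' Y Y' δ δ' (torusRegion_subset hts₂ h)
          (torusRegion_subset hts₂ h')).2.2
    have h2 := ((hkep t θ θ' Y Y' δ δ' (torusRegion_subset hts₁ h)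
      (torusRegion_subset hts₁ h')).2.2).trans (mul_le_mul_of_nonneg_left hδD hK₁)
    have e : outerPert a b κ μ (t, θ, Y, δ) - outerPert a b κ μ (t, θ', Y', δ') =
        -(2 / 9) * ((n : ℂ)⁻¹ * ∑ i, (tidalForce a b (κ μ) t θ Y δ i -
          tidalForce a b (κ μ) t θ' Y' δ' i) + (keplerRemainder t δ - keplerRemainder t δ')) := by
      rw [outerPert, outerPert, Finset.sum_sub_distrib]; ring
    rw [e, norm_mul, norm_neg]
    have h4 : ‖(2 / 9 : ℂ)‖ ≤ 1 := by norm_num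
    refine (mul_le_of_le_one_left (norm_nonneg _) h4).trans
      ((norm_add_le _ _).trans ((add_le_add h1 h2).trans ?_))
    have : 0 ≤ (L + B * K₂ * 2) * D := by positivity
    linarith
  · have h' := torusRegion_subset hts₂ h
    exact (htide (κ μ) (hκ0 μ hμ) (hκ1 μ hμ) j t θ θ Y Y δ δ h' h').1

end IsTidal
end ParabolicBounded

namespace ParabolicBounded

section Dynamics

variable {n : ℕ} {ι : Type*} [Fintype ι] [DecidableEq ι] {a : Fin n → ℝ} {b : ι → Fin n → ℝ}
  {lam : ι → ℝ} {k₀ : ι} {α : ℝ}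

theorem IsModalBasis.sum_mul_sum (hb : IsModalBasis a b lam k₀ α) (G : Fin n → ℂ) (j : Fin n) :
    ∑ k, (b k j : ℂ) * ∑ i, (b k i : ℂ) * G i = G j - (n : ℂ)⁻¹ * ∑ i, G i := by
  have h : ∀ i, ∑ k, (b k i : ℂ) * b k j = (if i = j then 1 else 0) - (n : ℂ)⁻¹ := fun i => by
    have := congrArg (Complex.ofReal) (hb.complete i j)
    simpa [apply_ite Complex.ofReal] using this
  calc _ = ∑ i, (∑ k, (b k i : ℂ) * b k j) * G i := by
        simp_rw [Finset.mul_sum, Finset.sum_mul]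
        rw [Finset.sum_comm]
        exact Finset.sum_congr rfl fun _ _ => Finset.sum_congr rfl fun _ _ => by ring
    _ = _ := by
        simp_rw [h, sub_mul, Finset.sum_sub_distrib, ite_mul, one_mul, zero_mul, ← Finset.mul_sum]
        simp

theorem IsModalBasis.sum_mul_modalCenter (hb : IsModalBasis a b lam k₀ α)
    (ha : IsCollinearEquilibrium a) (j : Fin n) :
    ∑ k, (b k j : ℂ) * modalCenter k₀ α k = a j := by
  rw [← hb.mul_eq ha j]
  simp [modalCenter, apply_ite Complex.ofReal, mul_comm]

omit [DecidableEq ι] in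
theorem sum_mutualForce (a : Fin n → ℝ) (b : ι → Fin n → ℝ) (Y : ι → ℂ × ℂ) :
    ∑ j, mutualForce a b Y j = 0 := by
  have h : ∑ j, mutualForce a b Y j = -∑ j, mutualForce a b Y j := by
    conv_lhs => unfold mutualForce
    rw [Finset.sum_comm, ← Finset.sum_neg_distrib]
    refine Finset.sum_congr rfl fun j _ => ?_
    rw [mutualForce, ← Finset.sum_neg_distrib]
    exact Finset.sum_congr rfl fun i _ => by rw [← grav_neg, neg_sub]
  exact self_eq_neg.1 h

theorem IsModalBasis.sum_shape (hb : IsModalBasis a b lam k₀ α) (ha : IsCollinearEquilibrium a)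
    (Y : ι → ℂ × ℂ) : ∑ j, shape a b Y j = 0 := by
  simp_rw [shape, Finset.sum_add_distrib, ← Complex.ofReal_sum, ha.sum_eq_zero]
  rw [Finset.sum_comm]
  simp_rw [← Finset.sum_mul, ← Complex.ofReal_sum, hb.sum_eq_zero]
  simp

theorem IsModalBasis.sum_momentum (hb : IsModalBasis a b lam k₀ α) (ha : IsCollinearEquilibrium a)
    (Y : ι → ℂ × ℂ) : ∑ j, momentum a b Y j = 0 := by
  simp_rw [momentum, Finset.sum_add_distrib, ← Finset.sum_mul, ← Complex.ofReal_sum,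
    ha.sum_eq_zero]
  rw [Finset.sum_comm]
  simp_rw [← Finset.sum_mul, ← Complex.ofReal_sum, hb.sum_eq_zero]
  simp

theorem hasDerivAt_exp_mul_I {θ : ℝ → ℝ} {ω t : ℝ} (h : HasDerivAt θ ω t) :
    HasDerivAt (fun s => Complex.exp (θ s * Complex.I))
      (Complex.exp (θ t * Complex.I) * (ω * Complex.I)) t :=
  (h.ofReal_comp.mul_const Complex.I).cexp

variable {θ : ℝ → ℝ} {Y : ℝ → ι → ℂ × ℂ} {t : ℝ}

theorem IsModalBasis.hasDerivAt_bodyPos (hb : IsModalBasis a b lam k₀ α)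
    (ha : IsCollinearEquilibrium a) {g : ι → ℂ}
    (hθ : HasDerivAt θ (1 + rotation k₀ α (Y t)) t)
    (hY : HasDerivAt Y (innerField a b k₀ α (Y t) + fun k => (0, g k)) t) (j : Fin n) :
    HasDerivAt (fun s => bodyPos a b (θ s) (Y s) j)
      (Complex.exp (θ t * Complex.I) * momentum a b (Y t) j) t := by
  have h1 : ∀ k, HasDerivAt (fun s => (Y s k).1) (innerField a b k₀ α (Y t) k + (0, g k)).1 t :=
    fun k => ((hasDerivAt_pi.1 hY k).hasFDerivAt.fst).hasDerivAt.congr_deriv (by simp)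
  have h2 : HasDerivAt (fun s => shape a b (Y s) j)
      (∑ k, (b k j : ℂ) * (innerField a b k₀ α (Y t) k + (0, g k)).1) t :=
    (HasDerivAt.fun_sum fun k _ => (h1 k).const_mul (b k j : ℂ)).const_add _
  refine ((hasDerivAt_exp_mul_I hθ).mul h2).congr_deriv ?_
  have h3 : ∑ k, (b k j : ℂ) * (innerField a b k₀ α (Y t) k + (0, g k)).1 =
      momentum a b (Y t) j - ((1 + rotation k₀ α (Y t) : ℝ) : ℂ) *
        (Complex.I * shape a b (Y t) j) := by
    rw [momentum, shape, ← hb.sum_mul_modalCenter ha j, Finset.sum_mul, ← Finset.sum_add_distrib,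
      ← Finset.sum_add_distrib, Finset.mul_sum, Finset.mul_sum, ← Finset.sum_sub_distrib]
    refine Finset.sum_congr rfl fun k _ => ?_
    simp only [innerField, Prod.fst_add]
    ring
  rw [h3]
  ring

theorem IsModalBasis.hasDerivAt_momentum (hb : IsModalBasis a b lam k₀ α)
    (ha : IsCollinearEquilibrium a) {g : ι → ℂ}
    (hθ : HasDerivAt θ (1 + rotation k₀ α (Y t)) t)
    (hY : HasDerivAt Y (innerField a b k₀ α (Y t) + fun k => (0, g k)) t) (j : Fin n) :
    HasDerivAt (fun s => Complex.exp (θ s * Complex.I) * momentum a b (Y s) j)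
      (Complex.exp (θ t * Complex.I) *
        (mutualForce a b (Y t) j + ∑ k, (b k j : ℂ) * g k)) t := by
  have h1 : ∀ k, HasDerivAt (fun s => (Y s k).2) (innerField a b k₀ α (Y t) k + (0, g k)).2 t :=
    fun k => ((hasDerivAt_pi.1 hY k).hasFDerivAt.snd).hasDerivAt.congr_deriv (by simp)
  have h2 : HasDerivAt (fun s => momentum a b (Y s) j)
      (∑ k, (b k j : ℂ) * (innerField a b k₀ α (Y t) k + (0, g k)).2) t :=
    (HasDerivAt.fun_sum fun k _ => (h1 k).const_mul (b k j : ℂ)).const_add _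
  refine ((hasDerivAt_exp_mul_I hθ).mul h2).congr_deriv ?_
  have h3 : ∑ k, (b k j : ℂ) * (innerField a b k₀ α (Y t) k + (0, g k)).2 =
      (mutualForce a b (Y t) j + ∑ k, (b k j : ℂ) * g k) -
        ((1 + rotation k₀ α (Y t) : ℝ) : ℂ) * (Complex.I * momentum a b (Y t) j) := by
    have h4 := hb.sum_mul_sum (mutualForce a b (Y t)) j
    rw [sum_mutualForce, mul_zero, sub_zero] at h4
    rw [← h4, momentum, ← hb.sum_mul_modalCenter ha j, Finset.sum_mul, ← Finset.sum_add_distrib,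
      ← Finset.sum_add_distrib, Finset.mul_sum, Finset.mul_sum, ← Finset.sum_sub_distrib]
    refine Finset.sum_congr rfl fun k _ => ?_
    simp only [innerField, Prod.snd_add]
    ring
  rw [h3]
  ring

omit [DecidableEq ι] in
theorem exp_mul_mutualForce (a : Fin n → ℝ) (b : ι → Fin n → ℝ) (θ : ℝ) (Y : ι → ℂ × ℂ)
    (j : Fin n) : Complex.exp (θ * Complex.I) * mutualForce a b Y j =
      ∑ i, grav (bodyPos a b θ Y i - bodyPos a b θ Y j) := by
  rw [mutualForce, Finset.mul_sum]
  refine Finset.sum_congr rfl fun i _ => ?_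
  rw [bodyPos, bodyPos, ← mul_sub, grav_mul (Complex.norm_exp_ofReal_mul_I θ)]

theorem IsModalBasis.exp_mul_sum_tidalMode (hb : IsModalBasis a b lam k₀ α) (hn : (n : ℂ) ≠ 0)
    (κ t θ : ℝ) (Y : ι → ℂ × ℂ) (δ : ℂ) (j : Fin n) :
    Complex.exp (θ * Complex.I) * ∑ k, (b k j : ℂ) * tidalMode a b κ t θ Y δ k =
      grav (outerPos t δ - κ * bodyPos a b θ Y j) -
        (n : ℂ)⁻¹ * ∑ i, grav (outerPos t δ - κ * bodyPos a b θ Y i) := by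
  have h : ∑ k, (b k j : ℂ) * tidalMode a b κ t θ Y δ k =
      Complex.exp (-θ * Complex.I) * (∑ k, (b k j : ℂ) *
        ∑ i, (b k i : ℂ) * tidalForce a b κ t θ Y δ i) := by
    rw [Finset.mul_sum]
    exact Finset.sum_congr rfl fun k _ => by rw [tidalMode]; ring
  rw [h, ← mul_assoc, ← Complex.exp_add, hb.sum_mul_sum]
  simp only [tidalForce, Finset.sum_sub_distrib, Finset.sum_const, Finset.card_univ,
    Fintype.card_fin, nsmul_eq_mul]
  rw [neg_mul, add_neg_cancel, Complex.exp_zero]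
  field_simp
  ring

omit [DecidableEq ι] in
theorem outerLin_add_outerPert (hn : (n : ℂ) ≠ 0) (a : Fin n → ℝ) (b : ι → Fin n → ℝ) (κ : ℝ → ℝ)
    (μ t θ : ℝ) (Y : ι → ℂ × ℂ) (δ : ℂ) :
    outerLin t δ + outerPert a b κ μ (t, θ, Y, δ) = ((2 / 9 * t ^ (-(4 / 3) : ℝ) : ℝ) : ℂ) -
      (2 / 9) * ((n : ℂ)⁻¹ * ∑ i, grav (outerPos t δ - κ μ * bodyPos a b θ Y i)) := by
  have h : outerLin t δ = -(2 / 9) * (((t ^ (-2 : ℝ) : ℝ) : ℂ) * gravDeriv δ) := by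
    have e : (-(2 / 9) : ℂ) = ((-(2 / 9) : ℝ) : ℂ) := by push_cast; rfl
    rw [e]
    apply Complex.ext <;> simp only [outerLin, gravDeriv, Complex.re_ofReal_mul,
      Complex.im_ofReal_mul] <;> ring
  rw [h, outerPert]
  simp only [tidalForce, Finset.sum_sub_distrib, Finset.sum_const, Finset.card_univ,
    Fintype.card_fin, nsmul_eq_mul, keplerRemainder]
  rw [mul_sub, inv_mul_cancel_left₀ hn]
  push_cast
  ring

theorem hasDerivAt_outerPos {δ : ℝ → ℂ} {d : ℂ} {t : ℝ} (ht : 0 < t) (h : HasDerivAt δ d t) :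
    HasDerivAt (fun s => outerPos s (δ s)) (((2 / 3 * t ^ (-(1 / 3) : ℝ) : ℝ) : ℂ) + d) t :=
  (hasDerivAt_rpow' ht _ _ (by norm_num)).ofReal_comp.add h

theorem hasDerivAt_velocity_outerPos {ε : ℝ → ℂ} {d : ℂ} {t : ℝ} (ht : 0 < t)
    (h : HasDerivAt ε d t) :
    HasDerivAt (fun s => ((2 / 3 * s ^ (-(1 / 3) : ℝ) : ℝ) : ℂ) + ε s)
      (((-(2 / 9) * t ^ (-(4 / 3) : ℝ) : ℝ) : ℂ) + d) t := by
  refine ((((hasDerivAt_rpow' ht (-(1 / 3)) (-(4 / 3)) (by norm_num)).const_mul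
    (2 / 3 : ℝ)).congr_deriv ?_).ofReal_comp).add h
  ring

end Dynamics

section Assembly

variable {n : ℕ}

/-- The isometry between the complex plane and the Euclidean plane. -/
def planeEquiv : ℂ ≃ₗᵢ[ℝ] Plane := Complex.orthonormalBasisOneI.repr

theorem planeEquiv_grav (m : ℝ) (z w : ℂ) :
    (m / ‖planeEquiv z - planeEquiv w‖ ^ 3) • (planeEquiv z - planeEquiv w) =
      planeEquiv (m * grav (z - w)) := by
  rw [← map_sub, LinearIsometryEquiv.norm_map, ← map_smul, grav, ← Complex.real_smul, smul_smul,
    div_eq_mul_inv]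

theorem newtonAccel_eq_sum (m : Fin (n + 1) → ℝ) (z : ℝ → Fin (n + 1) → ℂ) (t : ℝ)
    (i : Fin (n + 1)) : newtonAccel m (fun s j => planeEquiv (z s j)) t i =
      planeEquiv (∑ j, m j * grav (z t j - z t i)) := by
  rw [newtonAccel, map_sum, ← Finset.add_sum_erase _ _ (Finset.mem_univ i)]
  simp_rw [planeEquiv_grav]
  simp [grav_zero]

theorem centerMassOthers_eq (m : Fin (n + 1) → ℝ) (hm : ∀ i : Fin n, m i.castSucc = 1)
    (hn : n ≠ 0) (X : ℂ) (r : Fin n → ℂ) (hr : ∑ i, r i = 0) (z : ℝ → Fin (n + 1) → ℂ) (t : ℝ)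
    (hz : ∀ i : Fin n, z t i.castSucc = X + r i) :
    centerMassOthers m (fun s j => planeEquiv (z s j)) t = planeEquiv X := by
  have h : ∀ {M : Type} [AddCommMonoid M] (f : Fin (n + 1) → M),
      ∑ j ∈ Finset.univ.erase (Fin.last n), f j = ∑ j : Fin n, f j.castSucc := fun f => by
    rw [← Finset.compl_singleton, ← Fin.image_castSucc,
      Finset.sum_image (Fin.castSucc_injective n).injOn]
  rw [centerMassOthers, h, h]
  simp_rw [hm, hz, one_smul]
  rw [← map_sum, Finset.sum_add_distrib, hr, add_zero, ← map_smul]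
  congr 1
  simp [hn]

end Assembly

end ParabolicBounded

namespace ParabolicBounded

theorem exists_newton_of_jacobi {n : ℕ} (hn : n ≠ 0) {μ T M : ℝ} (hμ : 0 < μ)
    {r p : ℝ → Fin n → ℂ} {R V : ℝ → ℂ}
    (hr : ∀ t, T ≤ t → ∀ i, HasDerivAt (fun s => r s i) (p t i) t)
    (hp : ∀ t, T ≤ t → ∀ i, HasDerivAt (fun s => p s i) (∑ j, grav (r t j - r t i) +
      μ * (grav (R t - r t i) - (n : ℂ)⁻¹ * ∑ j, grav (R t - r t j))) t)
    (hR : ∀ t, T ≤ t → HasDerivAt R (V t) t)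
    (hV : ∀ t, T ≤ t → HasDerivAt V (-((n + μ) / n * ∑ j, grav (R t - r t j))) t)
    (hr0 : ∀ t, ∑ i, r t i = 0) (hp0 : ∀ t, ∑ i, p t i = 0)
    (hrr : ∀ t, T ≤ t → ∀ i j, i ≠ j → r t i ≠ r t j)
    (hRr : ∀ t, T ≤ t → ∀ i, R t - r t i ≠ 0)
    (hRtop : Tendsto (fun t => ‖R t‖) atTop atTop) (hV0 : Tendsto V atTop (nhds 0))
    (hM : ∀ t, T ≤ t → ∀ i, ‖r t i‖ ≤ M) :
    ∃ m : Fin (n + 1) → ℝ, (∀ i, 0 < m i) ∧ ∃ q v : ℝ → Fin (n + 1) → Plane,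
      (∀ t : ℝ, 0 ≤ t → ∀ i j, i ≠ j → q t i ≠ q t j) ∧
      (∀ t : ℝ, 0 ≤ t → ∀ i, HasDerivAt (fun s => q s i) (v t i) t ∧
        HasDerivAt (fun s => v s i) (newtonAccel m q t i) t) ∧
      Tendsto (fun t => ‖q t (Fin.last n) - centerMassOthers m q t‖) atTop atTop ∧
      Tendsto (fun t => ‖v t (Fin.last n) - centerMassOthers m v t‖) atTop (nhds 0) ∧
      (∃ C : ℝ, ∀ t : ℝ, 0 ≤ t → ∀ i, i ≠ Fin.last n →
        ‖q t i - centerMassOthers m q t‖ ≤ C) := by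
  set ν : ℂ := μ / (n + μ) with hν
  obtain ⟨m, hm1, hm2⟩ : ∃ m : Fin (n + 1) → ℝ, (∀ i : Fin n, m i.castSucc = 1) ∧
      m (Fin.last n) = μ := ⟨Fin.snoc (fun _ => 1) μ, fun i => by simp, by simp⟩
  obtain ⟨join, hj1, hj2⟩ : ∃ join : (ℝ → Fin n → ℂ) → (ℝ → ℂ) → ℝ → Fin (n + 1) → ℂ,
      (∀ f g t (i : Fin n), join f g t i.castSucc = -ν * g (t + T) + f (t + T) i) ∧
      ∀ f g t, join f g t (Fin.last n) = -ν * g (t + T) + g (t + T) :=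
    ⟨fun f g t => Fin.snoc (fun i => -ν * g (t + T) + f (t + T) i) (-ν * g (t + T) + g (t + T)),
      fun f g t i => by simp, fun f g t => by simp⟩
  have hcm : ∀ f g, (∀ t, ∑ i, f t i = 0) → ∀ t,
      centerMassOthers m (fun s j => planeEquiv (join f g s j)) t =
        planeEquiv (-ν * g (t + T)) := fun f g hf t =>
    centerMassOthers_eq m hm1 hn _ _ (hf (t + T)) _ _ (hj1 f g t)
  have hJ : ∀ {f : ℝ → ℂ} {d : ℂ} {t : ℝ}, HasDerivAt f d (t + T) →
      HasDerivAt (fun s => planeEquiv (f (s + T))) (planeEquiv d) t := fun h =>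
    (planeEquiv.toContinuousLinearEquiv : ℂ →L[ℝ] Plane).hasFDerivAt.comp_hasDerivAt _
      (h.comp_add_const _ _)
  have hadd : Tendsto (fun t : ℝ => t + T) atTop atTop :=
    tendsto_atTop_add_const_right _ _ tendsto_id
  have hnμ : (n : ℂ) + μ ≠ 0 := by
    have : (0 : ℝ) < n + μ := by positivity
    exact_mod_cast this.ne'
  have hnc : (n : ℂ) ≠ 0 := Nat.cast_ne_zero.2 hn
  refine ⟨m, fun i => ?_, fun t j => planeEquiv (join r R t j),
    fun t j => planeEquiv (join p V t j), fun t ht i j hij h => ?_,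
    fun t ht i => ?_, ?_, ?_, M, fun t ht i hi => ?_⟩
  · induction i using Fin.lastCases with
    | last => rwa [hm2]
    | cast i => rw [hm1]; exact one_pos
  · have hT : T ≤ t + T := by linarith
    have h' := planeEquiv.injective h
    induction i using Fin.lastCases with
    | last =>
      induction j using Fin.lastCases with
      | last => exact hij rfl
      | cast j =>
        rw [hj1, hj2] at h'
        exact hRr _ hT j (sub_eq_zero.2 (add_left_cancel h'))
    | cast i =>
      induction j using Fin.lastCases with
      | last =>
        rw [hj1, hj2] at h'
        exact hRr _ hT i (sub_eq_zero.2 (add_left_cancel h').symm)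
      | cast j =>
        rw [hj1, hj1] at h'
        exact hrr _ hT i j (fun e => hij (by rw [e])) (add_left_cancel h')
  · have hT : T ≤ t + T := by linarith
    rw [newtonAccel_eq_sum, Fin.sum_univ_castSucc]
    simp only [hm1, hm2]
    induction i using Fin.lastCases with
    | last =>
      simp only [hj1, hj2]
      refine ⟨hJ (f := fun s => -ν * R s + R s) (((hR _ hT).const_mul (-ν)).add (hR _ hT)), ?_⟩
      refine (hJ (f := fun s => -ν * V s + V s)
        (((hV _ hT).const_mul (-ν)).add (hV _ hT))).congr_deriv ?_
      have e : ∀ j, grav (-ν * R (t + T) + r (t + T) j - (-ν * R (t + T) + R (t + T))) =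
          -grav (R (t + T) - r (t + T) j) := fun j => by
        rw [← grav_neg]; congr 1; ring
      simp only [e, sub_self, grav_zero, Complex.ofReal_one, one_mul, mul_zero, add_zero,
        Finset.sum_neg_distrib]
      congr 1
      rw [hν]
      field_simp
      ring
    | cast i =>
      simp only [hj1, hj2]
      refine ⟨hJ (f := fun s => -ν * R s + r s i) (((hR _ hT).const_mul (-ν)).add (hr _ hT i)), ?_⟩
      refine (hJ (f := fun s => -ν * V s + p s i)
        (((hV _ hT).const_mul (-ν)).add (hp _ hT i))).congr_deriv ?_
      simp only [add_sub_add_left_eq_sub, Complex.ofReal_one, one_mul]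
      congr 1
      rw [hν]
      field_simp
      ring
  · simp only [hcm r R hr0, hj2]
    refine (hRtop.comp hadd).congr fun t => ?_
    rw [← map_sub, LinearIsometryEquiv.norm_map, add_sub_cancel_left, Function.comp]
  · simp only [hcm p V hp0, hj2]
    refine ((hV0.norm.comp hadd).congr fun t => ?_).trans (by simp)
    rw [← map_sub, LinearIsometryEquiv.norm_map, add_sub_cancel_left, Function.comp]
  · simp only [hcm r R hr0]
    induction i using Fin.lastCases with
    | last => exact absurd rfl hi
    | cast i =>
      rw [hj1, ← map_sub, LinearIsometryEquiv.norm_map, add_sub_cancel_left]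
      exact hM _ (by linarith) i

end ParabolicBounded

open ParabolicBounded in
/-- **Existence of parabolic-bounded motions** (Claim after Theorem 3.2 of
Baldomá–Fontich–Martín). For any `n ≥ 2`, the planar `(n+1)`-body problem has
parabolic-bounded motions: solutions defined for all forward time such that the
position of one of the bodies relative to the center of mass of the others goes
to infinity with velocity tending to zero, while the remaining bodies stay at a
bounded distance from their center of mass. -/
theorem parabolic_bounded_motions (n : ℕ) (hn : 2 ≤ n) :
    ∃ m : Fin (n + 1) → ℝ, (∀ i, 0 < m i) ∧
    ∃ q v : ℝ → Fin (n + 1) → Plane,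
      -- the solution is collisionless, hence defined, for all forward time
      (∀ t : ℝ, 0 ≤ t → ∀ i j, i ≠ j → q t i ≠ q t j) ∧
      -- Newton's equations of the planar (n+1)-body problem
      (∀ t : ℝ, 0 ≤ t → ∀ i,
        HasDerivAt (fun s => q s i) (v t i) t ∧
        HasDerivAt (fun s => v s i) (newtonAccel m q t i) t) ∧
      -- the last body escapes to infinity relative to the center of mass of
      -- the others ...
      Tendsto (fun t => ‖q t (Fin.last n) - centerMassOthers m q t‖) atTop atTop ∧
      -- ... with relative velocity tending to zero (parabolic escape)
      Tendsto (fun t => ‖v t (Fin.last n) - centerMassOthers m v t‖) atTop (nhds 0) ∧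
      -- the remaining bodies perform a bounded motion around their center of mass
      (∃ C : ℝ, ∀ t : ℝ, 0 ≤ t → ∀ i, i ≠ Fin.last n →
        ‖q t i - centerMassOthers m q t‖ ≤ C) := by
  have hn0 : n ≠ 0 := by omega
  have hn1 : (1 : ℝ) ≤ n := by exact_mod_cast (by omega : 1 ≤ n)
  have hnc : (n : ℂ) ≠ 0 := Nat.cast_ne_zero.2 hn0
  obtain ⟨a, ha⟩ := exists_isCollinearEquilibrium n
  obtain ⟨d, b, lam, k₀, α, hb⟩ := exists_isModalBasis ha hn
  set κ : ℝ → ℝ := fun μ => ((9 * (n + μ) / 2) ^ (1 / 3 : ℝ))⁻¹ with hκ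
  obtain ⟨C, t₁, hC, ht₁, hF, hne⟩ := exists_isTidal ha hb (κ := κ)
    (fun μ hμ => by positivity)
    (fun μ hμ => inv_le_one_of_one_le₀ (Real.one_le_rpow (by linarith) (by norm_num)))
  obtain ⟨μ, hμ, -, t₀, -, ht₀, θ, Y, δ, ε, H, hε⟩ :=
    exists_parabolic_torus_motion (hasGreen_innerLin hb) hC hF
  set c : ℝ := (9 * (n + μ) / 2) ^ (1 / 3 : ℝ) with hc
  have hc0 : 0 < c := by positivity
  have hc3 : c ^ 3 = 9 * (n + μ) / 2 := by
    rw [hc, ← Real.rpow_natCast, ← Real.rpow_mul (by positivity)]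
    norm_num
  have hκc : κ μ = c⁻¹ := rfl
  have hY0 : Tendsto Y atTop (nhds 0) := by
    refine squeeze_zero_norm' ?_ (tendsto_rpow_neg_atTop one_pos)
    filter_upwards [eventually_gt_atTop t₀] with t ht using (H t ht).1.2.1
  have hinj : ∀ᶠ t in atTop, ∀ i j, i ≠ j → shape a b (Y t) i ≠ shape a b (Y t) j := by
    simp only [eventually_all]
    intro i j hij
    have h : ∀ l, Tendsto (fun t => shape a b (Y t) l) atTop (nhds (a l : ℂ)) := fun l => by
      rw [← shape_zero a b l]
      exact ((contDiff_shape a b l).continuous.tendsto 0).comp hY0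
    have hne' : (a i : ℂ) - a j ≠ 0 :=
      sub_ne_zero.2 (by exact_mod_cast ha.strictMono.injective.ne hij)
    exact (((h i).sub (h j)).eventually_ne hne').mono fun t ht => sub_ne_zero.1 ht
  obtain ⟨T', hT'⟩ := eventually_atTop.1 hinj
  set T := max T' (t₀ + 1) with hT
  have hTt : ∀ t, T ≤ t → t₀ < t := fun t ht => by
    linarith [le_max_right T' (t₀ + 1)]
  have hgrav : ∀ t i, grav (c * outerPos t (δ t) - bodyPos a b (θ t) (Y t) i) =
      ((c ^ 2)⁻¹ : ℝ) * grav (outerPos t (δ t) - κ μ * bodyPos a b (θ t) (Y t) i) := fun t i => by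
    rw [← grav_smul hc0, hκc, mul_sub, ← mul_assoc, ← Complex.ofReal_mul,
      mul_inv_cancel₀ hc0.ne', Complex.ofReal_one, one_mul]
  have hYd : ∀ t, T ≤ t → HasDerivAt Y (innerField a b k₀ α (Y t) + fun k => (0,
      ((μ * κ μ ^ 2 : ℝ) : ℂ) * tidalMode a b (κ μ) t (θ t) (Y t) (δ t) k)) t := fun t ht => by
    refine (H t (hTt t ht)).2.2.1.congr_deriv ?_
    simp only [innerPert]
    abel
  obtain ⟨M, hM1, hM⟩ := exists_norm_bodyPos_le a b
  refine exists_newton_of_jacobi (T := T) (M := M) hn0 hμ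
    (r := fun t i => bodyPos a b (θ t) (Y t) i)
    (p := fun t i => Complex.exp (θ t * Complex.I) * momentum a b (Y t) i)
    (R := fun t => c * outerPos t (δ t))
    (V := fun t => c * (((2 / 3 * t ^ (-(1 / 3) : ℝ) : ℝ) : ℂ) + ε t))
    (fun t ht i => hb.hasDerivAt_bodyPos ha (H t (hTt t ht)).2.1 (hYd t ht) i)
    (fun t ht i => (hb.hasDerivAt_momentum ha (H t (hTt t ht)).2.1 (hYd t ht) i).congr_deriv ?_)
    (fun t ht => (hasDerivAt_outerPos (by linarith [hTt t ht])
      (H t (hTt t ht)).2.2.2.1).const_mul _)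
    (fun t ht => ((hasDerivAt_velocity_outerPos (by linarith [hTt t ht])
      (H t (hTt t ht)).2.2.2.2).const_mul _).congr_deriv ?_)
    (fun t => ?_) (fun t => ?_) (fun t ht i j hij h => ?_) (fun t ht i => ?_) ?_ ?_
    (fun t ht i => ?_)
  · have e : ∑ k, (b k i : ℂ) * (((μ * κ μ ^ 2 : ℝ) : ℂ) *
        tidalMode a b (κ μ) t (θ t) (Y t) (δ t) k) = ((μ * κ μ ^ 2 : ℝ) : ℂ) *
        ∑ k, (b k i : ℂ) * tidalMode a b (κ μ) t (θ t) (Y t) (δ t) k := by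
      rw [Finset.mul_sum]
      exact Finset.sum_congr rfl fun k _ => by ring
    rw [e, mul_add, exp_mul_mutualForce, mul_left_comm, hb.exp_mul_sum_tidalMode hnc]
    simp only [hgrav, ← Finset.mul_sum, hκc]
    push_cast
    ring
  · rw [outerLin_add_outerPert hnc]
    simp only [hgrav, ← Finset.mul_sum]
    have hc3' : (c : ℂ) ^ 3 = 9 * (n + μ) / 2 := by exact_mod_cast congrArg Complex.ofReal hc3
    have hcc : (c : ℂ) ≠ 0 := by exact_mod_cast hc0.ne'
    have e : ((n : ℂ) + μ) = 2 / 9 * (c : ℂ) ^ 3 := by rw [hc3']; ring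
    rw [e]
    push_cast
    field_simp
    ring
  · simp_rw [bodyPos, ← Finset.mul_sum, hb.sum_shape ha, mul_zero]
  · simp_rw [← Finset.mul_sum, hb.sum_momentum ha, mul_zero]
  · exact hT' t ((le_max_left _ _).trans ht) i j hij (mul_left_cancel₀ (Complex.exp_ne_zero _) h)
  · have h1 := hne μ hμ i t (θ t) (Y t) (δ t) (H t (hTt t ht)).1
    have hcc : (c : ℂ) ≠ 0 := by exact_mod_cast hc0.ne'
    have e : (c : ℂ) * outerPos t (δ t) - bodyPos a b (θ t) (Y t) i =
        c * (outerPos t (δ t) - κ μ * bodyPos a b (θ t) (Y t) i) := by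
      rw [hκc, mul_sub, ← mul_assoc, ← Complex.ofReal_mul, mul_inv_cancel₀ hc0.ne',
        Complex.ofReal_one, one_mul]
    rw [e]
    exact mul_ne_zero hcc h1
  · have h1 : Tendsto (fun t : ℝ => c * (t ^ (1 / 4 : ℝ) * (t ^ (5 / 12 : ℝ) - 1))) atTop atTop :=
      ((tendsto_rpow_atTop (by norm_num)).atTop_mul_atTop₀ (tendsto_atTop_add_const_right _ (-1)
        (tendsto_rpow_atTop (by norm_num)))).const_mul_atTop hc0
    refine tendsto_atTop_mono' _ ?_ h1
    filter_upwards [eventually_gt_atTop t₀] with t ht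
    have ht0 : 0 < t := by linarith
    have hδ : ‖δ t‖ ≤ t ^ (1 / 4 : ℝ) := (H t ht).1.2.2
    rw [norm_mul, Complex.norm_real, Real.norm_of_nonneg hc0.le, mul_sub, ← Real.rpow_add ht0,
      mul_one]
    refine mul_le_mul_of_nonneg_left ?_ hc0.le
    have h2 := norm_sub_le (outerPos t (δ t)) (δ t)
    rw [outerPos, add_sub_cancel_right, Complex.norm_real,
      Real.norm_of_nonneg (by positivity)] at h2
    norm_num at *
    rw [outerPos]
    norm_num
    linarith
  · have h1 : Tendsto (fun t : ℝ => 2 / 3 * t ^ (-(1 / 3) : ℝ)) atTop (nhds 0) := by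
      simpa using (tendsto_rpow_neg_atTop (by norm_num : (0 : ℝ) < 1 / 3)).const_mul (2 / 3)
    have h2 := (((Complex.continuous_ofReal.tendsto 0).comp h1).add hε).const_mul (c : ℂ)
    simpa using h2
  · have ht' := hTt t ht
    refine (hM i (θ t) (θ t) (Y t) (Y t) ((H t ht').1.2.1.trans ?_)).1
    exact Real.rpow_le_one_of_one_le_of_nonpos (by linarith) (by norm_num)
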